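/- arXiv:0706.1765 — 2 statements merged into one kernel-verified Lean document; each statement's English description precedes it below -/
import Mathlib

section
/- Fix r ∈ ℕ and let i ∈ {1, 2}. Then Σ_{n ≤ x} Λ₂(n) f_i(n) = (r² + r) x (log x) (1 + O(1/log x)) as x → ∞. -/
open Filter Finset

/-- `τ_r(n)`, the `r`-th divisor function: the number of ordered `r`-tuples of positive
integers whose product is `n`; equivalently the coefficient of `n^{-s}` in `ζ(s)^r`. -/
noncomputable def tauR (r n : ℕ) : ℕ := (ArithmeticFunction.zeta ^ r : ArithmeticFunction ℕ) n

/-- The second generalized von Mangoldt function `Λ₂ = μ * log²`, i.e.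
`Λ₂(n) = Σ_{d | n} μ(d) (log(n/d))²`. -/
noncomputable def vonMangoldtTwo (n : ℕ) : ℝ :=
  ∑ d ∈ n.divisors, (ArithmeticFunction.moebius d : ℝ) * Real.log ((n : ℝ) / d) ^ 2

/-- The multiplicative function `f₁` determined on prime powers by
`f₁(p^e) = (Σ_{j≥0} τ_r(p^{e+j})/p^j) / (Σ_{j≥0} τ_r(p^j)/p^j)`. -/
noncomputable def fOne (r n : ℕ) : ℝ :=
  ∏ p ∈ n.primeFactors,
    (∑' j : ℕ, (tauR r (p ^ (n.factorization p + j)) : ℝ) / p ^ j) /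
      (∑' j : ℕ, (tauR r (p ^ j) : ℝ) / p ^ j)

/-- The multiplicative function `f₂` determined on prime powers by
`f₂(p^e) = (Σ_{j≥0} τ_r(p^{e+j}) τ_r(p^j)/p^j) / (Σ_{j≥0} τ_r(p^j)²/p^j)`. -/
noncomputable def fTwo (r n : ℕ) : ℝ :=
  ∏ p ∈ n.primeFactors,
    (∑' j : ℕ, ((tauR r (p ^ (n.factorization p + j)) : ℝ) * tauR r (p ^ j)) / p ^ j) /
      (∑' j : ℕ, ((tauR r (p ^ j) : ℝ)) ^ 2 / p ^ j)

/-- The Euler–Maclaurin remainder of `(s - 1) ζ(s)` on the interval `[n, n + 1]`. -/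
noncomputable def zetaRemainder (n : ℕ) (s : ℂ) : ℂ :=
  (s - 1) * ((n + 1 : ℕ) : ℂ) ^ (-s) + ((n + 1 : ℕ) : ℂ) ^ (1 - s) - (n : ℂ) ^ (1 - s)

lemma norm_zetaRemainder_le {n : ℕ} (hn : 1 ≤ n) {s : ℂ} (hs : 0 < s.re) :
    ‖zetaRemainder n s‖ ≤ ‖s‖ * ‖s - 1‖ * (n : ℝ) ^ (-s.re - 1) := by
  have hn0 : (0 : ℝ) < n := by exact_mod_cast hn
  set G : ℝ → ℂ := fun v => (s - 1) * ((v : ℂ) - n) * (v : ℂ) ^ (-s) + (v : ℂ) ^ (1 - s)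
  have hG : ∀ v ∈ Set.Icc (n : ℝ) (n + 1), HasDerivWithinAt G
      (-s * (s - 1) * ((v : ℂ) - n) * (v : ℂ) ^ (-s - 1)) (Set.Icc (n : ℝ) (n + 1)) v := by
    intro v hv
    have hv0 : 0 < v := hn0.trans_le hv.1
    have h1 : HasDerivAt (fun v : ℝ => (v : ℂ) ^ (-s)) (-s * (v : ℂ) ^ (-s - 1)) v := by
      have := (hasDerivAt_ofReal_cpow_const' (x := v) (r := -s - 1) hv0.ne' (by
        intro h; have := congrArg Complex.re h; simp at this; linarith)).const_mul (-s)
      rcases eq_or_ne s 0 with rfl | hs0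
      · simp at hs
      · refine this.congr_of_eventuallyEq (Eventually.of_forall fun y => ?_)
        simp; field_simp
    have h2 : HasDerivAt (fun v : ℝ => (v : ℂ) ^ (1 - s)) ((1 - s) * (v : ℂ) ^ (-s)) v := by
      rcases eq_or_ne s 1 with rfl | hs1
      · simpa using hasDerivAt_const v (1 : ℂ)
      · have := (hasDerivAt_ofReal_cpow_const' (x := v) (r := -s) hv0.ne' (by
          intro h; exact hs1 (neg_injective h))).const_mul (1 - s)
        refine this.congr_of_eventuallyEq (Eventually.of_forall fun y => ?_)
        have : (1 - s) ≠ 0 := sub_ne_zero.mpr (Ne.symm hs1)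
        have h3 : -s + 1 = 1 - s := by ring
        simp only [h3]; field_simp
    have h3 : HasDerivAt (fun v : ℝ => (s - 1) * ((v : ℂ) - n)) (s - 1) v := by
      simpa using ((Complex.ofRealCLM.hasDerivAt (x := v)).sub_const (n : ℂ)).const_mul (s - 1)
    have := ((h3.mul h1).add h2).hasDerivWithinAt (s := Set.Icc (n : ℝ) (n + 1))
    refine this.congr_deriv ?_
    ring
  have hb : ∀ v ∈ Set.Ico (n : ℝ) (n + 1),
      ‖-s * (s - 1) * ((v : ℂ) - n) * (v : ℂ) ^ (-s - 1)‖ ≤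
        ‖s‖ * ‖s - 1‖ * (n : ℝ) ^ (-s.re - 1) := by
    intro v hv
    have hv0 : 0 < v := hn0.trans_le hv.1
    rw [norm_mul, norm_mul, norm_mul, norm_neg, Complex.norm_cpow_eq_rpow_re_of_pos hv0]
    have h1 : ‖(v : ℂ) - n‖ ≤ 1 := by
      rw [← Complex.ofReal_natCast, ← Complex.ofReal_sub, Complex.norm_real, Real.norm_eq_abs,
        abs_le]
      constructor <;> linarith [hv.1, hv.2]
    have h2 : v ^ (-s - 1).re ≤ (n : ℝ) ^ (-s.re - 1) := by
      simp only [Complex.sub_re, Complex.neg_re, Complex.one_re]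
      exact Real.rpow_le_rpow_of_nonpos hn0 hv.1 (by linarith)
    calc _ ≤ ‖s‖ * ‖s - 1‖ * 1 * (n : ℝ) ^ (-s.re - 1) := by gcongr
      _ = _ := by ring
  have := norm_image_sub_le_of_norm_deriv_le_segment' hG hb (n + 1) (by simp)
  have e : G (n + 1) - G n = zetaRemainder n s := by
    simp [G, zetaRemainder]
  rw [← e]
  simpa using this

lemma norm_zetaRemainder_le_of_half_le {N m : ℕ} (hN : 1 ≤ N) (hm : N ≤ m) {s : ℂ}
    (hs : 1 / 2 ≤ s.re) :
    ‖zetaRemainder m s‖ ≤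
      ‖s‖ * ‖s - 1‖ * (N : ℝ) ^ (-(1 / 4 : ℝ)) * (m : ℝ) ^ (-(5 / 4 : ℝ)) := by
  refine (norm_zetaRemainder_le (hN.trans hm) (by linarith)).trans ?_
  have hN0 : (0 : ℝ) < N := by exact_mod_cast hN
  have hm1 : (1 : ℝ) ≤ m := by exact_mod_cast hN.trans hm
  rw [mul_assoc (‖s‖ * ‖s - 1‖)]
  gcongr
  calc (m : ℝ) ^ (-s.re - 1) ≤ (m : ℝ) ^ (-(1 / 4 : ℝ) + -(5 / 4)) :=
        Real.rpow_le_rpow_of_exponent_le hm1 (by linarith)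
    _ = (m : ℝ) ^ (-(1 / 4 : ℝ)) * (m : ℝ) ^ (-(5 / 4 : ℝ)) := Real.rpow_add (by linarith) _ _
    _ ≤ _ := by
        gcongr ?_ * _
        exact Real.rpow_le_rpow_of_nonpos hN0 (by exact_mod_cast hm) (by norm_num)

lemma summable_nat_add_rpow_neg_five_quarters (N : ℕ) :
    Summable fun k : ℕ => ((N + k : ℕ) : ℝ) ^ (-(5 / 4 : ℝ)) := by
  have : Summable fun k : ℕ => (k : ℝ) ^ (-(5 / 4 : ℝ)) :=
    Real.summable_nat_rpow.mpr (by norm_num)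
  have := (summable_nat_add_iff N).mpr this
  simpa [add_comm] using this

lemma summable_zetaRemainder {N : ℕ} (hN : 1 ≤ N) {s : ℂ} (hs : 1 / 2 ≤ s.re) :
    Summable fun k : ℕ => zetaRemainder (N + k) s :=
  Summable.of_norm_bounded ((summable_nat_add_rpow_neg_five_quarters N).mul_left _)
    fun k => norm_zetaRemainder_le_of_half_le hN (by omega) hs

lemma differentiable_zetaRemainder {n : ℕ} (hn : 1 ≤ n) : Differentiable ℂ (zetaRemainder n) := by
  intro s
  have h : (n : ℂ) ≠ 0 := by exact_mod_cast (by omega : n ≠ 0)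
  have h' : ((n + 1 : ℕ) : ℂ) ≠ 0 := by exact_mod_cast (by omega : n + 1 ≠ 0)
  unfold zetaRemainder
  have h1 : DifferentiableAt ℂ (fun s : ℂ => ((n + 1 : ℕ) : ℂ) ^ (-s)) s :=
    (differentiableAt_id.neg).const_cpow (Or.inl h')
  have h2 : DifferentiableAt ℂ (fun s : ℂ => ((n + 1 : ℕ) : ℂ) ^ (1 - s)) s :=
    (differentiableAt_id.const_sub _).const_cpow (Or.inl h')
  have h3 : DifferentiableAt ℂ (fun s : ℂ => (n : ℂ) ^ (1 - s)) s :=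
    (differentiableAt_id.const_sub _).const_cpow (Or.inl h)
  exact (((differentiableAt_id.sub_const 1).mul h1).add h2).sub h3

lemma sum_range_zetaRemainder (N K : ℕ) (s : ℂ) :
    ∑ k ∈ range K, zetaRemainder (N + k) s =
      (s - 1) * (∑ n ∈ range (N + K), ((n + 1 : ℕ) : ℂ) ^ (-s) -
        ∑ n ∈ range N, ((n + 1 : ℕ) : ℂ) ^ (-s)) + ((N + K : ℕ) : ℂ) ^ (1 - s) -
        (N : ℂ) ^ (1 - s) := by
  induction K with
  | zero => simp
  | succ K ih =>
    rw [sum_range_succ, ih, ← add_assoc, sum_range_succ, zetaRemainder]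
    ring

lemma tendsto_sum_range_zeta {s : ℂ} (hs : 1 < s.re) :
    Tendsto (fun K : ℕ => ∑ n ∈ range K, ((n + 1 : ℕ) : ℂ) ^ (-s)) atTop
      (nhds (riemannZeta s)) := by
  rw [zeta_eq_tsum_one_div_nat_add_one_cpow hs]
  have : Summable fun n : ℕ => 1 / ((n : ℂ) + 1) ^ s := by
    have := (summable_nat_add_iff 1).mpr (Complex.summable_one_div_nat_cpow.mpr hs)
    simpa using this
  refine this.hasSum.tendsto_sum_nat.congr fun K => sum_congr rfl fun n _ => ?_
  rw [Complex.cpow_neg]; simp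

lemma riemannZeta₁_eq_of_one_lt_re {N : ℕ} (hN : 1 ≤ N) {s : ℂ} (hs : 1 < s.re) :
    riemannZeta₁ s = (s - 1) * ∑ n ∈ range N, ((n + 1 : ℕ) : ℂ) ^ (-s) + (N : ℂ) ^ (1 - s) +
      ∑' k, zetaRemainder (N + k) s := by
  have h1 := (summable_zetaRemainder hN (s := s) (by linarith)).hasSum.tendsto_sum_nat
  have h0 : Tendsto (fun K : ℕ => N + K) atTop atTop := tendsto_add_atTop_nat N |>.congr
    fun K => by ring
  have h2 : Tendsto (fun K : ℕ => ((N + K : ℕ) : ℂ) ^ (1 - s)) atTop (nhds 0) := by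
    rw [tendsto_zero_iff_norm_tendsto_zero]
    have : Tendsto (fun K : ℕ => ((N + K : ℕ) : ℝ) ^ (-(s.re - 1))) atTop (nhds 0) :=
      (tendsto_rpow_neg_atTop (by linarith)).comp (tendsto_natCast_atTop_atTop.comp h0)
    refine this.congr fun K => ?_
    rw [Complex.norm_natCast_cpow_of_pos (by omega)]
    simp
  have h3 := ((((tendsto_sum_range_zeta hs).comp h0).sub_const
    (∑ n ∈ range N, ((n + 1 : ℕ) : ℂ) ^ (-s))).const_mul (s - 1)).add h2 |>.sub_const
      ((N : ℂ) ^ (1 - s))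
  have h4 := tendsto_nhds_unique h1 (h3.congr fun K => by
    simpa using (sum_range_zetaRemainder N K s).symm)
  have hs1 : s ≠ 1 := by rintro rfl; simp at hs
  rw [h4, riemannZeta_eq_inv_sub_mul hs1]
  have : s - 1 ≠ 0 := sub_ne_zero.mpr hs1
  field_simp
  ring

lemma riemannZeta₁_eq_of_half_lt_re {N : ℕ} (hN : 1 ≤ N) {s : ℂ} (hs : 1 / 2 < s.re) :
    riemannZeta₁ s = (s - 1) * ∑ n ∈ range N, ((n + 1 : ℕ) : ℂ) ^ (-s) + (N : ℂ) ^ (1 - s) +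
      ∑' k, zetaRemainder (N + k) s := by
  set U : Set ℂ := {s | 1 / 2 < s.re}
  have hU : IsOpen U := isOpen_lt continuous_const Complex.continuous_re
  have hUc : Convex ℝ U := convex_halfSpace_re_gt _
  have hNz : (N : ℂ) ≠ 0 := by exact_mod_cast (by omega : N ≠ 0)
  have hsum : DifferentiableOn ℂ (fun s => ∑' k, zetaRemainder (N + k) s) U := by
    intro s hs
    set V : Set ℂ := U ∩ Metric.ball 0 (‖s‖ + 1)
    have hV : IsOpen V := hU.inter Metric.isOpen_ball
    have hsV : s ∈ V := ⟨hs, by simp⟩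
    have : DifferentiableOn ℂ (fun s => ∑' k, zetaRemainder (N + k) s) V := by
      refine Complex.differentiableOn_tsum_of_summable_norm
        (u := fun k => (‖s‖ + 1) * (‖s‖ + 2) * (N : ℝ) ^ (-(1 / 4 : ℝ)) *
          ((N + k : ℕ) : ℝ) ^ (-(5 / 4 : ℝ)))
        ((summable_nat_add_rpow_neg_five_quarters N).mul_left _)
        (fun k => (differentiable_zetaRemainder (by omega)).differentiableOn) hV ?_
      intro k w hw
      have hw2 : ‖w‖ ≤ ‖s‖ + 1 := by
        have := hw.2
        simp at this
        exact this.le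
      refine (norm_zetaRemainder_le_of_half_le hN (by omega) (le_of_lt hw.1)).trans ?_
      have : ‖w - 1‖ ≤ ‖s‖ + 2 := by
        refine (norm_sub_le _ _).trans ?_
        simp; linarith
      gcongr
    exact ((this s hsV).differentiableAt (hV.mem_nhds hsV)).differentiableWithinAt
  have hfin : DifferentiableOn ℂ (fun s : ℂ =>
      (s - 1) * ∑ n ∈ range N, ((n + 1 : ℕ) : ℂ) ^ (-s) + (N : ℂ) ^ (1 - s)) U := by
    intro s _
    refine DifferentiableAt.differentiableWithinAt ?_
    refine DifferentiableAt.add ((differentiableAt_id.sub_const 1).mul ?_)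
      ((differentiableAt_id.const_sub _).const_cpow (Or.inl hNz))
    refine DifferentiableAt.fun_sum fun n _ => (differentiableAt_id.neg).const_cpow (Or.inl ?_)
    exact_mod_cast (by omega : n + 1 ≠ 0)
  have hL := (differentiable_riemannZeta₁.differentiableOn (s := U)).analyticOnNhd hU
  have hR := (hfin.add hsum).analyticOnNhd hU
  refine hL.eqOn_of_preconnected_of_eventuallyEq hR hUc.isPreconnected
    (z₀ := 2) (by simp [U]; norm_num) ?_ hs
  have : {s : ℂ | 1 < s.re} ∈ nhds (2 : ℂ) :=
    (isOpen_lt continuous_const Complex.continuous_re).mem_nhds (by simp)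
  filter_upwards [this] with w hw
  exact riemannZeta₁_eq_of_one_lt_re hN hw

/-- `g` grows at most like `|Im s| ^ η` in the region `a ≤ Re s ≤ b`, `|Im s| ≥ T`. -/
def VerticalGrowth (g : ℂ → ℂ) (a b T η : ℝ) : Prop :=
  ∃ C : ℝ, 0 < C ∧ ∀ s : ℂ, a ≤ s.re → s.re ≤ b → T ≤ |s.im| → ‖g s‖ ≤ C * |s.im| ^ η

lemma sum_range_rpow_neg_le {N : ℕ} (hN : 1 ≤ N) {σ ε : ℝ} (hε : 0 < ε) 
    (hσ : 1 - ε ≤ σ) :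
    ∑ n ∈ range N, ((n + 1 : ℕ) : ℝ) ^ (-σ) ≤ (1 + 1 / ε) * (N : ℝ) ^ (2 * ε) := by
  have hN1 : (1 : ℝ) ≤ N := by exact_mod_cast hN
  calc ∑ n ∈ range N, ((n + 1 : ℕ) : ℝ) ^ (-σ)
      ≤ ∑ n ∈ range N, (N : ℝ) ^ ε * ((n + 1 : ℕ) : ℝ)⁻¹ := by
        refine sum_le_sum fun n hn => ?_
        have h1 : (1 : ℝ) ≤ ((n + 1 : ℕ) : ℝ) := by simp
        have h2 : ((n + 1 : ℕ) : ℝ) ≤ N := by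
          have := mem_range.mp hn
          exact_mod_cast this
        calc ((n + 1 : ℕ) : ℝ) ^ (-σ) ≤ ((n + 1 : ℕ) : ℝ) ^ (ε + -1) :=
              Real.rpow_le_rpow_of_exponent_le h1 (by linarith)
          _ = ((n + 1 : ℕ) : ℝ) ^ ε * ((n + 1 : ℕ) : ℝ)⁻¹ := by
              rw [Real.rpow_add (by linarith), Real.rpow_neg_one]
          _ ≤ _ := by gcongr
    _ = (N : ℝ) ^ ε * (harmonic N : ℝ) := by
        rw [← mul_sum, harmonic]; push_cast; rfl
    _ ≤ (N : ℝ) ^ ε * (1 + (N : ℝ) ^ ε / ε) := by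
        gcongr
        exact (harmonic_le_one_add_log N).trans
          (by gcongr; exact Real.log_le_rpow_div (by linarith) hε)
    _ ≤ (N : ℝ) ^ ε * ((1 + 1 / ε) * (N : ℝ) ^ ε) := by
        gcongr
        have : 1 ≤ (N : ℝ) ^ ε := Real.one_le_rpow hN1 hε.le
        rw [add_mul, one_mul, one_div_mul_eq_div]
        gcongr
    _ = _ := by
        rw [two_mul, Real.rpow_add (by linarith)]; ring

lemma verticalGrowth_riemannZeta :
    VerticalGrowth riemannZeta (1 - 1 / 256) 4 1 (1 / 32) := by
  set K : ℝ := ∑' k : ℕ, ((1 + k : ℕ) : ℝ) ^ (-(5 / 4 : ℝ))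
  have hK : 0 ≤ K := tsum_nonneg fun k => by positivity
  refine ⟨257 * 16 + 16 + 5 * K, by positivity, fun s hs1 hs2 ht => ?_⟩
  set t := |s.im| with ht_def
  have ht0 : 0 < t := by linarith
  have htη : 1 ≤ t ^ (1 / 32 : ℝ) := Real.one_le_rpow ht (by norm_num)
  set N : ℕ := ⌈t⌉₊ ^ 4 with hN_def
  have hc1 : t ≤ ⌈t⌉₊ := Nat.le_ceil t
  have hc2 : (⌈t⌉₊ : ℝ) ≤ 2 * t := by
    have := (Nat.ceil_lt_add_one ht0.le).le; linarith
  have hNt : t ^ 4 ≤ N := by rw [hN_def]; push_cast; gcongr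
  have hNt2 : (N : ℝ) ≤ 16 * t ^ 4 := by
    rw [hN_def]; push_cast
    calc (⌈t⌉₊ : ℝ) ^ 4 ≤ (2 * t) ^ 4 := by gcongr
      _ = _ := by ring
  have hN1' : (1 : ℝ) ≤ N := (one_le_pow₀ ht).trans hNt
  have hN : 1 ≤ N := by exact_mod_cast hN1'
  have hNpow : (N : ℝ) ^ (2 * (1 / 256 : ℝ)) ≤ 16 * t ^ (1 / 32 : ℝ) := by
    calc (N : ℝ) ^ (2 * (1 / 256 : ℝ)) ≤ (16 * t ^ 4) ^ (2 * (1 / 256 : ℝ)) := by gcongr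
      _ = 16 ^ (2 * (1 / 256 : ℝ)) * t ^ (1 / 32 : ℝ) := by
        rw [Real.mul_rpow (by norm_num) (by positivity), ← Real.rpow_natCast t 4,
          ← Real.rpow_mul ht0.le]
        norm_num
      _ ≤ 16 ^ (1 : ℝ) * t ^ (1 / 32 : ℝ) := by
        gcongr
        · norm_num
        · norm_num
      _ = _ := by norm_num
  have hsne : s ≠ 1 := by
    rintro rfl; simp [t] at ht0
  have hs1n : t ≤ ‖s - 1‖ := by
    have := Complex.abs_im_le_norm (s - 1); simpa [t] using this
  have hs1p : 0 < ‖s - 1‖ := ht0.trans_le hs1n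
  have hsn : ‖s‖ ≤ 5 * t := by
    refine (Complex.norm_le_abs_re_add_abs_im s).trans ?_
    rw [abs_of_nonneg (by linarith)]; linarith
  have hrem : ‖∑' k, zetaRemainder (N + k) s‖ ≤ ‖s - 1‖ * (5 * K) := by
    have hb : ∀ k : ℕ, ‖zetaRemainder (N + k) s‖ ≤
        ‖s - 1‖ * 5 * ((1 + k : ℕ) : ℝ) ^ (-(5 / 4 : ℝ)) := by
      intro k
      refine (norm_zetaRemainder_le_of_half_le hN (by omega) (by linarith)).trans ?_
      have h1 : (N : ℝ) ^ (-(1 / 4 : ℝ)) ≤ t⁻¹ := by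
        calc (N : ℝ) ^ (-(1 / 4 : ℝ)) ≤ (t ^ 4) ^ (-(1 / 4 : ℝ)) :=
              Real.rpow_le_rpow_of_nonpos (by positivity) hNt (by norm_num)
          _ = t⁻¹ := by
              rw [← Real.rpow_natCast t 4, ← Real.rpow_mul ht0.le]
              norm_num [Real.rpow_neg_one]
      have h2 : ((N + k : ℕ) : ℝ) ^ (-(5 / 4 : ℝ)) ≤ ((1 + k : ℕ) : ℝ) ^ (-(5 / 4 : ℝ)) := by
        refine Real.rpow_le_rpow_of_nonpos (by positivity) ?_ (by norm_num)
        exact_mod_cast (by omega : 1 + k ≤ N + k)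
      calc ‖s‖ * ‖s - 1‖ * (N : ℝ) ^ (-(1 / 4 : ℝ)) * ((N + k : ℕ) : ℝ) ^ (-(5 / 4 : ℝ))
          ≤ (5 * t) * ‖s - 1‖ * t⁻¹ * ((1 + k : ℕ) : ℝ) ^ (-(5 / 4 : ℝ)) := by gcongr
        _ = _ := by field_simp
    have := tsum_of_norm_bounded
      ((summable_nat_add_rpow_neg_five_quarters 1).hasSum.mul_left (‖s - 1‖ * 5)) hb
    simpa [K, mul_assoc] using this
  have hsum : ‖∑ n ∈ range N, ((n + 1 : ℕ) : ℂ) ^ (-s)‖ ≤ 257 * (16 * t ^ (1 / 32 : ℝ)) := by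
    refine (norm_sum_le _ _).trans ?_
    have : ∀ n ∈ range N, ‖((n + 1 : ℕ) : ℂ) ^ (-s)‖ = ((n + 1 : ℕ) : ℝ) ^ (-s.re) := by
      intro n _
      rw [Complex.norm_natCast_cpow_of_pos (by omega)]; simp
    rw [sum_congr rfl this]
    refine (sum_range_rpow_neg_le hN (ε := 1 / 256) (by norm_num) hs1).trans ?_
    norm_num at hNpow ⊢
    linarith
  have hpole : ‖(N : ℂ) ^ (1 - s)‖ ≤ ‖s - 1‖ * (16 * t ^ (1 / 32 : ℝ)) := by
    rw [Complex.norm_natCast_cpow_of_pos (by omega)]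
    calc (N : ℝ) ^ (1 - s).re ≤ (N : ℝ) ^ (2 * (1 / 256 : ℝ)) :=
          Real.rpow_le_rpow_of_exponent_le hN1' (by simp; linarith)
      _ ≤ 1 * (16 * t ^ (1 / 32 : ℝ)) := by linarith
      _ ≤ _ := by gcongr; linarith
  rw [riemannZeta_eq_inv_sub_mul hsne, norm_mul, norm_inv, inv_mul_le_iff₀ hs1p,
    riemannZeta₁_eq_of_half_lt_re hN (by linarith)]
  refine (norm_add_le _ _).trans ((add_le_add_left (norm_add_le _ _) _).trans ?_)
  rw [norm_mul]
  calc ‖s - 1‖ * ‖∑ n ∈ range N, ((n + 1 : ℕ) : ℂ) ^ (-s)‖ + ‖(N : ℂ) ^ (1 - s)‖ +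
        ‖∑' k, zetaRemainder (N + k) s‖
      ≤ ‖s - 1‖ * (257 * (16 * t ^ (1 / 32 : ℝ))) + ‖s - 1‖ * (16 * t ^ (1 / 32 : ℝ)) +
        ‖s - 1‖ * (5 * K) := by gcongr
    _ = ‖s - 1‖ * ((257 * 16 + 16) * t ^ (1 / 32 : ℝ) + 5 * K * 1) := by ring
    _ ≤ ‖s - 1‖ * ((257 * 16 + 16) * t ^ (1 / 32 : ℝ) + 5 * K * t ^ (1 / 32 : ℝ)) := by gcongr
    _ = _ := by ring

lemma VerticalGrowth.deriv {g : ℂ → ℂ} {a b T η δ : ℝ} (h : VerticalGrowth g a b T η)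
    (hg : ∀ s : ℂ, s ≠ 1 → DifferentiableAt ℂ g s) (hη : 0 ≤ η) (hη1 : η ≤ 1)
    (hδ : 0 < δ) (hδ1 : δ ≤ 1) (hT : 1 ≤ T) :
    VerticalGrowth (deriv g) (a + δ) (b - δ) (T + 1) η := by
  obtain ⟨C, hC, h⟩ := h
  refine ⟨C * 2 / δ, by positivity, fun s h1 h2 h3 => ?_⟩
  have hz : ∀ z ∈ Metric.closedBall s δ, a ≤ z.re ∧ z.re ≤ b ∧ T ≤ |z.im| ∧
      |z.im| ≤ 2 * |s.im| := by
    intro z hz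
    rw [Metric.mem_closedBall, dist_eq_norm] at hz
    have hr := (Complex.abs_re_le_norm (z - s)).trans hz
    have hi := (Complex.abs_im_le_norm (z - s)).trans hz
    rw [Complex.sub_re, abs_le] at hr
    rw [Complex.sub_im] at hi
    have h4 := (abs_sub_abs_le_abs_sub z.im s.im).trans hi
    have h5 := (abs_sub_abs_le_abs_sub s.im z.im).trans ((abs_sub_comm _ _).trans_le hi)
    refine ⟨?_, ?_, ?_, ?_⟩ <;> linarith [hr.1, hr.2]
  have hd : DiffContOnCl ℂ g (Metric.ball s δ) := by
    refine DifferentiableOn.diffContOnCl fun z hz' => ?_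
    have := hz z (Metric.closure_ball_subset_closedBall hz')
    refine (hg z ?_).differentiableWithinAt
    rintro rfl
    simp at this; linarith
  have := Complex.norm_deriv_le_of_forall_mem_sphere_norm_le hδ hd
    (C := C * (2 * |s.im| ^ η)) fun z hz' => by
      obtain ⟨h4, h5, h6, h7⟩ := hz z (Metric.sphere_subset_closedBall hz')
      refine (h z h4 h5 h6).trans ?_
      gcongr
      calc |z.im| ^ η ≤ (2 * |s.im|) ^ η := by gcongr
        _ = 2 ^ η * |s.im| ^ η := Real.mul_rpow (by norm_num) (abs_nonneg _)
        _ ≤ 2 ^ (1 : ℝ) * |s.im| ^ η := by gcongr; norm_num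
        _ = _ := by norm_num
  refine this.trans (le_of_eq ?_)
  ring

lemma differentiableAt_deriv_riemannZeta {s : ℂ} (hs : s ≠ 1) :
    DifferentiableAt ℂ (deriv riemannZeta) s :=
  ((differentiableOn_riemannZeta.deriv isOpen_compl_singleton) s hs).differentiableAt
    (isOpen_compl_singleton.mem_nhds hs)

lemma differentiableAt_deriv_deriv_riemannZeta {s : ℂ} (hs : s ≠ 1) :
    DifferentiableAt ℂ (deriv (deriv riemannZeta)) s :=
  (((differentiableOn_riemannZeta.deriv isOpen_compl_singleton).deriv
    isOpen_compl_singleton) s hs).differentiableAt (isOpen_compl_singleton.mem_nhds hs)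

lemma exists_norm_riemannZeta_derivs_le : ∃ C : ℝ, 1 ≤ C ∧ ∀ s : ℂ, 1 ≤ s.re → s.re ≤ 2 →
    4 ≤ |s.im| → ‖riemannZeta s‖ ≤ C * |s.im| ^ (1 / 32 : ℝ) ∧
      ‖deriv riemannZeta s‖ ≤ C * |s.im| ^ (1 / 32 : ℝ) ∧
      ‖deriv (deriv riemannZeta) s‖ ≤ C * |s.im| ^ (1 / 32 : ℝ) ∧
      ‖deriv (deriv (deriv riemannZeta)) s‖ ≤ C * |s.im| ^ (1 / 32 : ℝ) := by
  have h0 := verticalGrowth_riemannZeta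
  have h1 := h0.deriv (δ := 1 / 1024) (fun s hs => differentiableAt_riemannZeta hs)
    (by norm_num) (by norm_num) (by norm_num) (by norm_num) (by norm_num)
  have h2 := h1.deriv (δ := 1 / 1024) (fun s hs => differentiableAt_deriv_riemannZeta hs)
    (by norm_num) (by norm_num) (by norm_num) (by norm_num) (by norm_num)
  have h3 := h2.deriv (δ := 1 / 1024) (fun s hs => differentiableAt_deriv_deriv_riemannZeta hs)
    (by norm_num) (by norm_num) (by norm_num) (by norm_num) (by norm_num)
  obtain ⟨C0, hC0, h0⟩ := h0
  obtain ⟨C1, hC1, h1⟩ := h1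
  obtain ⟨C2, hC2, h2⟩ := h2
  obtain ⟨C3, hC3, h3⟩ := h3
  refine ⟨1 + C0 + C1 + C2 + C3, by linarith, fun s ha hb ht => ?_⟩
  refine ⟨(h0 s ?_ ?_ ?_).trans ?_, (h1 s ?_ ?_ ?_).trans ?_, (h2 s ?_ ?_ ?_).trans ?_,
    (h3 s ?_ ?_ ?_).trans ?_⟩ <;>
  first
    | linarith
    | (gcongr; linarith)

lemma one_le_norm_riemannZeta_product {x : ℝ} (hx : 0 < x) (y : ℝ) :
    1 ≤ ‖riemannZeta (1 + x)‖ ^ 3 * ‖riemannZeta (1 + x + Complex.I * y)‖ ^ 4 *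
      ‖riemannZeta (1 + x + 2 * Complex.I * y)‖ := by
  have := DirichletCharacter.norm_LFunction_product_ge_one (N := 1) 1 hx y
  simpa [DirichletCharacter.LFunctionTrivChar, DirichletCharacter.LFunction_modOne_eq] using this

lemma exists_norm_riemannZeta_one_add_le : ∃ K : ℝ, 1 ≤ K ∧ ∀ x : ℝ, 0 < x → x ≤ 1 →
    ‖riemannZeta (1 + x)‖ ≤ K / x := by
  obtain ⟨K, hK⟩ := (isCompact_closedBall (1 : ℂ) 1).exists_bound_of_continuousOn
    differentiable_riemannZeta₀.continuous.continuousOn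
  refine ⟨1 + |K|, by linarith [abs_nonneg K], fun x hx hx1 => ?_⟩
  have h1 : (1 + x : ℂ) ≠ 1 := by simp [hx.ne']
  rw [riemannZeta_eq_inv_sub_add h1]
  refine (norm_add_le _ _).trans ?_
  have h2 : ‖riemannZeta₀ (1 + x)‖ ≤ |K| := by
    refine (hK _ ?_).trans (le_abs_self K)
    simp [abs_of_pos hx, hx1]
  have h3 : ‖((1 + x : ℂ) - 1)⁻¹‖ = 1 / x := by simp [abs_of_pos hx]
  rw [h3, add_div]
  gcongr
  exact h2.trans (le_div_self (abs_nonneg K) hx hx1)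

lemma exists_le_norm_riemannZeta : ∃ c : ℝ, 0 < c ∧ ∀ s : ℂ, 1 < s.re → s.re ≤ 2 →
    4 ≤ |s.im| → c * |s.im| ^ (-(1 / 8 : ℝ)) ≤ ‖riemannZeta s‖ := by
  obtain ⟨C, hC, hζ⟩ := exists_norm_riemannZeta_derivs_le
  obtain ⟨K, hK, hpole⟩ := exists_norm_riemannZeta_one_add_le
  set κ : ℝ := 1 / (2 * K ^ 3 * C) with hκ_def
  have hKC : 1 ≤ 2 * K ^ 3 * C := by
    have : 1 ≤ K ^ 3 := one_le_pow₀ hK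
    nlinarith
  have hκ : 0 < κ := by positivity
  have hκ1 : κ ≤ 1 := by rw [hκ_def, div_le_one (by linarith)]; exact hKC
  set l : ℝ := κ / (2 * C) with hl_def
  have hl : 0 < l := by positivity
  have hl1 : l ≤ 1 := by rw [hl_def, div_le_one (by linarith)]; linarith
  have hlC : C * l = κ / 2 := by rw [hl_def]; field_simp
  refine ⟨κ * l ^ 3 / 2, by positivity, fun s hs1 hs2 ht => ?_⟩
  set t := |s.im| with ht_def
  have ht0 : 0 < t := by linarith
  set u : ℝ := t ^ (-(1 / 32 : ℝ)) with hu_def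
  have hu0 : 0 < u := by positivity
  have hu1 : u ≤ 1 := Real.rpow_le_one_of_one_le_of_nonpos (by linarith) (by norm_num)
  have hu4 : t ^ (-(1 / 8 : ℝ)) = u ^ 4 := by
    rw [hu_def, ← Real.rpow_natCast, ← Real.rpow_mul ht0.le]; norm_num
  have huinv : t ^ (1 / 32 : ℝ) = u⁻¹ := by
    rw [hu_def, Real.rpow_neg ht0.le, inv_inv]
  have key : ∀ x : ℝ, 0 < x → x ≤ 1 →
      κ ^ 4 * x ^ 3 * u ≤ ‖riemannZeta (1 + x + Complex.I * s.im)‖ ^ 4 := by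
    intro x hx hx1
    have h1 := one_le_norm_riemannZeta_product hx s.im
    have h2 : ‖riemannZeta (1 + x + 2 * Complex.I * s.im)‖ ≤ C * (2 * u⁻¹) := by
      refine (hζ _ (by simp; linarith) (by simp; linarith) (by simp; linarith)).1.trans ?_
      gcongr
      have : |(1 + (x : ℂ) + 2 * Complex.I * s.im).im| = 2 * t := by
        simp [abs_mul, t]
      rw [this, Real.mul_rpow (by norm_num) ht0.le, huinv]
      gcongr
      calc (2 : ℝ) ^ (1 / 32 : ℝ) ≤ 2 ^ (1 : ℝ) := by gcongr <;> norm_num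
        _ = 2 := by norm_num
    set Y := ‖riemannZeta (1 + x + Complex.I * s.im)‖ ^ 4
    have hY : 0 ≤ Y := by positivity
    have h3 : 1 ≤ (K / x) ^ 3 * Y * (C * (2 * u⁻¹)) := by
      refine h1.trans ?_
      gcongr
      exact hpole x hx hx1
    have h4 : κ * x ^ 3 * u ≤ Y := by
      have : (K / x) ^ 3 * Y * (C * (2 * u⁻¹)) = Y / (κ * x ^ 3 * u) := by
        rw [hκ_def]; field_simp
      rw [this, le_div_iff₀ (by positivity)] at h3
      linarith
    refine le_trans ?_ h4
    gcongr
    exact pow_le_of_le_one hκ.le hκ1 (by norm_num)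
  set X : ℝ := l ^ 4 * u ^ 5 with hX_def
  have hX0 : 0 < X := by positivity
  have hX1 : X ≤ 1 := by
    rw [hX_def]
    exact mul_le_one₀ (pow_le_one₀ hl.le hl1) (by positivity) (pow_le_one₀ hu0.le hu1)
  have key2 : ∀ x : ℝ, X ≤ x → x ≤ 1 →
      κ * l ^ 3 * u ^ 4 ≤ ‖riemannZeta (1 + x + Complex.I * s.im)‖ := by
    intro x hx hx1
    have h := key x (hX0.trans_le hx) hx1
    refine le_of_pow_le_pow_left₀ (n := 4) (by norm_num) (norm_nonneg _) (le_trans ?_ h)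
    calc (κ * l ^ 3 * u ^ 4) ^ 4 = κ ^ 4 * X ^ 3 * u := by rw [hX_def]; ring
      _ ≤ _ := by gcongr
  have hs_eq : s = 1 + ((s.re - 1 : ℝ) : ℂ) + Complex.I * s.im := by
    apply Complex.ext <;> simp
  rw [hu4]
  rcases le_or_gt X (s.re - 1) with hx | hx
  · have := key2 _ hx (by linarith)
    rw [← hs_eq] at this
    refine le_trans ?_ this
    have : 0 < κ * l ^ 3 * u ^ 4 := by positivity
    linarith
  · have h1 := key2 X le_rfl hX1
    set s' : ℂ := 1 + X + Complex.I * s.im with hs'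
    have h2 : ‖riemannZeta s' - riemannZeta s‖ ≤ C * u⁻¹ * ‖s' - s‖ := by
      refine Convex.norm_image_sub_le_of_norm_deriv_le (s := Set.Icc 1 2 ×ℂ {s.im})
        (fun z hz => differentiableAt_riemannZeta ?_) (fun z hz => ?_)
        (((convex_Icc (1 : ℝ) 2).linear_preimage Complex.reLm).inter
          ((convex_singleton _).linear_preimage Complex.imLm)) ?_ ?_
      · rintro rfl
        have := hz.2
        simp at this
        rw [ht_def, ← this] at ht0
        simp at ht0
      · have hz2 : z.im = s.im := hz.2
        rw [← huinv, ht_def, ← hz2]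
        exact (hζ z hz.1.1 hz.1.2 (by rw [hz2]; exact ht)).2.1
      · exact ⟨⟨hs1.le, hs2⟩, rfl⟩
      · refine ⟨⟨?_, ?_⟩, ?_⟩ <;> simp [hs'] <;> linarith
    have h3 : ‖s' - s‖ ≤ X := by
      have : s' - s = ((X - (s.re - 1) : ℝ) : ℂ) := by
        rw [hs']; nth_rw 2 [hs_eq]; push_cast; ring
      rw [this, Complex.norm_real, Real.norm_eq_abs, abs_of_nonneg (by linarith)]
      linarith
    have h4 : C * u⁻¹ * ‖s' - s‖ ≤ κ * l ^ 3 * u ^ 4 / 2 := by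
      calc C * u⁻¹ * ‖s' - s‖ ≤ C * u⁻¹ * X := by gcongr
        _ = (C * l) * l ^ 3 * u ^ 4 := by rw [hX_def]; field_simp
        _ = _ := by rw [hlC]; ring
    have h5 := norm_sub_norm_le (riemannZeta s') (riemannZeta s)
    linarith

/-- The continuation to `Re s ≥ 1` of the Dirichlet series with coefficients `Λ(n) - 1`. -/
noncomputable def primeDiscrepancy (s : ℂ) : ℂ :=
  -(deriv riemannZeta₁ s / riemannZeta₁ s) - riemannZeta₀ s

lemma riemannZeta₁_eq_mul {s : ℂ} (hs : s ≠ 1) : riemannZeta₁ s = (s - 1) * riemannZeta s := by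
  rw [riemannZeta_eq_inv_sub_mul hs, mul_inv_cancel_left₀ (sub_ne_zero.mpr hs)]

lemma riemannZeta₁_ne_zero {s : ℂ} (hs : 1 ≤ s.re) : riemannZeta₁ s ≠ 0 := by
  rcases eq_or_ne s 1 with rfl | h
  · simp
  · rw [riemannZeta₁_eq_mul h]
    exact mul_ne_zero (sub_ne_zero.mpr h) (riemannZeta_ne_zero_of_one_le_re hs)

lemma isOpen_riemannZeta₁_ne_zero : IsOpen {s | riemannZeta₁ s ≠ 0} :=
  isOpen_ne_fun differentiable_riemannZeta₁.continuous continuous_const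

lemma differentiableOn_primeDiscrepancy :
    DifferentiableOn ℂ primeDiscrepancy {s | riemannZeta₁ s ≠ 0} := by
  intro s hs
  have h1 : DifferentiableAt ℂ (deriv riemannZeta₁) s :=
    ((differentiable_riemannZeta₁.differentiableOn (s := Set.univ)).deriv isOpen_univ s
      trivial).differentiableAt Filter.univ_mem
  exact (((h1.div (differentiable_riemannZeta₁ s) hs).neg).sub
    (differentiable_riemannZeta₀ s)).differentiableWithinAt

lemma primeDiscrepancy_eq {s : ℂ} (hs : 1 < s.re) :
    primeDiscrepancy s = -(deriv riemannZeta s / riemannZeta s) - riemannZeta s := by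
  have hs1 : s ≠ 1 := by rintro rfl; simp at hs
  have hs0 : s - 1 ≠ 0 := sub_ne_zero.mpr hs1
  have hζ := riemannZeta_ne_zero_of_one_le_re hs.le
  have hd : deriv riemannZeta₁ s = riemannZeta s + (s - 1) * deriv riemannZeta s := by
    have h1 : riemannZeta₁ =ᶠ[nhds s] fun w => (w - 1) * riemannZeta w := by
      filter_upwards [isOpen_compl_singleton.mem_nhds hs1] with w hw
      exact riemannZeta₁_eq_mul hw
    rw [h1.deriv_eq]
    have := ((hasDerivAt_id' s).sub_const 1).fun_mul (differentiableAt_riemannZeta hs1).hasDerivAt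
    simpa using this.deriv
  have h0 : riemannZeta₀ s = riemannZeta s - (s - 1)⁻¹ := by
    rw [riemannZeta_eq_inv_sub_add hs1]; ring
  rw [primeDiscrepancy, hd, riemannZeta₁_eq_mul hs1, h0]
  field_simp
  ring

lemma deriv_primeDiscrepancy_eq {s : ℂ} (hs : 1 < s.re) :
    deriv primeDiscrepancy s = -(deriv (deriv riemannZeta) s / riemannZeta s -
      (deriv riemannZeta s / riemannZeta s) ^ 2) - deriv riemannZeta s := by
  have hs1 : s ≠ 1 := by rintro rfl; simp at hs
  have hζ := riemannZeta_ne_zero_of_one_le_re hs.le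
  have h1 : primeDiscrepancy =ᶠ[nhds s]
      fun s => -(deriv riemannZeta s / riemannZeta s) - riemannZeta s := by
    filter_upwards [(isOpen_lt continuous_const Complex.continuous_re).mem_nhds hs] with w hw
    exact primeDiscrepancy_eq hw
  rw [h1.deriv_eq]
  have d0 := (differentiableAt_riemannZeta hs1).hasDerivAt
  have d1 := (differentiableAt_deriv_riemannZeta hs1).hasDerivAt
  refine (((d1.fun_div d0 hζ).fun_neg).fun_sub d0).deriv.trans ?_
  field_simp

lemma deriv_deriv_primeDiscrepancy_eq {s : ℂ} (hs : 1 < s.re) :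
    deriv (deriv primeDiscrepancy) s = -(deriv (deriv (deriv riemannZeta)) s / riemannZeta s -
      deriv (deriv riemannZeta) s / riemannZeta s * (deriv riemannZeta s / riemannZeta s) -
      2 * (deriv riemannZeta s / riemannZeta s) * (deriv (deriv riemannZeta) s / riemannZeta s -
      (deriv riemannZeta s / riemannZeta s) ^ 2)) - deriv (deriv riemannZeta) s := by
  have hs1 : s ≠ 1 := by rintro rfl; simp at hs
  have hζ := riemannZeta_ne_zero_of_one_le_re hs.le
  have h1 : deriv primeDiscrepancy =ᶠ[nhds s]
      fun s => -(deriv (deriv riemannZeta) s / riemannZeta s -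
        (deriv riemannZeta s / riemannZeta s) ^ 2) - deriv riemannZeta s := by
    filter_upwards [(isOpen_lt continuous_const Complex.continuous_re).mem_nhds hs] with w hw
    exact deriv_primeDiscrepancy_eq hw
  rw [h1.deriv_eq]
  have d0 := (differentiableAt_riemannZeta hs1).hasDerivAt
  have d1 := (differentiableAt_deriv_riemannZeta hs1).hasDerivAt
  have d2 := (differentiableAt_deriv_deriv_riemannZeta hs1).hasDerivAt
  refine ((((d2.fun_div d0 hζ).fun_sub ((d1.fun_div d0 hζ).fun_pow 2)).fun_neg).fun_sub
    d1).deriv.trans ?_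
  generalize riemannZeta s = z at *
  push_cast
  simp only [pow_one]
  field_simp

lemma exists_norm_primeDiscrepancy_le_of_four_le : ∃ C : ℝ, 0 < C ∧ ∀ s : ℂ, 1 < s.re →
    s.re ≤ 2 → 4 ≤ |s.im| →
      ‖primeDiscrepancy s‖ ≤ C * (1 + |s.im|) ^ (1 / 2 : ℝ) ∧
      ‖deriv primeDiscrepancy s‖ ≤ C * (1 + |s.im|) ^ (1 / 2 : ℝ) ∧
      ‖deriv (deriv primeDiscrepancy) s‖ ≤ C * (1 + |s.im|) ^ (1 / 2 : ℝ) := by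
  obtain ⟨C, hC, hζ⟩ := exists_norm_riemannZeta_derivs_le
  obtain ⟨c, hc, hlow⟩ := exists_le_norm_riemannZeta
  set M₀ : ℝ := C + C / c
  have hM₀ : 1 ≤ M₀ := by have : 0 < C / c := by positivity
                          linarith
  refine ⟨7 * M₀ ^ 3, by positivity, fun s hs1 hs2 ht => ?_⟩
  rw [primeDiscrepancy_eq hs1, deriv_primeDiscrepancy_eq hs1, deriv_deriv_primeDiscrepancy_eq hs1]
  obtain ⟨h0, h1, h2, h3⟩ := hζ s hs1.le hs2 ht
  have hl := hlow s hs1 hs2 ht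
  set t := |s.im| with ht_def
  have ht0 : 0 < t := by linarith
  have ht1 : 1 ≤ t := by linarith
  set M : ℝ := M₀ * t ^ (5 / 32 : ℝ) with hM_def
  have hp : 1 ≤ t ^ (5 / 32 : ℝ) := Real.one_le_rpow ht1 (by norm_num)
  have hM1 : 1 ≤ M := one_le_mul_of_one_le_of_one_le hM₀ hp
  have hM3 : 7 * M ^ 3 ≤ 7 * M₀ ^ 3 * (1 + t) ^ (1 / 2 : ℝ) := by
    rw [hM_def, mul_pow, ← mul_assoc]
    gcongr
    calc (t ^ (5 / 32 : ℝ)) ^ 3 = t ^ (15 / 32 : ℝ) := by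
          rw [← Real.rpow_natCast, ← Real.rpow_mul ht0.le]; norm_num
      _ ≤ (1 + t) ^ (15 / 32 : ℝ) := by gcongr; linarith
      _ ≤ _ := Real.rpow_le_rpow_of_exponent_le (by linarith) (by norm_num)
  have hsmall : C * t ^ (1 / 32 : ℝ) ≤ M := by
    rw [hM_def]
    have : 0 < C / c := by positivity
    exact mul_le_mul (by linarith) (Real.rpow_le_rpow_of_exponent_le ht1 (by norm_num))
      (by positivity) (by positivity)
  have hdiv : ∀ w : ℂ, ‖w‖ ≤ C * t ^ (1 / 32 : ℝ) → ‖w / riemannZeta s‖ ≤ M := by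
    intro w hw
    rw [norm_div]
    calc ‖w‖ / ‖riemannZeta s‖ ≤ (C * t ^ (1 / 32 : ℝ)) / (c * t ^ (-(1 / 8 : ℝ))) := by gcongr
      _ = C / c * t ^ (5 / 32 : ℝ) := by
          rw [mul_div_mul_comm, ← Real.rpow_sub ht0]; norm_num
      _ ≤ M := by rw [hM_def]; gcongr; linarith
  have r1 := hdiv _ h1
  have r2 := hdiv _ h2
  have r3 := hdiv _ h3
  replace h0 := h0.trans hsmall
  replace h1 := h1.trans hsmall
  replace h2 := h2.trans hsmall
  generalize deriv riemannZeta s / riemannZeta s = L1 at *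
  generalize deriv (deriv riemannZeta) s / riemannZeta s = L2 at *
  generalize deriv (deriv (deriv riemannZeta)) s / riemannZeta s = L3 at *
  have hM2 : M ≤ M ^ 2 := le_self_pow₀ hM1 (by norm_num)
  have hM23 : M ^ 2 ≤ M ^ 3 := pow_le_pow_right₀ hM1 (by norm_num)
  have hL1 : ‖L1 ^ 2‖ ≤ M ^ 2 := by rw [norm_pow]; gcongr
  have hL2 : ‖L2 - L1 ^ 2‖ ≤ M + M ^ 2 := (norm_sub_le _ _).trans (add_le_add r2 hL1)
  refine ⟨le_trans ?_ hM3, le_trans ?_ hM3, le_trans ?_ hM3⟩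
  · refine (norm_sub_le _ _).trans ?_
    rw [norm_neg]
    linarith
  · refine (norm_sub_le _ _).trans ?_
    rw [norm_neg]
    linarith
  · refine (norm_sub_le _ _).trans ?_
    rw [norm_neg]
    have e1 : ‖L2 * L1‖ ≤ M * M := by rw [norm_mul]; gcongr
    have e2 : ‖2 * L1 * (L2 - L1 ^ 2)‖ ≤ 2 * M * (M + M ^ 2) := by
      rw [norm_mul, norm_mul]; simp only [Complex.norm_ofNat]; gcongr
    have e3 := norm_sub_le (L3 - L2 * L1) (2 * L1 * (L2 - L1 ^ 2))
    have e4 := norm_sub_le L3 (L2 * L1)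
    nlinarith

lemma exists_norm_primeDiscrepancy_le : ∃ C : ℝ, 0 < C ∧ ∀ s : ℂ, 1 < s.re →
    s.re ≤ 2 →
      ‖primeDiscrepancy s‖ ≤ C * (1 + |s.im|) ^ (1 / 2 : ℝ) ∧
      ‖deriv primeDiscrepancy s‖ ≤ C * (1 + |s.im|) ^ (1 / 2 : ℝ) ∧
      ‖deriv (deriv primeDiscrepancy) s‖ ≤ C * (1 + |s.im|) ^ (1 / 2 : ℝ) := by
  obtain ⟨C, hC, hbig⟩ := exists_norm_primeDiscrepancy_le_of_four_le
  have hcomp : IsCompact (Set.Icc (1 : ℝ) 2 ×ℂ Set.Icc (-4 : ℝ) 4) :=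
    isCompact_Icc.reProdIm isCompact_Icc
  have hsub : Set.Icc (1 : ℝ) 2 ×ℂ Set.Icc (-4 : ℝ) 4 ⊆ {s | riemannZeta₁ s ≠ 0} :=
    fun s hs => riemannZeta₁_ne_zero hs.1.1
  have d0 := differentiableOn_primeDiscrepancy
  have d1 := d0.deriv isOpen_riemannZeta₁_ne_zero
  have d2 := d1.deriv isOpen_riemannZeta₁_ne_zero
  obtain ⟨K0, hK0⟩ := hcomp.exists_bound_of_continuousOn (d0.continuousOn.mono hsub)
  obtain ⟨K1, hK1⟩ := hcomp.exists_bound_of_continuousOn (d1.continuousOn.mono hsub)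
  obtain ⟨K2, hK2⟩ := hcomp.exists_bound_of_continuousOn (d2.continuousOn.mono hsub)
  refine ⟨C + |K0| + |K1| + |K2|, by positivity, fun s hs1 hs2 => ?_⟩
  have n0 := abs_nonneg K0
  have n1 := abs_nonneg K1
  have n2 := abs_nonneg K2
  rcases le_or_gt 4 |s.im| with ht | ht
  · obtain ⟨h0, h1, h2⟩ := hbig s hs1 hs2 ht
    refine ⟨h0.trans ?_, h1.trans ?_, h2.trans ?_⟩ <;> gcongr <;> linarith
  · have hs : s ∈ Set.Icc (1 : ℝ) 2 ×ℂ Set.Icc (-4 : ℝ) 4 :=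
      ⟨⟨hs1.le, hs2⟩, abs_le.mp ht.le⟩
    have hone : 1 ≤ (1 + |s.im|) ^ (1 / 2 : ℝ) :=
      Real.one_le_rpow (by linarith [abs_nonneg s.im]) (by norm_num)
    have hmul : ∀ K, K ≤ C + |K0| + |K1| + |K2| →
        K ≤ (C + |K0| + |K1| + |K2|) * (1 + |s.im|) ^ (1 / 2 : ℝ) := fun K hK =>
      hK.trans (le_mul_of_one_le_right (by linarith) hone)
    refine ⟨(hK0 s hs).trans (hmul _ ?_), (hK1 s hs).trans (hmul _ ?_),
      (hK2 s hs).trans (hmul _ ?_)⟩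
    · linarith [le_abs_self K0]
    · linarith [le_abs_self K1]
    · linarith [le_abs_self K2]

/-- The function `y ↦ max (1 - y) 0` on `(0, ∞)`, written so that its Mellin transform is visible. -/
noncomputable def fejerKernel (y : ℝ) : ℂ :=
  (Set.Ioc (0 : ℝ) 1).indicator (fun _ => (1 : ℂ)) y -
    (Set.Ioc (0 : ℝ) 1).indicator (fun t : ℝ => (t : ℂ) ^ (1 : ℂ)) y

lemma fejerKernel_of_pos {y : ℝ} (hy : 0 < y) : fejerKernel y = ((max (1 - y) 0 : ℝ) : ℂ) := by
  rcases le_or_gt y 1 with h | h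
  · have hm : y ∈ Set.Ioc (0 : ℝ) 1 := ⟨hy, h⟩
    rw [fejerKernel, Set.indicator_of_mem hm, Set.indicator_of_mem hm, max_eq_left (by linarith)]
    simp
  · have hm : y ∉ Set.Ioc (0 : ℝ) 1 := fun hm => absurd hm.2 (not_le.mpr h)
    rw [fejerKernel, Set.indicator_of_notMem hm, Set.indicator_of_notMem hm,
      max_eq_right (by linarith)]
    simp

lemma hasMellin_fejerKernel {s : ℂ} (hs : 0 < s.re) :
    HasMellin fejerKernel s (s⁻¹ * (s + 1)⁻¹) := by
  have h1 := hasMellin_one_Ioc hs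
  have h2 := hasMellin_cpow_Ioc 1 (s := s) (by simp; linarith)
  have h := hasMellin_sub h1.1 h2.1
  refine ⟨h.1, h.2.trans ?_⟩
  have hs0 : s ≠ 0 := by rintro rfl; simp at hs
  have hs1 : s + 1 ≠ 0 := by
    intro h0
    have := congrArg Complex.re h0
    simp at this
    linarith
  rw [h1.2, h2.2]
  field_simp
  ring

lemma one_add_abs_im_le_two_mul_norm {s : ℂ} (hs : 1 ≤ s.re) : 1 + |s.im| ≤ 2 * ‖s‖ := by
  have h1 := Complex.abs_re_le_norm s
  have h2 := Complex.abs_im_le_norm s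
  have h3 := le_abs_self s.re
  linarith

lemma norm_inv_le_of_one_le_re {s : ℂ} (hs : 1 ≤ s.re) :
    ‖s⁻¹‖ ≤ 2 / (1 + |s.im|) ∧ ‖s⁻¹‖ ≤ 1 := by
  have h1 := one_add_abs_im_le_two_mul_norm hs
  have h2 : 1 ≤ ‖s‖ := by linarith [Complex.abs_re_le_norm s, le_abs_self s.re]
  have h3 := abs_nonneg s.im
  rw [norm_inv]
  refine ⟨?_, inv_le_one_of_one_le₀ h2⟩
  rw [inv_eq_one_div, div_le_div_iff₀ (by linarith) (by linarith)]
  linarith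

lemma two_rpow_bound_eq (t : ℝ) :
    (1 + |t|) ^ (1 / 2 : ℝ) * (2 / (1 + |t|)) ^ 2 = 4 * (1 + ‖t‖) ^ (-(3 / 2) : ℝ) := by
  have h : 0 < 1 + |t| := by positivity
  rw [Real.norm_eq_abs, div_pow, show (-(3 / 2) : ℝ) = 1 / 2 - 2 by norm_num, Real.rpow_sub h]
  norm_num
  ring

lemma integrable_one_add_norm_rpow :
    MeasureTheory.Integrable fun t : ℝ => (1 + ‖t‖) ^ (-(3 / 2) : ℝ) :=
  integrable_one_add_norm (by simp; norm_num)

lemma integrable_fejer_mellin {σ : ℝ} (hσ : 1 ≤ σ) :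
    MeasureTheory.Integrable fun t : ℝ =>
      ((σ + t * Complex.I : ℂ)⁻¹ * (σ + t * Complex.I + 1 : ℂ)⁻¹) := by
  have hne : ∀ t : ℝ, (σ + t * Complex.I : ℂ) ≠ 0 := fun t h => by
    have := congrArg Complex.re h
    simp at this
    linarith
  have hne1 : ∀ t : ℝ, (σ + t * Complex.I + 1 : ℂ) ≠ 0 := fun t h => by
    have := congrArg Complex.re h
    simp at this
    linarith
  refine (integrable_one_add_norm_rpow.const_mul 4).mono'
    (Continuous.aestronglyMeasurable ?_) (MeasureTheory.ae_of_all _ fun t => ?_)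
  · exact (Continuous.inv₀ (by fun_prop) hne).mul (Continuous.inv₀ (by fun_prop) hne1)
  · rw [← two_rpow_bound_eq, norm_mul]
    have h1 := (norm_inv_le_of_one_le_re (s := σ + t * Complex.I) (by simpa using hσ)).1
    have h2 := (norm_inv_le_of_one_le_re (s := σ + t * Complex.I + 1) (by simp; linarith)).1
    simp only [Complex.add_im, Complex.ofReal_im, Complex.mul_im, Complex.ofReal_re, Complex.I_im,
      Complex.I_re, Complex.one_im, mul_one, mul_zero, zero_add, add_zero] at h1 h2
    calc _ ≤ (2 / (1 + |t|)) * (2 / (1 + |t|)) := by gcongr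
      _ ≤ _ := by
        rw [← sq]
        exact le_mul_of_one_le_left (by positivity)
          (Real.one_le_rpow (by linarith [abs_nonneg t]) (by norm_num))

lemma fejerKernel_eq_integral {σ : ℝ} (hσ : 1 ≤ σ) {y : ℝ} (hy : 0 < y) :
    ((max (1 - y) 0 : ℝ) : ℂ) = (1 / (2 * Real.pi) : ℝ) • ∫ t : ℝ,
      (y : ℂ) ^ (-(σ + t * Complex.I) : ℂ) *
        ((σ + t * Complex.I : ℂ)⁻¹ * (σ + t * Complex.I + 1 : ℂ)⁻¹) := by
  have hre : ∀ t : ℝ, 0 < (σ + t * Complex.I : ℂ).re := fun t => by simp; linarith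
  have hv : Complex.VerticalIntegrable (mellin fejerKernel) σ := by
    refine (integrable_fejer_mellin hσ).congr (MeasureTheory.ae_of_all _ fun t => ?_)
    exact ((hasMellin_fejerKernel (hre t)).2).symm
  have hc : ContinuousAt fejerKernel y := by
    have : (fun z : ℝ => ((max (1 - z) 0 : ℝ) : ℂ)) =ᶠ[nhds y] fejerKernel := by
      filter_upwards [lt_mem_nhds hy] with z hz
      exact (fejerKernel_of_pos hz).symm
    refine ContinuousAt.congr ?_ this
    exact Continuous.continuousAt (by fun_prop)
  have h := mellinInv_mellin_eq σ fejerKernel hy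
    (hasMellin_fejerKernel (by simpa using by linarith)).1 hv hc
  rw [← fejerKernel_of_pos hy, ← h, mellinInv]
  congr 1
  refine MeasureTheory.integral_congr_ae (MeasureTheory.ae_of_all _ fun t => ?_)
  simp only [smul_eq_mul]
  rw [(hasMellin_fejerKernel (hre t)).2]

lemma LSeriesHasSum_primeDiscrepancy {s : ℂ} (hs : 1 < s.re) :
    LSeriesHasSum (fun n => (ArithmeticFunction.vonMangoldt n : ℂ) - 1) s (primeDiscrepancy s) := by
  have h1 := (ArithmeticFunction.LSeriesSummable_vonMangoldt hs).LSeriesHasSum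
  have h2 := LSeriesHasSum_one hs
  rw [ArithmeticFunction.LSeries_vonMangoldt_eq_deriv_riemannZeta_div hs] at h1
  rw [primeDiscrepancy_eq hs, ← neg_div]
  exact h1.sub h2

lemma tsum_fejer_eq_integral {σ : ℝ} (hσ : 1 < σ) {x : ℝ} (hx : 0 < x) :
    HasSum (fun n : ℕ => if n = 0 then (0 : ℂ) else
        ((ArithmeticFunction.vonMangoldt n : ℂ) - 1) * ((max (1 - n / x) 0 : ℝ) : ℂ))
      ((1 / (2 * Real.pi) : ℝ) • ∫ t : ℝ, (x : ℂ) ^ (σ + t * Complex.I : ℂ) *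
        (primeDiscrepancy (σ + t * Complex.I) *
          ((σ + t * Complex.I : ℂ)⁻¹ * (σ + t * Complex.I + 1 : ℂ)⁻¹))) := by
  set a : ℕ → ℂ := fun n => (ArithmeticFunction.vonMangoldt n : ℂ) - 1
  set M : ℝ → ℂ := fun t => (σ + t * Complex.I : ℂ)⁻¹ * (σ + t * Complex.I + 1 : ℂ)⁻¹ with hM
  set F : ℕ → ℝ → ℂ := fun n t =>
    LSeries.term a (σ + t * Complex.I) n * ((x : ℂ) ^ (σ + t * Complex.I : ℂ) * M t) with hF
  have hre : ∀ t : ℝ, 1 < (σ + t * Complex.I : ℂ).re := fun t => by simpa using hσ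
  have hMint : MeasureTheory.Integrable M := integrable_fejer_mellin hσ.le
  have hxc : (x : ℂ) ≠ 0 := by exact_mod_cast hx.ne'
  have hcx : ∀ {y : ℝ}, 0 < y → Continuous fun t : ℝ => (y : ℂ) ^ (σ + t * Complex.I : ℂ) := by
    intro y hy
    have hyc : (y : ℂ) ≠ 0 := by exact_mod_cast hy.ne'
    exact Continuous.const_cpow (by fun_prop) (Or.inl hyc)
  have hnx : ∀ {y : ℝ}, 0 < y → ∀ t : ℝ, ‖(y : ℂ) ^ (σ + t * Complex.I : ℂ)‖ = y ^ σ := by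
    intro y hy t
    rw [Complex.norm_cpow_eq_rpow_re_of_pos hy]; simp
  have hnorm : ∀ n t, ‖F n t‖ = ‖LSeries.term a σ n‖ * x ^ σ * ‖M t‖ := by
    intro n t
    simp only [hF, norm_mul, hnx hx, LSeries.norm_term_eq]
    simp
    ring_nf
  have hcont : ∀ n, MeasureTheory.AEStronglyMeasurable
      (fun t : ℝ => LSeries.term a (σ + t * Complex.I) n * (x : ℂ) ^ (σ + t * Complex.I : ℂ)) := by
    intro n
    refine Continuous.aestronglyMeasurable (Continuous.mul ?_ (hcx hx))
    rcases eq_or_ne n 0 with rfl | hn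
    · simp only [LSeries.term_zero]; exact continuous_const
    · simp only [LSeries.term_of_ne_zero hn]
      have hn' : (0 : ℝ) < n := by exact_mod_cast Nat.pos_of_ne_zero hn
      have := hcx hn'
      simp only [Complex.ofReal_natCast] at this
      exact continuous_const.div this fun t => by
        rw [← norm_pos_iff]
        have := hnx hn' t
        simp only [Complex.ofReal_natCast] at this
        rw [this]; positivity
  have hFint : ∀ n, MeasureTheory.Integrable (F n) := by
    intro n
    refine (hMint.norm.const_mul (‖LSeries.term a σ n‖ * x ^ σ)).mono' ?_
      (MeasureTheory.ae_of_all _ fun t => (hnorm n t).le)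
    have := (hcont n).mul hMint.aestronglyMeasurable
    refine this.congr (MeasureTheory.ae_of_all _ fun t => ?_)
    simp only [hF, Pi.mul_apply]; ring
  have hsum : Summable fun n => ∫ t, ‖F n t‖ := by
    simp only [hnorm, MeasureTheory.integral_const_mul]
    refine Summable.mul_right _ (Summable.mul_right _ (Summable.norm ?_))
    exact (LSeriesHasSum_primeDiscrepancy (s := σ) (by simpa using hσ)).LSeriesSummable
  have key := (MeasureTheory.hasSum_integral_of_summable_integral_norm hFint hsum).const_smul
    (1 / (2 * Real.pi) : ℝ)
  have hval : ∫ t, ∑' n, F n t = ∫ t : ℝ, (x : ℂ) ^ (σ + t * Complex.I : ℂ) *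
      (primeDiscrepancy (σ + t * Complex.I) * M t) := by
    refine MeasureTheory.integral_congr_ae (MeasureTheory.ae_of_all _ fun t => ?_)
    simp only [hF, tsum_mul_right]
    have := (LSeriesHasSum_primeDiscrepancy (hre t)).tsum_eq
    rw [this]
    ring
  rw [hval] at key
  refine (congrArg (fun f => HasSum f _) (funext fun n => ?_)).mpr key
  rcases eq_or_ne n 0 with rfl | hn
  · simp [hF]
  · have hn' : (0 : ℝ) < n := by exact_mod_cast Nat.pos_of_ne_zero hn
    have hnc : (n : ℂ) ≠ 0 := by exact_mod_cast hn
    rw [if_neg hn, fejerKernel_eq_integral hσ.le (div_pos hn' hx), mul_smul_comm]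
    rw [← MeasureTheory.integral_const_mul]
    congr 1
    refine MeasureTheory.integral_congr_ae (MeasureTheory.ae_of_all _ fun t => ?_)
    simp only [hF, LSeries.term_of_ne_zero hn]
    have : ((n / x : ℝ) : ℂ) ^ (-(σ + t * Complex.I) : ℂ) =
        (x : ℂ) ^ (σ + t * Complex.I : ℂ) / (n : ℂ) ^ (σ + t * Complex.I : ℂ) := by
      have h2 := Complex.mul_cpow_ofReal_nonneg (div_pos hn' hx).le hx.le (σ + t * Complex.I)
      have h1 : ((n / x : ℝ) : ℂ) * x = n := by push_cast; field_simp
      rw [h1] at h2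
      rw [h2, Complex.cpow_neg]
      have h3 : (x : ℂ) ^ (σ + t * Complex.I : ℂ) ≠ 0 := by
        rw [Complex.cpow_ne_zero_iff]; exact Or.inl hxc
      field_simp
    rw [this]
    ring

lemma norm_integral_exp_mul_le {g g1 g2 : ℝ → ℂ} (h1 : ∀ t, HasDerivAt g (g1 t) t)
    (h2 : ∀ t, HasDerivAt g1 (g2 t) t) (i0 : MeasureTheory.Integrable g)
    (i1 : MeasureTheory.Integrable g1) (i2 : MeasureTheory.Integrable g2) {L : ℝ} (hL : 0 < L) :
    ‖∫ t : ℝ, Complex.exp (L * t * Complex.I) * g t‖ ≤ (∫ t, ‖g2 t‖) / L ^ 2 := by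
  have hLc : (L : ℂ) ≠ 0 := by exact_mod_cast hL.ne'
  set v : ℝ → ℂ := fun t => Complex.exp (L * t * Complex.I) with hv_def
  set c : ℂ := (L * Complex.I)⁻¹ with hc
  have hv : ∀ t, HasDerivAt (fun t => c * v t) (v t) t := by
    intro t
    have h0 : HasDerivAt (fun t : ℝ => (L : ℂ) * t * Complex.I) (L * Complex.I) t := by
      simpa using ((hasDerivAt_id t).ofReal_comp.const_mul (L : ℂ)).mul_const Complex.I
    have := (h0.cexp).const_mul c
    refine this.congr_deriv ?_
    rw [hc]
    have := Complex.I_ne_zero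
    simp only [hv_def]
    field_simp
  have hvn : ∀ t, ‖v t‖ = 1 := fun t => by
    simp only [hv_def]
    rw [show (L : ℂ) * t * Complex.I = ((L * t : ℝ) : ℂ) * Complex.I by push_cast; ring]
    exact Complex.norm_exp_ofReal_mul_I _
  have hvc : Continuous v := by rw [hv_def]; fun_prop
  have hintegral : ∀ {f : ℝ → ℂ}, MeasureTheory.Integrable f →
      MeasureTheory.Integrable fun t => f t * v t := fun {f} hf =>
    hf.mul_bdd (c := 1) hvc.aestronglyMeasurable (MeasureTheory.ae_of_all _ fun t => (hvn t).le)
  have hintegral_mul : ∀ {f : ℝ → ℂ}, MeasureTheory.Integrable f →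
      MeasureTheory.Integrable fun t => f t * (c * v t) := fun {f} hf => by
    refine ((hintegral hf).const_mul c).congr (MeasureTheory.ae_of_all _ fun t => ?_)
    ring
  have step : ∀ {f f1 : ℝ → ℂ}, (∀ t, HasDerivAt f (f1 t) t) → MeasureTheory.Integrable f →
      MeasureTheory.Integrable f1 → ∫ t, f t * v t = -c * ∫ t, f1 t * v t := by
    intro f f1 hf if0 if1
    have := MeasureTheory.integral_mul_deriv_eq_deriv_mul_of_integrable (fun t _ => hf t)
      (fun t _ => hv t) (hintegral if0) (hintegral_mul if1) (hintegral_mul if0)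
    rw [this, neg_mul, ← MeasureTheory.integral_const_mul]
    congr 2
    ext t
    ring
  have heq : ∫ t : ℝ, v t * g t = c ^ 2 * ∫ t, g2 t * v t := by
    simp_rw [mul_comm (v _)]
    rw [step h1 i0 i1, step h2 i1 i2]
    ring
  rw [heq, norm_mul]
  have hcn : ‖c ^ 2‖ = 1 / L ^ 2 := by
    simp [hc]
  rw [hcn, div_mul_eq_mul_div, one_mul]
  gcongr
  refine (MeasureTheory.norm_integral_le_integral_norm _).trans (le_of_eq ?_)
  simp [hvn]

/-- The function `s ↦ B(s) / (s (s + 1))` and its first two derivatives. -/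
lemma exists_norm_smoothed_primeDiscrepancy_le : ∃ C : ℝ, 0 < C ∧ ∃ G1 G2 : ℂ → ℂ,
    (∀ s : ℂ, 1 < s.re → HasDerivAt (fun s => primeDiscrepancy s * (s⁻¹ * (s + 1)⁻¹)) (G1 s) s ∧
      HasDerivAt G1 (G2 s) s) ∧
    (ContinuousOn G2 {s | 1 < s.re}) ∧
    ∀ s : ℂ, 1 < s.re → s.re ≤ 2 →
      ‖primeDiscrepancy s * (s⁻¹ * (s + 1)⁻¹)‖ ≤ C * (1 + ‖s.im‖) ^ (-(3 / 2) : ℝ) ∧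
      ‖G1 s‖ ≤ C * (1 + ‖s.im‖) ^ (-(3 / 2) : ℝ) ∧
      ‖G2 s‖ ≤ C * (1 + ‖s.im‖) ^ (-(3 / 2) : ℝ) := by
  obtain ⟨C, hC, hB⟩ := exists_norm_primeDiscrepancy_le
  set B := primeDiscrepancy
  refine ⟨44 * C, by positivity,
    fun s => deriv B s * (s⁻¹ * (s + 1)⁻¹) + B s *
      (-(s⁻¹ ^ 2 * (s + 1)⁻¹) - s⁻¹ * (s + 1)⁻¹ ^ 2),
    fun s => deriv (deriv B) s * (s⁻¹ * (s + 1)⁻¹) + 2 * deriv B s *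
      (-(s⁻¹ ^ 2 * (s + 1)⁻¹) - s⁻¹ * (s + 1)⁻¹ ^ 2) + B s *
      (2 * s⁻¹ ^ 3 * (s + 1)⁻¹ + 2 * s⁻¹ ^ 2 * (s + 1)⁻¹ ^ 2 + 2 * s⁻¹ * (s + 1)⁻¹ ^ 3),
    ?_, ?_, ?_⟩
  all_goals
    have hne : ∀ s : ℂ, 1 < s.re → s ≠ 0 := by
      rintro s hs rfl
      norm_num at hs
    have hne1 : ∀ s : ℂ, 1 < s.re → s + 1 ≠ 0 := by
      intro s hs h0
      have := congrArg Complex.re h0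
      simp at this
      linarith
    have d0 := differentiableOn_primeDiscrepancy
    have d1 := d0.deriv isOpen_riemannZeta₁_ne_zero
    have d2 := d1.deriv isOpen_riemannZeta₁_ne_zero
    have hmem : ∀ s : ℂ, 1 < s.re → riemannZeta₁ s ≠ 0 := fun s hs => riemannZeta₁_ne_zero hs.le
  · intro s hs
    have hn := isOpen_riemannZeta₁_ne_zero.mem_nhds (hmem s hs)
    have e0 := (d0.differentiableAt hn).hasDerivAt
    have e1 := (d1.differentiableAt hn).hasDerivAt
    have p := hasDerivAt_inv (hne s hs)
    have q := ((hasDerivAt_id' s).add_const 1).fun_inv (hne1 s hs)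
    have hp := hne s hs
    have hq := hne1 s hs
    constructor
    · refine (e0.fun_mul (p.fun_mul q)).congr_deriv ?_
      field_simp
      ring
    · refine ((e1.fun_mul (p.fun_mul q)).fun_add (e0.fun_mul
        ((((p.fun_pow 2).fun_mul q).fun_neg).fun_sub (p.fun_mul (q.fun_pow 2))))).congr_deriv ?_
      push_cast
      field_simp
      ring
  · have hs : {s : ℂ | 1 < s.re} ⊆ {s | riemannZeta₁ s ≠ 0} := hmem
    have c0 := d0.continuousOn.mono hs
    have c1 := d1.continuousOn.mono hs
    have c2 := d2.continuousOn.mono hs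
    have p : ContinuousOn (fun s : ℂ => s⁻¹) {s | 1 < s.re} := continuousOn_id.inv₀ hne
    have q : ContinuousOn (fun s : ℂ => (s + 1)⁻¹) {s | 1 < s.re} :=
      (continuousOn_id.add continuousOn_const).inv₀ hne1
    fun_prop
  · intro s hs hs2
    obtain ⟨b0, b1, b2⟩ := hB s hs hs2
    obtain ⟨p1, p2⟩ := norm_inv_le_of_one_le_re hs.le
    obtain ⟨q1, q2⟩ := norm_inv_le_of_one_le_re (s := s + 1) (by simp; linarith)
    simp only [Complex.add_im, Complex.one_im, add_zero] at q1
    beta_reduce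
    rw [show (44 * C) * (1 + ‖s.im‖) ^ (-(3 / 2) : ℝ) =
      11 * C * (4 * (1 + ‖s.im‖) ^ (-(3 / 2) : ℝ)) by ring, ← two_rpow_bound_eq]
    set E : ℝ := (1 + |s.im|) ^ (1 / 2 : ℝ)
    set H : ℝ := 2 / (1 + |s.im|)
    have hE : 0 ≤ E := by positivity
    have hH : 0 ≤ H := by positivity
    have hCE : 0 ≤ C * E := by positivity
    generalize s⁻¹ = p at *
    generalize (s + 1)⁻¹ = q at *
    have hpq : ‖p * q‖ ≤ H ^ 2 := by rw [norm_mul, sq]; gcongr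
    have hmul : ∀ {u w : ℂ}, ‖u‖ ≤ H ^ 2 → ‖w‖ ≤ 1 → ‖u * w‖ ≤ H ^ 2 := fun {u w} hu hw => by
      rw [norm_mul]
      exact (mul_le_of_le_one_right (norm_nonneg _) hw).trans hu
    have k1 := hmul hpq p2
    have k2 := hmul hpq q2
    have k11 := hmul k1 p2
    have k12 := hmul k1 q2
    have k22 := hmul k2 q2
    have m1 : ‖-(p ^ 2 * q) - p * q ^ 2‖ ≤ 2 * H ^ 2 := by
      have := norm_add_le (p * q * p) (p * q * q)
      rw [← norm_neg, show -(-(p ^ 2 * q) - p * q ^ 2) = p * q * p + p * q * q by ring]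
      linarith
    have m2 : ‖2 * p ^ 3 * q + 2 * p ^ 2 * q ^ 2 + 2 * p * q ^ 3‖ ≤ 6 * H ^ 2 := by
      rw [show 2 * p ^ 3 * q + 2 * p ^ 2 * q ^ 2 + 2 * p * q ^ 3 =
        2 * (p * q * p * p + p * q * p * q + p * q * q * q) by ring, norm_mul, Complex.norm_ofNat]
      have := norm_add_le (p * q * p * p + p * q * p * q) (p * q * q * q)
      have := norm_add_le (p * q * p * p) (p * q * p * q)
      linarith
    have hprod : ∀ {u w : ℂ} {k : ℝ}, ‖u‖ ≤ C * E → ‖w‖ ≤ k * H ^ 2 →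
        ‖u * w‖ ≤ C * E * (k * H ^ 2) := fun {u w k} hu hw => by
      rw [norm_mul]
      exact mul_le_mul hu hw (norm_nonneg _) hCE
    have hpq' : ‖p * q‖ ≤ 1 * H ^ 2 := by rwa [one_mul]
    have z : 0 ≤ C * E * H ^ 2 := by positivity
    refine ⟨(hprod b0 hpq').trans (by linarith), (norm_add_le _ _).trans ?_,
      (norm_add₃_le).trans ?_⟩
    · have := hprod b1 hpq'
      have := hprod b0 m1
      linarith
    · have := hprod b2 hpq'
      have := hprod b1 m1
      have := hprod b0 m2
      rw [mul_assoc 2, norm_mul (2 : ℂ), Complex.norm_ofNat]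
      linarith

lemma exists_abs_sum_fejer_le : ∃ C : ℝ, 0 < C ∧ ∀ x : ℝ, Real.exp 1 ≤ x →
    |∑ n ∈ Finset.Icc 1 ⌊x⌋₊, (ArithmeticFunction.vonMangoldt n - 1) * (1 - n / x)| ≤
      C * x / Real.log x ^ 2 := by
  obtain ⟨C, hC, G1, G2, hder, hcont, hbound⟩ := exists_norm_smoothed_primeDiscrepancy_le
  set I : ℝ := ∫ t : ℝ, C * (1 + ‖t‖) ^ (-(3 / 2) : ℝ) with hI
  have hIint := integrable_one_add_norm_rpow.const_mul C
  have hI0 : 0 ≤ I := MeasureTheory.integral_nonneg fun t => by positivity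
  refine ⟨(1 / (2 * Real.pi)) * Real.exp 1 * I + 1, by positivity, fun x hx => ?_⟩
  have hx0 : 0 < x := (Real.exp_pos 1).trans_le hx
  set L := Real.log x with hL
  have hL1 : 1 ≤ L := by rwa [hL, Real.le_log_iff_exp_le hx0]
  set σ : ℝ := 1 + 1 / L with hσ_def
  have hσ : 1 < σ := by
    have : 0 < 1 / L := by positivity
    linarith
  have hσ2 : σ ≤ 2 := by
    have : 1 / L ≤ 1 := by rw [div_le_one (by linarith)]; exact hL1
    linarith
  have hxσ : x ^ σ = Real.exp 1 * x := by
    rw [Real.rpow_def_of_pos hx0, ← hL, hσ_def, mul_add, mul_one, mul_one_div_cancel (by linarith),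
      Real.exp_add, hL, Real.exp_log hx0, mul_comm]
  set G : ℂ → ℂ := fun s => primeDiscrepancy s * (s⁻¹ * (s + 1)⁻¹) with hG
  have hre : ∀ t : ℝ, (σ + t * Complex.I : ℂ).re = σ := fun t => by simp
  have him : ∀ t : ℝ, (σ + t * Complex.I : ℂ).im = t := fun t => by simp
  have hre1 : ∀ t : ℝ, 1 < (σ + t * Complex.I : ℂ).re := fun t => by rw [hre]; exact hσ
  have hline : ∀ t : ℝ, HasDerivAt (fun t : ℝ => (σ + t * Complex.I : ℂ)) Complex.I t := fun t => by
    simpa using ((hasDerivAt_id t).ofReal_comp.mul_const Complex.I).const_add (σ : ℂ)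
  have hb := fun t : ℝ => hbound (σ + t * Complex.I) (hre1 t) (by rw [hre]; exact hσ2)
  simp only [him] at hb
  have e0 : ∀ t : ℝ, HasDerivAt (fun t : ℝ => G (σ + t * Complex.I))
      (G1 (σ + t * Complex.I) * Complex.I) t := fun t => by
    have := (hder _ (hre1 t)).1.comp t (hline t)
    exact this
  have e1 : ∀ t : ℝ, HasDerivAt (fun t : ℝ => G1 (σ + t * Complex.I) * Complex.I)
      (G2 (σ + t * Complex.I) * Complex.I * Complex.I) t := fun t =>
    ((hder _ (hre1 t)).2.comp t (hline t)).mul_const Complex.I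
  have c0 : Continuous fun t : ℝ => G (σ + t * Complex.I) :=
    continuous_iff_continuousAt.mpr fun t => (e0 t).continuousAt
  have c1 : Continuous fun t : ℝ => G1 (σ + t * Complex.I) * Complex.I :=
    continuous_iff_continuousAt.mpr fun t => (e1 t).continuousAt
  have c2 : Continuous fun t : ℝ => G2 (σ + t * Complex.I) * Complex.I * Complex.I :=
    ((hcont.comp_continuous (by fun_prop) hre1).mul continuous_const).mul continuous_const
  have i0 : MeasureTheory.Integrable fun t : ℝ => G (σ + t * Complex.I) :=
    hIint.mono' c0.aestronglyMeasurable (MeasureTheory.ae_of_all _ fun t => (hb t).1)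
  have i1 : MeasureTheory.Integrable fun t : ℝ => G1 (σ + t * Complex.I) * Complex.I :=
    hIint.mono' c1.aestronglyMeasurable (MeasureTheory.ae_of_all _ fun t => by
      simpa using (hb t).2.1)
  have i2 : MeasureTheory.Integrable fun t : ℝ => G2 (σ + t * Complex.I) * Complex.I * Complex.I :=
    hIint.mono' c2.aestronglyMeasurable (MeasureTheory.ae_of_all _ fun t => by
      simpa using (hb t).2.2)
  have hI2 : ∫ t : ℝ, ‖G2 (σ + t * Complex.I) * Complex.I * Complex.I‖ ≤ I :=
    MeasureTheory.integral_mono i2.norm hIint fun t => by simpa using (hb t).2.2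
  have hosc := norm_integral_exp_mul_le e0 e1 i0 i1 i2 (L := L) (by linarith)
  have hsum := tsum_fejer_eq_integral hσ hx0
  have hxt : ∀ t : ℝ, (x : ℂ) ^ (σ + t * Complex.I : ℂ) =
      (x ^ σ : ℝ) * Complex.exp (L * t * Complex.I) := fun t => by
    have hxc : (x : ℂ) ≠ 0 := by exact_mod_cast hx0.ne'
    rw [Complex.cpow_add _ _ hxc, Complex.ofReal_cpow hx0.le, Complex.cpow_def_of_ne_zero hxc
      (t * Complex.I), ← Complex.ofReal_log hx0.le, hL]
    congr 2
    ring
  simp_rw [hxt, mul_assoc ((x ^ σ : ℝ) : ℂ)] at hsum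
  rw [MeasureTheory.integral_const_mul] at hsum
  have hfin : HasSum (fun n : ℕ => if n = 0 then (0 : ℂ) else
      ((ArithmeticFunction.vonMangoldt n : ℂ) - 1) * ((max (1 - n / x) 0 : ℝ) : ℂ))
      ((∑ n ∈ Finset.Icc 1 ⌊x⌋₊,
        (ArithmeticFunction.vonMangoldt n - 1) * (1 - n / x) : ℝ) : ℂ) := by
    rw [Complex.ofReal_sum]
    have : ∀ n ∈ Finset.Icc 1 ⌊x⌋₊,
        (((ArithmeticFunction.vonMangoldt n - 1) * (1 - n / x) : ℝ) : ℂ) =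
        if n = 0 then (0 : ℂ) else
        ((ArithmeticFunction.vonMangoldt n : ℂ) - 1) * ((max (1 - n / x) 0 : ℝ) : ℂ) := by
      intro n hn
      rw [Finset.mem_Icc] at hn
      have h1 : (n : ℝ) / x ≤ 1 := by
        rw [div_le_one hx0]
        exact (Nat.le_floor_iff hx0.le).mp hn.2
      rw [if_neg (by omega), max_eq_left (by linarith)]
      push_cast
      ring
    rw [Finset.sum_congr rfl this]
    refine hasSum_sum_of_ne_finset_zero fun n hn => ?_
    rcases Nat.eq_zero_or_pos n with rfl | hn0
    · simp
    · have h1 : ⌊x⌋₊ < n := by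
        by_contra h
        exact hn (Finset.mem_Icc.mpr ⟨hn0, not_lt.mp h⟩)
      have h2 : 1 ≤ (n : ℝ) / x := by
        rw [le_div_iff₀ hx0, one_mul]
        exact ((Nat.floor_lt hx0.le).mp h1).le
      rw [if_neg (by omega), max_eq_right (by linarith)]
      simp
  have heq := hfin.unique hsum
  rw [← Real.norm_eq_abs, ← Complex.norm_real, heq, norm_smul, norm_mul, Complex.norm_real,
    Real.norm_of_nonneg (by positivity), Real.norm_of_nonneg (by positivity), hxσ]
  calc _ ≤ 1 / (2 * Real.pi) * (Real.exp 1 * x * (I / L ^ 2)) := by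
        gcongr
        exact hosc.trans (by gcongr)
    _ = (1 / (2 * Real.pi)) * Real.exp 1 * I * x / L ^ 2 := by ring
    _ ≤ _ := by
      gcongr
      linarith

/-- The sum `∑_{n ≤ x} (Λ(n) - 1) (x - n)`. -/
noncomputable def smoothedPsiError (x : ℝ) : ℝ :=
  ∑ n ∈ Ioc 0 ⌊x⌋₊, (ArithmeticFunction.vonMangoldt n - 1) * (x - n)

lemma exists_abs_smoothedPsiError_le : ∃ C : ℝ, 0 < C ∧ ∀ x : ℝ, Real.exp 1 ≤ x →
    |smoothedPsiError x| ≤ C * x ^ 2 / Real.log x ^ 2 := by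
  obtain ⟨C, hC, h⟩ := exists_abs_sum_fejer_le
  refine ⟨C, hC, fun x hx => ?_⟩
  have hx0 : 0 < x := (Real.exp_pos 1).trans_le hx
  have heq : smoothedPsiError x = x *
      ∑ n ∈ Finset.Icc 1 ⌊x⌋₊, (ArithmeticFunction.vonMangoldt n - 1) * (1 - n / x) := by
    rw [smoothedPsiError, Finset.mul_sum]
    refine Finset.sum_congr rfl fun n _ => ?_
    field_simp
  rw [heq, abs_mul, abs_of_pos hx0]
  calc x * _ ≤ x * (C * x / Real.log x ^ 2) := by gcongr; exact h x hx
    _ = _ := by ring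

lemma psi_sub_floor_eq (x : ℝ) : Chebyshev.psi x - ⌊x⌋₊ =
    ∑ n ∈ Ioc 0 ⌊x⌋₊, (ArithmeticFunction.vonMangoldt n - 1) := by
  rw [Finset.sum_sub_distrib, Chebyshev.psi]
  simp

lemma smoothedPsiError_sub {y z : ℝ} (hyz : y ≤ z) :
    smoothedPsiError z - smoothedPsiError y = (z - y) * (Chebyshev.psi y - ⌊y⌋₊) +
      ∑ n ∈ Ioc ⌊y⌋₊ ⌊z⌋₊, (ArithmeticFunction.vonMangoldt n - 1) * (z - n) := by
  have hf := Nat.floor_le_floor hyz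
  rw [smoothedPsiError, smoothedPsiError, psi_sub_floor_eq,
    ← Finset.sum_Ioc_consecutive _ (Nat.zero_le _) hf, Finset.mul_sum, add_sub_right_comm,
    ← Finset.sum_sub_distrib]
  congr 1
  refine Finset.sum_congr rfl fun n _ => ?_
  ring

lemma neg_le_sum_vonMangoldt_sub_one_mul {y z h : ℝ} (hy : 0 ≤ y) (hyz : y ≤ z) (w : ℕ → ℝ)
    (hw0 : ∀ n ∈ Ioc ⌊y⌋₊ ⌊z⌋₊, 0 ≤ w n) (hwh : ∀ n ∈ Ioc ⌊y⌋₊ ⌊z⌋₊, w n ≤ h) (hh : 0 ≤ h) :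
    -(h * (z - y + 1)) ≤ ∑ n ∈ Ioc ⌊y⌋₊ ⌊z⌋₊, (ArithmeticFunction.vonMangoldt n - 1) * w n := by
  have h1 : ∑ n ∈ Ioc ⌊y⌋₊ ⌊z⌋₊, -h ≤
      ∑ n ∈ Ioc ⌊y⌋₊ ⌊z⌋₊, (ArithmeticFunction.vonMangoldt n - 1) * w n := by
    refine Finset.sum_le_sum fun n hn => ?_
    have := ArithmeticFunction.vonMangoldt_nonneg (n := n)
    nlinarith [hw0 n hn, hwh n hn, mul_nonneg this (hw0 n hn)]
  refine le_trans ?_ h1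
  rw [Finset.sum_const, Nat.card_Ioc, nsmul_eq_mul, Nat.cast_sub (Nat.floor_le_floor hyz)]
  have e1 := Nat.floor_le (hy.trans hyz)
  have e2 := Nat.lt_floor_add_one y
  nlinarith

lemma mul_psi_sub_floor_le {y h : ℝ} (hy : 0 ≤ y) (hh : 0 ≤ h) :
    h * (Chebyshev.psi y - ⌊y⌋₊) ≤
      smoothedPsiError (y + h) - smoothedPsiError y + h * (h + 1) := by
  have hyz : y ≤ y + h := by linarith
  have h1 := smoothedPsiError_sub hyz
  have h2 := neg_le_sum_vonMangoldt_sub_one_mul hy hyz (fun n => y + h - n) (h := h) ?_ ?_ hh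
  · simp only [add_sub_cancel_left] at h1 h2
    linarith
  · intro n hn
    have := (Nat.le_floor_iff (by linarith)).mp (mem_Ioc.mp hn).2
    simpa using this
  · intro n hn
    have := (Nat.floor_lt hy).mp (mem_Ioc.mp hn).1
    linarith

lemma le_mul_psi_sub_floor {y h : ℝ} (hy : 0 ≤ y) (hh : 0 ≤ h) :
    smoothedPsiError (y + h) - smoothedPsiError y - h * (h + 1) ≤
      h * (Chebyshev.psi (y + h) - ⌊y + h⌋₊) := by
  have hyz : y ≤ y + h := by linarith
  have h1 := smoothedPsiError_sub hyz
  have h2 := neg_le_sum_vonMangoldt_sub_one_mul hy hyz (fun n => n - y) (h := h) ?_ ?_ hh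
  · rw [psi_sub_floor_eq] at h1
    rw [psi_sub_floor_eq, ← Finset.sum_Ioc_consecutive _ (Nat.zero_le _)
      (Nat.floor_le_floor hyz), mul_add]
    have h3 : ∑ n ∈ Ioc ⌊y⌋₊ ⌊y + h⌋₊, (ArithmeticFunction.vonMangoldt n - 1) * (y + h - n) =
        h * ∑ n ∈ Ioc ⌊y⌋₊ ⌊y + h⌋₊, (ArithmeticFunction.vonMangoldt n - 1) -
        ∑ n ∈ Ioc ⌊y⌋₊ ⌊y + h⌋₊, (ArithmeticFunction.vonMangoldt n - 1) * (n - y) := by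
      rw [Finset.mul_sum, ← Finset.sum_sub_distrib]
      exact Finset.sum_congr rfl fun n _ => by ring
    simp only [add_sub_cancel_left] at h1 h2
    linarith
  · intro n hn
    have := (Nat.floor_lt hy).mp (mem_Ioc.mp hn).1
    linarith
  · intro n hn
    have := (Nat.le_floor_iff (by linarith)).mp (mem_Ioc.mp hn).2
    linarith

/-- The prime number theorem with error term `O(x / log x)`. -/
theorem exists_abs_psi_sub_le : ∃ C : ℝ, 0 < C ∧ ∀ x : ℝ, 2 ≤ x →
    |Chebyshev.psi x - x| ≤ C * x / Real.log x := by
  obtain ⟨C, hC, hD⟩ := exists_abs_smoothedPsiError_le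
  refine ⟨5 * C + 28, by positivity, fun x hx => ?_⟩
  have hx0 : 0 < x := by linarith
  have hL0 : 0 < Real.log x := Real.log_pos (by linarith)
  rcases lt_or_ge (Real.log x) 4 with hL | hL
  · have h1 := Chebyshev.psi_le_const_mul_self hx0.le
    have h2 := Chebyshev.psi_nonneg x
    have h3 : Real.log 4 ≤ 2 := by
      rw [show (4 : ℝ) = 2 ^ 2 by norm_num, Real.log_pow]
      have := Real.log_two_lt_d9
      push_cast
      linarith
    have h4 : |Chebyshev.psi x - x| ≤ 7 * x := by
      rw [abs_le]
      constructor <;> nlinarith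
    refine h4.trans ?_
    rw [le_div_iff₀ hL0]
    nlinarith [mul_pos hC hx0]
  · set L := Real.log x with hL_def
    have hxL : x = Real.exp L := (Real.exp_log hx0).symm
    have hLx : L + 1 ≤ x := by rw [hxL]; exact Real.add_one_le_exp L
    set h : ℝ := x / L with hh_def
    have hh : 0 < h := by positivity
    have hhx : h ≤ x / 4 := by rw [hh_def]; gcongr
    have h1h : 1 ≤ h := by rw [hh_def, one_le_div hL0]; linarith
    have hhL : h * L = x := by rw [hh_def]; field_simp
    have he : Real.exp 1 ≤ x / 2 := by
      have : Real.exp 1 * 2 ≤ x := by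
        rw [hxL]
        calc Real.exp 1 * 2 ≤ Real.exp 1 * Real.exp 1 := by
              gcongr
              linarith [Real.add_one_le_exp (1 : ℝ)]
          _ = Real.exp 2 := by rw [← Real.exp_add]; norm_num
          _ ≤ _ := by gcongr; linarith
      linarith
    have hD0 := hD x (by linarith)
    have hD1 := hD (x + h) (by linarith)
    have hD2 := hD (x - h) (by linarith)
    have hD1' : |smoothedPsiError (x + h)| ≤ 4 * C * h ^ 2 := by
      refine hD1.trans ?_
      have : L ≤ Real.log (x + h) := Real.log_le_log hx0 (by linarith)
      calc C * (x + h) ^ 2 / Real.log (x + h) ^ 2 ≤ C * (2 * x) ^ 2 / L ^ 2 := by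
            gcongr; linarith
        _ = _ := by rw [hh_def]; ring
    have hD2' : |smoothedPsiError (x - h)| ≤ 4 * C * h ^ 2 := by
      refine hD2.trans ?_
      have : L / 2 ≤ Real.log (x - h) := by
        have h1 : Real.log (x / 2) ≤ Real.log (x - h) :=
          Real.log_le_log (by linarith) (by linarith)
        rw [Real.log_div hx0.ne' (by norm_num)] at h1
        have := Real.log_two_lt_d9
        linarith
      have h0 : 0 ≤ x - h := by linarith
      calc C * (x - h) ^ 2 / Real.log (x - h) ^ 2 ≤ C * x ^ 2 / (L / 2) ^ 2 := by
            gcongr; linarith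
        _ = _ := by rw [hh_def]; field_simp; norm_num
    have hD0' : |smoothedPsiError x| ≤ C * h ^ 2 := by
      refine hD0.trans (le_of_eq ?_)
      rw [hh_def]; ring
    have hup := mul_psi_sub_floor_le hx0.le hh.le
    have hlow := le_mul_psi_sub_floor (y := x - h) (by linarith) hh.le
    rw [sub_add_cancel] at hlow
    rw [abs_le] at hD0' hD1' hD2'
    have hfl := Nat.floor_le hx0.le
    have hfl2 := Nat.lt_floor_add_one x
    have hu : Chebyshev.psi x - ⌊x⌋₊ ≤ (5 * C) * h + (h + 1) := by
      refine le_of_mul_le_mul_left ?_ hh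
      linarith
    have hl : -((5 * C) * h + (h + 1)) ≤ Chebyshev.psi x - ⌊x⌋₊ := by
      refine le_of_mul_le_mul_left ?_ hh
      linarith
    rw [mul_div_assoc, ← hh_def, abs_le]
    constructor <;> linarith

lemma psi_le_seven_mul {x : ℝ} (hx : 0 ≤ x) : Chebyshev.psi x ≤ 7 * x := by
  have h3 : Real.log 4 ≤ 2 := by
    rw [show (4 : ℝ) = 2 ^ 2 by norm_num, Real.log_pow]
    have := Real.log_two_lt_d9
    push_cast
    linarith
  refine (Chebyshev.psi_le_const_mul_self hx).trans ?_
  gcongr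
  linarith

lemma psi_natCast (N : ℕ) : Chebyshev.psi N = ∑ n ∈ Ioc 0 N, ArithmeticFunction.vonMangoldt n := by
  rw [Chebyshev.psi, Nat.floor_natCast]

lemma psi_mul_log_sub_sum_vonMangoldt_mul_log (N : ℕ) :
    0 ≤ Chebyshev.psi N * Real.log N -
      ∑ n ∈ Ioc 0 N, ArithmeticFunction.vonMangoldt n * Real.log n ∧
    Chebyshev.psi N * Real.log N -
      ∑ n ∈ Ioc 0 N, ArithmeticFunction.vonMangoldt n * Real.log n ≤ 7 * N := by
  induction N with
  | zero => simp
  | succ N ih =>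
    rw [Finset.sum_Ioc_succ_top (Nat.zero_le _)]
    rw [psi_natCast, Finset.sum_Ioc_succ_top (Nat.zero_le _), ← psi_natCast]
    have h0 : 0 ≤ Real.log (N + 1 : ℕ) - Real.log N := by
      rcases Nat.eq_zero_or_pos N with rfl | hN
      · simp
      · rw [sub_nonneg]
        exact Real.log_le_log (by positivity) (by push_cast; linarith)
    have h1 : Chebyshev.psi N * (Real.log (N + 1 : ℕ) - Real.log N) ≤ 7 := by
      rcases Nat.eq_zero_or_pos N with rfl | hN
      · simp
      · have hN' : (0 : ℝ) < N := by positivity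
        have h2 : Real.log (N + 1 : ℕ) - Real.log N ≤ 1 / N := by
          rw [← Real.log_div (by positivity) hN'.ne']
          refine (Real.log_le_sub_one_of_pos (by positivity)).trans (le_of_eq ?_)
          push_cast
          field_simp
          ring
        calc _ ≤ (7 * N : ℝ) * (1 / N) := by
              gcongr
              exact psi_le_seven_mul hN'.le
          _ = 7 := by field_simp
    have h2 := mul_nonneg (Chebyshev.psi_nonneg N) h0
    push_cast at *
    constructor
    · nlinarith
    · nlinarith

lemma exists_abs_sum_vonMangoldt_mul_log_sub_le : ∃ C : ℝ, 0 < C ∧ ∀ N : ℕ,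
    |∑ n ∈ Ioc 0 N, ArithmeticFunction.vonMangoldt n * Real.log n - N * Real.log N| ≤ C * N := by
  obtain ⟨C, hC, h⟩ := exists_abs_psi_sub_le
  refine ⟨C + 7, by positivity, fun N => ?_⟩
  rcases lt_or_ge N 2 with hN | hN
  · interval_cases N <;> simp <;> linarith
  have hN' : (2 : ℝ) ≤ N := by exact_mod_cast hN
  have hlog : 0 < Real.log N := Real.log_pos (by linarith)
  have h1 : |Chebyshev.psi N - N| * Real.log N ≤ C * N := by
    have := h N hN'
    rwa [le_div_iff₀ hlog] at this
  have h1' : |(Chebyshev.psi N - N) * Real.log N| ≤ C * N := by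
    rwa [abs_mul, abs_of_pos hlog]
  rw [abs_le] at h1'
  obtain ⟨h2, h3⟩ := psi_mul_log_sub_sum_vonMangoldt_mul_log N
  obtain ⟨h4, h5⟩ := h1'
  rw [abs_le]
  constructor <;> linarith

lemma log_factorial_bounds (N : ℕ) :
    N * Real.log N - N ≤ Real.log N.factorial ∧ Real.log N.factorial ≤ N * Real.log N := by
  constructor
  · induction N with
    | zero => simp
    | succ N ih =>
      rw [Nat.factorial_succ, Nat.cast_mul, Real.log_mul (by positivity) (by positivity)]
      rcases Nat.eq_zero_or_pos N with rfl | hN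
      · simp
      · have hN' : (0 : ℝ) < N := by positivity
        have h2 : Real.log (N + 1 : ℕ) - Real.log N ≤ 1 / N := by
          rw [← Real.log_div (by positivity) hN'.ne']
          refine (Real.log_le_sub_one_of_pos (by positivity)).trans (le_of_eq ?_)
          push_cast
          field_simp
          ring
        rw [le_div_iff₀ hN'] at h2
        push_cast at *
        nlinarith
  · rw [← Real.log_pow]
    refine Real.log_le_log (by positivity) ?_
    exact_mod_cast Nat.factorial_le_pow N

lemma abs_sum_vonMangoldt_div_sub_log_le {N : ℕ} (hN : 0 < N) :
    |∑ n ∈ Ioc 0 N, ArithmeticFunction.vonMangoldt n / n - Real.log N| ≤ 7 := by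
  have hN' : (0 : ℝ) < N := by positivity
  have h1 : ∑ n ∈ Ioc 0 N, ArithmeticFunction.vonMangoldt n * ((N / n : ℕ) : ℝ) =
      Real.log N.factorial := by
    rw [← ArithmeticFunction.sum_Ioc_mul_zeta_eq_sum, ArithmeticFunction.vonMangoldt_mul_zeta,
      ← Finset.prod_Ico_id_eq_factorial, Nat.cast_prod, Real.log_prod fun i hi => by
        have := (Finset.mem_Ico.mp hi).1
        positivity]
    rfl
  obtain ⟨h2, h3⟩ := log_factorial_bounds N
  have h4 : (N : ℝ) * ∑ n ∈ Ioc 0 N, ArithmeticFunction.vonMangoldt n / n -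
      Real.log N.factorial =
      ∑ n ∈ Ioc 0 N, ArithmeticFunction.vonMangoldt n * (N / n - ((N / n : ℕ) : ℝ)) := by
    rw [← h1, Finset.mul_sum, ← Finset.sum_sub_distrib]
    exact Finset.sum_congr rfl fun n _ => by ring
  have h5 : ∀ n : ℕ, 0 ≤ (N / n : ℝ) - ((N / n : ℕ) : ℝ) := fun n => by
    linarith [Nat.cast_div_le (α := ℝ) (m := N) (n := n)]
  have h6 : 0 ≤ ∑ n ∈ Ioc 0 N,
      ArithmeticFunction.vonMangoldt n * (N / n - ((N / n : ℕ) : ℝ)) :=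
    Finset.sum_nonneg fun n _ => mul_nonneg ArithmeticFunction.vonMangoldt_nonneg (h5 n)
  have h7 : ∑ n ∈ Ioc 0 N,
      ArithmeticFunction.vonMangoldt n * (N / n - ((N / n : ℕ) : ℝ)) ≤ Chebyshev.psi N := by
    rw [psi_natCast]
    refine Finset.sum_le_sum fun n hn => ?_
    refine mul_le_of_le_one_right ArithmeticFunction.vonMangoldt_nonneg ?_
    have h8 := Nat.lt_floor_add_one ((N : ℝ) / n)
    rw [Nat.floor_div_eq_div] at h8
    linarith
  have h8 := psi_le_seven_mul hN'.le
  have e1 : (N : ℝ) * (∑ n ∈ Ioc 0 N, ArithmeticFunction.vonMangoldt n / n - Real.log N) ≤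
      N * 7 := by linarith
  have e2 : (N : ℝ) * (-7) ≤
      N * (∑ n ∈ Ioc 0 N, ArithmeticFunction.vonMangoldt n / n - Real.log N) := by linarith
  exact abs_le.mpr ⟨le_of_mul_le_mul_left e2 hN', le_of_mul_le_mul_left e1 hN'⟩

lemma sum_vonMangoldt_pairs_eq (N : ℕ) :
    ∑ q ∈ Ioc 0 N ×ˢ Ioc 0 N with q.1 * q.2 ≤ N,
      ArithmeticFunction.vonMangoldt q.1 * ArithmeticFunction.vonMangoldt q.2 =
    2 * ∑ a ∈ Ioc 0 N.sqrt, ArithmeticFunction.vonMangoldt a * Chebyshev.psi (N / a) -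
      Chebyshev.psi N.sqrt ^ 2 := by
  set s := N.sqrt
  set P := Ioc 0 N ×ˢ Ioc 0 N
  set w : ℕ × ℕ → ℝ := fun q =>
    ArithmeticFunction.vonMangoldt q.1 * ArithmeticFunction.vonMangoldt q.2 with hw
  have hss : s * s ≤ N := Nat.sqrt_le N
  have hlt : N < (s + 1) * (s + 1) := Nat.lt_succ_sqrt N
  have hA : ∑ q ∈ P with q.1 * q.2 ≤ N ∧ q.1 ≤ s, w q =
      ∑ a ∈ Ioc 0 s, ArithmeticFunction.vonMangoldt a * Chebyshev.psi (N / a) := by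
    simp_rw [Chebyshev.psi, Nat.floor_div_eq_div, Finset.mul_sum, Finset.sum_sigma']
    refine Finset.sum_nbij' (fun q => ⟨q.1, q.2⟩) (fun x => (x.1, x.2)) ?_ ?_ (by simp) (by simp)
      (by simp [hw])
    · rintro ⟨a, b⟩ hq
      simp only [P, Finset.mem_filter, Finset.mem_product, Finset.mem_Ioc, Finset.mem_sigma]
        at hq ⊢
      refine ⟨⟨hq.1.1.1, hq.2.2⟩, hq.1.2.1, ?_⟩
      rw [Nat.le_div_iff_mul_le hq.1.1.1, mul_comm]
      exact hq.2.1
    · rintro ⟨a, b⟩ hq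
      simp only [P, Finset.mem_filter, Finset.mem_product, Finset.mem_Ioc, Finset.mem_sigma]
        at hq ⊢
      rw [Nat.le_div_iff_mul_le hq.1.1, mul_comm] at hq
      refine ⟨⟨⟨hq.1.1, ?_⟩, hq.2.1, ?_⟩, hq.2.2, hq.1.2⟩
      · exact (Nat.le_mul_of_pos_right a hq.2.1).trans hq.2.2
      · exact (Nat.le_mul_of_pos_left b hq.1.1).trans hq.2.2
  have hB : ∑ q ∈ P with q.1 * q.2 ≤ N ∧ q.2 ≤ s, w q =
      ∑ q ∈ P with q.1 * q.2 ≤ N ∧ q.1 ≤ s, w q := by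
    refine Finset.sum_nbij' Prod.swap Prod.swap ?_ ?_ (by simp) (by simp) ?_
    · intro q; simp [P, mul_comm q.1]; tauto
    · intro q; simp [P, mul_comm q.1]; tauto
    · intro q _; simp [hw, mul_comm]
  have hC : ∑ q ∈ P with q.1 ≤ s ∧ q.2 ≤ s, w q = Chebyshev.psi s ^ 2 := by
    rw [psi_natCast, sq, Finset.sum_mul_sum, ← Finset.sum_product']
    refine Finset.sum_congr ?_ fun _ _ => rfl
    have hsN : s ≤ N := Nat.sqrt_le_self N
    ext ⟨a, b⟩
    simp only [P, Finset.mem_filter, Finset.mem_product, Finset.mem_Ioc]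
    lia
  rw [two_mul, ← hA]
  nth_rewrite 2 [← hB]
  rw [← hC]
  simp only [Finset.sum_filter]
  rw [← Finset.sum_add_distrib, ← Finset.sum_sub_distrib]
  refine Finset.sum_congr rfl fun q _ => ?_
  by_cases h1 : q.1 ≤ s <;> by_cases h2 : q.2 ≤ s
  · have h3 : q.1 * q.2 ≤ N := (Nat.mul_le_mul h1 h2).trans hss
    simp [h1, h2, h3, hw]
  · simp [h1, h2, hw]
  · simp [h1, h2, hw]
  · have h3 : ¬ q.1 * q.2 ≤ N := fun h3 => by
      have := Nat.mul_le_mul (not_le.mp h1) (not_le.mp h2)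
      simp only [Nat.succ_eq_add_one] at *
      lia
    simp [h1, h2, h3]

lemma exists_abs_sum_vonMangoldt_pairs_sub_le : ∃ C : ℝ, 0 < C ∧ ∀ N : ℕ,
    |∑ q ∈ Ioc 0 N ×ˢ Ioc 0 N with q.1 * q.2 ≤ N,
      ArithmeticFunction.vonMangoldt q.1 * ArithmeticFunction.vonMangoldt q.2 -
        N * Real.log N| ≤ C * N := by
  obtain ⟨C, hC, h⟩ := exists_abs_psi_sub_le
  refine ⟨30 * C + 65, by positivity, fun N => ?_⟩
  rw [sum_vonMangoldt_pairs_eq]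
  rcases lt_or_ge N 4 with hN | hN
  · have hs : N.sqrt ≤ 1 := Nat.lt_succ_iff.mp (Nat.sqrt_lt.mpr hN)
    have h1 : Chebyshev.psi N.sqrt = 0 :=
      Chebyshev.psi_eq_zero_of_lt_two (by exact_mod_cast Nat.lt_succ_iff.mpr hs)
    have h2 : ∑ a ∈ Ioc 0 N.sqrt, ArithmeticFunction.vonMangoldt a * Chebyshev.psi (N / a) = 0 :=
      Finset.sum_eq_zero fun a ha => by
        have : a = 1 := by
          have := Finset.mem_Ioc.mp ha
          lia
        simp [this]
    rw [h1, h2, zero_pow two_ne_zero, mul_zero, sub_zero, zero_sub, abs_neg,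
      abs_of_nonneg (mul_nonneg (Nat.cast_nonneg _) (Real.log_natCast_nonneg _)), mul_comm]
    gcongr
    have := Real.log_le_self (Nat.cast_nonneg (α := ℝ) N)
    have : (N : ℝ) ≤ 4 := by exact_mod_cast hN.le
    linarith
  set s := N.sqrt
  have hs2 : 2 ≤ s := Nat.le_sqrt.mpr (by lia)
  have hs2' : (2 : ℝ) ≤ s := by exact_mod_cast hs2
  have hss : (s : ℝ) * s ≤ N := by exact_mod_cast Nat.sqrt_le N
  have hlt : (N : ℝ) < (s + 1) * (s + 1) := by exact_mod_cast Nat.lt_succ_sqrt N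
  have hN' : (4 : ℝ) ≤ N := by exact_mod_cast hN
  have hN0 : (0 : ℝ) < N := by linarith
  have hl2 := Real.log_two_lt_d9
  have hL : 1 ≤ Real.log N := by
    have h4 : Real.log 4 = 2 * Real.log 2 := by
      rw [show (4 : ℝ) = 2 ^ 2 by norm_num, Real.log_pow]
      norm_num
    have := Real.log_le_log (by norm_num) hN'
    have := Real.log_two_gt_d9
    linarith
  have hls : 2 * Real.log s ≤ Real.log N := by
    have := Real.log_le_log (by positivity) hss
    rwa [Real.log_mul (by positivity) (by positivity), ← two_mul] at this
  have hls' : Real.log N ≤ 2 * Real.log s + 2 := by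
    have : (N : ℝ) ≤ (2 * s) * (2 * s) := by nlinarith
    have := Real.log_le_log hN0 this
    rw [Real.log_mul (by positivity) (by positivity), Real.log_mul (by positivity) (by positivity)]
      at this
    linarith
  set M := ∑ n ∈ Ioc 0 s, ArithmeticFunction.vonMangoldt n / n with hM
  obtain ⟨hM1, hM2⟩ := abs_le.mp (abs_sum_vonMangoldt_div_sub_log_le (N := s) (by lia))
  have hE : |∑ a ∈ Ioc 0 s, ArithmeticFunction.vonMangoldt a * Chebyshev.psi (N / a) - N * M| ≤
      2 * C * N / Real.log N * M := by
    rw [hM, Finset.mul_sum, Finset.mul_sum, ← Finset.sum_sub_distrib]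
    refine (Finset.abs_sum_le_sum_abs _ _).trans (Finset.sum_le_sum fun a ha => ?_)
    obtain ⟨ha0, has⟩ := Finset.mem_Ioc.mp ha
    have ha0' : (0 : ℝ) < a := by positivity
    have has' : (a : ℝ) ≤ s := by exact_mod_cast has
    have h1 : (s : ℝ) ≤ N / a := by
      rw [le_div_iff₀ ha0']
      nlinarith
    have h2 : Real.log N ≤ 2 * Real.log (N / a) := by
      have h3 : (N : ℝ) ≤ N / a * (N / a) := by
        have h4 : (a : ℝ) * a ≤ N := by nlinarith
        rw [div_mul_div_comm, le_div_iff₀ (by positivity)]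
        nlinarith
      have h5 := Real.log_le_log hN0 h3
      rwa [Real.log_mul (by positivity) (by positivity), ← two_mul] at h5
    have h6 := h (N / a) (hs2'.trans h1)
    have h7 : C * ((N : ℝ) / a) / Real.log (N / a) ≤ 2 * C * N / Real.log N / a := by
      rw [div_le_iff₀ (by linarith), div_div, div_mul_eq_mul_div, le_div_iff₀ (by positivity)]
      have : C * ((N : ℝ) / a) * (Real.log N * a) = C * N * Real.log N := by field_simp
      rw [this]
      have := mul_le_mul_of_nonneg_left h2 (by positivity : 0 ≤ C * N)
      linarith
    rw [show ArithmeticFunction.vonMangoldt a * Chebyshev.psi (N / a) -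
      N * (ArithmeticFunction.vonMangoldt a / a) =
      ArithmeticFunction.vonMangoldt a * (Chebyshev.psi (N / a) - N / a) by ring, abs_mul,
      abs_of_nonneg ArithmeticFunction.vonMangoldt_nonneg]
    calc _ ≤ ArithmeticFunction.vonMangoldt a * (2 * C * N / Real.log N / a) :=
          mul_le_mul_of_nonneg_left (h6.trans h7) ArithmeticFunction.vonMangoldt_nonneg
      _ = _ := by ring
  have hE2 : 2 * C * N / Real.log N * M ≤ 15 * C * N := by
    rw [div_mul_eq_mul_div, div_le_iff₀ (by linarith)]
    have h1 : 2 * M ≤ 15 * Real.log N := by linarith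
    have := mul_le_mul_of_nonneg_left h1 (by positivity : 0 ≤ C * N)
    linarith
  have hsq : Chebyshev.psi s ^ 2 ≤ 49 * N := by
    have h1 := psi_le_seven_mul (Nat.cast_nonneg (α := ℝ) s)
    have h2 := Chebyshev.psi_nonneg (s : ℝ)
    nlinarith
  have hsq0 := sq_nonneg (Chebyshev.psi s)
  obtain ⟨hE3, hE4⟩ := abs_le.mp (hE.trans hE2)
  have e1 : (N : ℝ) * (2 * M - Real.log N) ≤ N * 14 :=
    mul_le_mul_of_nonneg_left (by linarith) hN0.le
  have e2 : (N : ℝ) * (-16) ≤ N * (2 * M - Real.log N) :=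
    mul_le_mul_of_nonneg_left (by linarith) hN0.le
  rw [abs_le]
  constructor <;> nlinarith

lemma sum_divisorsAntidiagonal_moebius_mul_log_sq {n : ℕ} (hn : 0 < n) :
    ∑ x ∈ n.divisorsAntidiagonal, (ArithmeticFunction.moebius x.1 : ℝ) * Real.log x.2 ^ 2 =
      ArithmeticFunction.vonMangoldt n * Real.log n +
        ∑ x ∈ n.divisorsAntidiagonal,
          ArithmeticFunction.vonMangoldt x.1 * ArithmeticFunction.vonMangoldt x.2 := by
  set L : ArithmeticFunction ℝ :=
    ArithmeticFunction.vonMangoldt.pmul ArithmeticFunction.log with hL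
  have h1 : ∀ m : ℕ, m > 0 → ∑ i ∈ m.divisors,
      (L + ArithmeticFunction.vonMangoldt * ArithmeticFunction.vonMangoldt) i =
        Real.log m ^ 2 := by
    intro m hm
    rw [← ArithmeticFunction.coe_mul_zeta_apply, add_mul, mul_assoc,
      ArithmeticFunction.vonMangoldt_mul_zeta, ArithmeticFunction.add_apply,
      ArithmeticFunction.coe_mul_zeta_apply, ArithmeticFunction.mul_apply,
      ← Nat.sum_divisorsAntidiagonal (fun i _ => L i), ← Finset.sum_add_distrib, sq]
    nth_rewrite 1 [← ArithmeticFunction.vonMangoldt_sum]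
    rw [← Nat.sum_divisorsAntidiagonal (fun i _ => ArithmeticFunction.vonMangoldt i),
      Finset.sum_mul]
    refine Finset.sum_congr rfl fun x hx => ?_
    obtain ⟨hx1, hx2⟩ := Nat.mem_divisorsAntidiagonal.mp hx
    have hx3 : (x.1 : ℝ) ≠ 0 := by
      have := left_ne_zero_of_mul (hx1.trans_ne hx2)
      positivity
    have hx4 : (x.2 : ℝ) ≠ 0 := by
      have := right_ne_zero_of_mul (hx1.trans_ne hx2)
      positivity
    rw [← hx1, Nat.cast_mul, Real.log_mul hx3 hx4, hL, ArithmeticFunction.pmul_apply,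
      ArithmeticFunction.log_apply, ArithmeticFunction.log_apply]
    ring
  have h2 := ArithmeticFunction.sum_eq_iff_sum_mul_moebius_eq.mp h1 n hn
  rw [h2, ArithmeticFunction.add_apply, ArithmeticFunction.mul_apply, hL,
    ArithmeticFunction.pmul_apply, ArithmeticFunction.log_apply]

lemma vonMangoldtTwo_eq {n : ℕ} (hn : 0 < n) :
    vonMangoldtTwo n = ArithmeticFunction.vonMangoldt n * Real.log n +
      ∑ x ∈ n.divisorsAntidiagonal,
        ArithmeticFunction.vonMangoldt x.1 * ArithmeticFunction.vonMangoldt x.2 := by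
  rw [← sum_divisorsAntidiagonal_moebius_mul_log_sq hn, vonMangoldtTwo,
    Nat.sum_divisorsAntidiagonal
      (fun a b => (ArithmeticFunction.moebius a : ℝ) * Real.log b ^ 2)]
  refine Finset.sum_congr rfl fun d hd => ?_
  have hd0 : (d : ℝ) ≠ 0 := by exact_mod_cast (Nat.pos_of_mem_divisors hd).ne'
  rw [Nat.cast_div (Nat.dvd_of_mem_divisors hd) hd0]

lemma sum_vonMangoldtTwo_mul_eq (f : ℕ → ℝ) (N : ℕ) :
    ∑ n ∈ Ioc 0 N, vonMangoldtTwo n * f n =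
      ∑ n ∈ Ioc 0 N, ArithmeticFunction.vonMangoldt n * Real.log n * f n +
      ∑ q ∈ Ioc 0 N ×ˢ Ioc 0 N with q.1 * q.2 ≤ N,
        ArithmeticFunction.vonMangoldt q.1 * ArithmeticFunction.vonMangoldt q.2 *
          f (q.1 * q.2) := by
  trans ∑ n ∈ Ioc 0 N, (ArithmeticFunction.vonMangoldt n * Real.log n * f n +
    ∑ q ∈ Ioc 0 N ×ˢ Ioc 0 N with q.1 * q.2 = n,
      ArithmeticFunction.vonMangoldt q.1 * ArithmeticFunction.vonMangoldt q.2 * f (q.1 * q.2))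
  · refine Finset.sum_congr rfl fun n hn => ?_
    obtain ⟨hn0, hnN⟩ := Finset.mem_Ioc.mp hn
    rw [vonMangoldtTwo_eq hn0, add_mul, Finset.sum_mul,
      Nat.divisorsAntidiagonal_eq_prod_filter_of_le hn0.ne' hnN]
    congr 1
    refine Finset.sum_congr rfl fun q hq => ?_
    rw [(Finset.mem_filter.mp hq).2]
  · rw [Finset.sum_add_distrib]
    congr 1
    simp_rw [Finset.sum_filter]
    rw [Finset.sum_comm]
    exact Finset.sum_congr rfl fun _ _ => by simp_all

lemma sum_le_tsum_of_cover {α β : Type*} (S : Finset α) (φ : β → α) (u : α → ℝ) {v : β → ℝ}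
    (hv : Summable v) (hv0 : ∀ q, 0 ≤ v q)
    (h : ∀ a ∈ S, u a ≤ 0 ∨ ∃ q, φ q = a ∧ u a ≤ v q) :
    ∑ a ∈ S, u a ≤ ∑' q, v q := by
  classical
  set T := S.filter (0 < u ·) with hT
  have h1 : ∀ a : T, ∃ q, φ q = a ∧ u a ≤ v q := fun a => by
    obtain ⟨ha, hpos⟩ := Finset.mem_filter.mp a.2
    exact (h a ha).resolve_left (not_le.mpr hpos)
  choose g hg1 hg2 using h1
  have hginj : Function.Injective g := fun a b hab => Subtype.ext (by rw [← hg1, ← hg1, hab])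
  calc ∑ a ∈ S, u a ≤ ∑ a ∈ T, u a := by
        rw [← Finset.sum_filter_add_sum_filter_not S (0 < u ·)]
        have : ∑ a ∈ S with ¬ 0 < u a, u a ≤ 0 :=
          Finset.sum_nonpos fun a ha => not_lt.mp (Finset.mem_filter.mp ha).2
        linarith
    _ = ∑ a : T, u a := (Finset.sum_coe_sort T u).symm
    _ ≤ ∑ a : T, v (g a) := Finset.sum_le_sum fun a _ => hg2 a
    _ = ∑ q ∈ Finset.univ.map ⟨g, hginj⟩, v q := by rw [Finset.sum_map]; rfl
    _ ≤ ∑' q, v q := hv.sum_le_tsum _ fun q _ => hv0 q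

lemma sum_pairs_mul_le {u v : ℕ → ℝ} (hu : ∀ n, 0 ≤ u n) {K S : ℝ} {N : ℕ} (hK : 0 ≤ K)
    (hv : ∀ M : ℕ, ∑ n ∈ Ioc 0 M, v n ≤ K * M)
    (hS : ∑ n ∈ Ioc 0 N, u n / n ≤ S) :
    ∑ q ∈ Ioc 0 N ×ˢ Ioc 0 N with q.1 * q.2 ≤ N, u q.1 * v q.2 ≤ K * S * N := by
  have h1 : ∑ q ∈ Ioc 0 N ×ˢ Ioc 0 N with q.1 * q.2 ≤ N, u q.1 * v q.2 =
      ∑ a ∈ Ioc 0 N, u a * ∑ b ∈ Ioc 0 (N / a), v b := by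
    rw [Finset.sum_filter, Finset.sum_product]
    refine Finset.sum_congr rfl fun a ha => ?_
    rw [← Finset.sum_filter, Finset.mul_sum]
    refine Finset.sum_congr ?_ fun _ _ => rfl
    obtain ⟨ha0, haN⟩ := Finset.mem_Ioc.mp ha
    ext b
    simp only [Finset.mem_filter, Finset.mem_Ioc]
    rw [Nat.le_div_iff_mul_le ha0, mul_comm b]
    refine ⟨fun h => ⟨h.1.1, h.2⟩, fun h => ⟨⟨h.1, ?_⟩, h.2⟩⟩
    exact (Nat.le_mul_of_pos_left b ha0).trans h.2
  rw [h1]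
  calc _ ≤ ∑ a ∈ Ioc 0 N, u a * (K * (N / a)) := by
        refine Finset.sum_le_sum fun a _ => mul_le_mul_of_nonneg_left ?_ (hu a)
        exact (hv _).trans (mul_le_mul_of_nonneg_left Nat.cast_div_le hK)
    _ = K * N * ∑ a ∈ Ioc 0 N, u a / a := by
        rw [Finset.mul_sum]
        exact Finset.sum_congr rfl fun a _ => by ring
    _ ≤ K * N * S := mul_le_mul_of_nonneg_left hS (by positivity)
    _ = K * S * N := by ring

lemma log_le_four_mul_rpow {x : ℝ} (hx : 0 ≤ x) : Real.log x ≤ 4 * x ^ (1 / 4 : ℝ) := by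
  refine (Real.log_le_rpow_div hx (by norm_num : (0 : ℝ) < 1 / 4)).trans (le_of_eq ?_)
  ring

lemma log_mul_one_add_log_div_sq_le {p : ℕ} (hp : 1 ≤ p) :
    Real.log p * (1 + Real.log p) / p ^ 2 ≤ 20 * (p : ℝ) ^ (-(3 / 2) : ℝ) := by
  have hp' : (1 : ℝ) ≤ p := by exact_mod_cast hp
  have hp0 : (0 : ℝ) < p := by positivity
  have h1 := log_le_four_mul_rpow hp0.le
  have h2 : (1 : ℝ) ≤ (p : ℝ) ^ (1 / 4 : ℝ) := Real.one_le_rpow hp' (by norm_num)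
  have h3 : (p : ℝ) ^ (-(3 / 2) : ℝ) * p ^ 2 = p ^ (1 / 4 : ℝ) * p ^ (1 / 4 : ℝ) := by
    rw [← Real.rpow_natCast, ← Real.rpow_add hp0, ← Real.rpow_add hp0]
    norm_num
  have h4 := Real.log_nonneg hp'
  rw [div_le_iff₀ (by positivity), mul_assoc, h3]
  calc _ ≤ (4 * (p : ℝ) ^ (1 / 4 : ℝ)) * (5 * (p : ℝ) ^ (1 / 4 : ℝ)) := by
        gcongr
        linarith
    _ = _ := by ring

lemma inv_pow_le_mul_half_pow {p : ℕ} (hp : 2 ≤ p) {k : ℕ} (hk : 2 ≤ k) :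
    ((p : ℝ) ^ k)⁻¹ ≤ 4 / p ^ 2 * (1 / 2) ^ k := by
  obtain ⟨m, rfl⟩ := Nat.exists_eq_add_of_le hk
  have hp' : (2 : ℝ) ≤ p := by exact_mod_cast hp
  have h1 : (2 : ℝ) ^ m ≤ (p : ℝ) ^ m := by gcongr
  have h2 : (4 : ℝ) / p ^ 2 * (1 / 2) ^ (2 + m) = ((p : ℝ) ^ 2 * 2 ^ m)⁻¹ := by
    rw [pow_add, one_div, inv_pow, inv_pow, mul_inv]
    ring
  rw [h2, pow_add]
  gcongr

lemma summable_rpow_neg_mul_mul_geometric :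
    Summable fun q : ℕ × ℕ => (q.1 : ℝ) ^ (-(3 / 2) : ℝ) * ((1 + q.2) * (5 / 8 : ℝ) ^ q.2) := by
  have h1 : Summable fun n : ℕ => (n : ℝ) ^ (-(3 / 2) : ℝ) :=
    Real.summable_nat_rpow.mpr (by norm_num)
  have h2 : Summable fun n : ℕ => (1 + n : ℝ) * (5 / 8 : ℝ) ^ n := by
    have h3 := summable_geometric_of_lt_one (r := (5 / 8 : ℝ)) (by norm_num) (by norm_num)
    have h4 := summable_pow_mul_geometric_of_norm_lt_one 1 (r := (5 / 8 : ℝ)) (by norm_num)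
    refine (h3.add h4).congr fun n => ?_
    ring
  exact h1.mul_of_nonneg h2 (fun n => by positivity) (fun n => by positivity)

lemma summable_rpow_neg_mul_geometric_mul_geometric :
    Summable fun q : ℕ × ℕ × ℕ =>
      (q.1 : ℝ) ^ (-(3 / 2) : ℝ) * ((5 / 8 : ℝ) ^ q.2.1 * (5 / 8 : ℝ) ^ q.2.2) := by
  have h1 : Summable fun n : ℕ => (n : ℝ) ^ (-(3 / 2) : ℝ) :=
    Real.summable_nat_rpow.mpr (by norm_num)
  have h3 := summable_geometric_of_lt_one (r := (5 / 8 : ℝ)) (by norm_num) (by norm_num)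
  have h4 := h3.mul_of_nonneg h3 (fun n => by positivity) (fun n => by positivity)
  exact h1.mul_of_nonneg h4 (fun n => by positivity) (fun n => by positivity)

lemma exists_sum_vonMangoldt_mul_abs_sub_le {f : ℕ → ℝ} {A c : ℝ} (hA : 0 ≤ A) (hc : |c| ≤ A)
    (hfpow : ∀ p k : ℕ, p.Prime → |f (p ^ k)| ≤ A * (5 / 4) ^ k)
    (hfp : ∀ p : ℕ, p.Prime → |f p - c| ≤ A / p) :
    ∃ S : ℝ, 0 ≤ S ∧ ∀ N : ℕ,
      ∑ n ∈ Ioc 0 N, ArithmeticFunction.vonMangoldt n * |f n - c| * (1 + Real.log n) / n ≤ S := by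
  have hv0 : ∀ q : ℕ × ℕ, 0 ≤
      160 * A * ((q.1 : ℝ) ^ (-(3 / 2) : ℝ) * ((1 + q.2) * (5 / 8 : ℝ) ^ q.2)) := fun q => by
    positivity
  refine ⟨_, tsum_nonneg hv0, fun N => sum_le_tsum_of_cover _ (fun q : ℕ × ℕ => q.1 ^ q.2) _
    (summable_rpow_neg_mul_mul_geometric.mul_left (160 * A)) hv0 fun n hn => ?_⟩
  by_cases hpp : IsPrimePow n
  swap
  · left
    simp [ArithmeticFunction.vonMangoldt_eq_zero_iff.mpr hpp]
  right
  obtain ⟨p, k, hp, hk, rfl⟩ := (isPrimePow_nat_iff n).mp hpp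
  refine ⟨(p, k), rfl, ?_⟩
  have hp1 : (1 : ℝ) ≤ p := by exact_mod_cast hp.one_lt.le
  have hp0 : (0 : ℝ) < p := by linarith
  have hlog : 0 ≤ Real.log p := Real.log_nonneg hp1
  rw [ArithmeticFunction.vonMangoldt_apply_pow hk.ne',
    ArithmeticFunction.vonMangoldt_apply_prime hp, Nat.cast_pow, Real.log_pow]
  have key : |f (p ^ k) - c| / (p : ℝ) ^ k ≤ 8 * A * (5 / 8) ^ k / p ^ 2 := by
    rcases Nat.lt_or_ge k 2 with hk2 | hk2
    · obtain rfl : k = 1 := by lia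
      rw [pow_one, pow_one, pow_one]
      have := hfp p hp
      calc _ ≤ A / p / p := by gcongr
        _ = A / p ^ 2 := by rw [div_div, sq]
        _ ≤ _ := by
          gcongr
          linarith
    · have h1 : |f (p ^ k) - c| ≤ 2 * A * (5 / 4) ^ k := by
        have h2 := hfpow p k hp
        have h3 := abs_sub (f (p ^ k)) c
        have h4 : A * 1 ≤ A * (5 / 4 : ℝ) ^ k := by
          gcongr
          exact one_le_pow₀ (by norm_num)
        linarith
      calc _ = |f (p ^ k) - c| * ((p : ℝ) ^ k)⁻¹ := by rw [div_eq_mul_inv]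
        _ ≤ (2 * A * (5 / 4) ^ k) * (4 / p ^ 2 * (1 / 2) ^ k) := by
          gcongr
          exact inv_pow_le_mul_half_pow hp.two_le hk2
        _ = _ := by
          rw [show (5 / 8 : ℝ) = 5 / 4 * (1 / 2) by norm_num, mul_pow]
          ring
  have key2 : 1 + k * Real.log p ≤ (1 + k) * (1 + Real.log p) := by
    have : (0 : ℝ) ≤ k := Nat.cast_nonneg k
    nlinarith
  calc _ = Real.log p * (|f (p ^ k) - c| / (p : ℝ) ^ k) * (1 + k * Real.log p) := by ring
    _ ≤ Real.log p * (8 * A * (5 / 8) ^ k / p ^ 2) * ((1 + k) * (1 + Real.log p)) := by gcongr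
    _ = 8 * A * ((1 + k) * (5 / 8) ^ k) * (Real.log p * (1 + Real.log p) / p ^ 2) := by ring
    _ ≤ 8 * A * ((1 + k) * (5 / 8) ^ k) * (20 * (p : ℝ) ^ (-(3 / 2) : ℝ)) := by
      gcongr
      exact log_mul_one_add_log_div_sq_le hp.one_lt.le
    _ = _ := by
      push_cast
      ring

lemma exists_sum_not_coprime_vonMangoldt_le {f : ℕ → ℝ} {A : ℝ} (hA : 0 ≤ A)
    (hfpow : ∀ p k : ℕ, p.Prime → |f (p ^ k)| ≤ A * (5 / 4) ^ k) :
    ∃ S : ℝ, 0 ≤ S ∧ ∀ T : Finset (ℕ × ℕ), ∑ q ∈ T with ¬ q.1.Coprime q.2,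
      ArithmeticFunction.vonMangoldt q.1 * ArithmeticFunction.vonMangoldt q.2 *
        |f (q.1 * q.2) - f q.1 * f q.2| / (q.1 * q.2) ≤ S := by
  have hv0 : ∀ q : ℕ × ℕ × ℕ, 0 ≤ 80 * (A + A ^ 2) *
      ((q.1 : ℝ) ^ (-(3 / 2) : ℝ) * ((5 / 8 : ℝ) ^ q.2.1 * (5 / 8 : ℝ) ^ q.2.2)) := fun q => by
    positivity
  refine ⟨_, tsum_nonneg hv0, fun T => sum_le_tsum_of_cover _
    (fun q : ℕ × ℕ × ℕ => (q.1 ^ q.2.1, q.1 ^ q.2.2)) _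
    (summable_rpow_neg_mul_geometric_mul_geometric.mul_left (80 * (A + A ^ 2))) hv0 ?_⟩
  rintro ⟨a, b⟩ hq
  have hab : ¬ a.Coprime b := (Finset.mem_filter.mp hq).2
  dsimp only
  by_cases hpa : IsPrimePow a
  swap
  · left
    simp [ArithmeticFunction.vonMangoldt_eq_zero_iff.mpr hpa]
  by_cases hpb : IsPrimePow b
  swap
  · left
    simp [ArithmeticFunction.vonMangoldt_eq_zero_iff.mpr hpb]
  right
  obtain ⟨p, i, hp, hi, rfl⟩ := (isPrimePow_nat_iff a).mp hpa
  obtain ⟨p', j, hp', hj, rfl⟩ := (isPrimePow_nat_iff b).mp hpb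
  obtain rfl : p = p' := by
    by_contra hne
    exact hab (Nat.coprime_pow_primes i j hp hp' hne)
  refine ⟨(p, i, j), rfl, ?_⟩
  have hp1 : (1 : ℝ) ≤ p := by exact_mod_cast hp.one_lt.le
  have hp0 : (0 : ℝ) < p := by linarith
  have hlog : 0 ≤ Real.log p := Real.log_nonneg hp1
  rw [ArithmeticFunction.vonMangoldt_apply_pow hi.ne',
    ArithmeticFunction.vonMangoldt_apply_pow hj.ne',
    ArithmeticFunction.vonMangoldt_apply_prime hp, Nat.cast_pow, Nat.cast_pow, ← pow_add,
    ← pow_add]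
  have h1 : |f (p ^ (i + j)) - f (p ^ i) * f (p ^ j)| ≤ (A + A ^ 2) * (5 / 4) ^ (i + j) := by
    have h2 := abs_sub (f (p ^ (i + j))) (f (p ^ i) * f (p ^ j))
    rw [abs_mul] at h2
    have h3 : |f (p ^ i)| * |f (p ^ j)| ≤ (A * (5 / 4) ^ i) * (A * (5 / 4) ^ j) := by
      gcongr
      · exact hfpow p i hp
      · exact hfpow p j hp
    have h4 := hfpow p (i + j) hp
    calc _ ≤ A * (5 / 4) ^ (i + j) + (A * (5 / 4) ^ i) * (A * (5 / 4) ^ j) := by linarith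
      _ = _ := by ring
  calc _ = Real.log p * Real.log p * |f (p ^ (i + j)) - f (p ^ i) * f (p ^ j)| *
        ((p : ℝ) ^ (i + j))⁻¹ := by rw [div_eq_mul_inv]
    _ ≤ Real.log p * (1 + Real.log p) * ((A + A ^ 2) * (5 / 4) ^ (i + j)) *
        (4 / p ^ 2 * (1 / 2) ^ (i + j)) := by
      gcongr
      · linarith
      · exact inv_pow_le_mul_half_pow hp.two_le (by lia)
    _ = 4 * (A + A ^ 2) * (5 / 8) ^ (i + j) * (Real.log p * (1 + Real.log p) / p ^ 2) := by
      rw [show (5 / 8 : ℝ) = 5 / 4 * (1 / 2) by norm_num, mul_pow]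
      ring
    _ ≤ 4 * (A + A ^ 2) * (5 / 8) ^ (i + j) * (20 * (p : ℝ) ^ (-(3 / 2) : ℝ)) := by
      gcongr
      exact log_mul_one_add_log_div_sq_le hp.one_lt.le
    _ = _ := by
      rw [pow_add]
      ring

theorem exists_abs_sum_vonMangoldtTwo_mul_sub_le {f : ℕ → ℝ} {A c : ℝ} (hc : |c| ≤ A)
    (hfpow : ∀ p k : ℕ, p.Prime → |f (p ^ k)| ≤ A * (5 / 4) ^ k)
    (hfp : ∀ p : ℕ, p.Prime → |f p - c| ≤ A / p)
    (hmul : ∀ a b : ℕ, a ≠ 0 → b ≠ 0 → a.Coprime b → f (a * b) = f a * f b) :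
    ∃ C : ℝ, ∀ N : ℕ,
      |∑ n ∈ Ioc 0 N, vonMangoldtTwo n * f n - (c ^ 2 + c) * (N * Real.log N)| ≤ C * N := by
  have hA : 0 ≤ A := (abs_nonneg c).trans hc
  obtain ⟨S, hS0, hS⟩ := exists_sum_vonMangoldt_mul_abs_sub_le hA hc hfpow hfp
  obtain ⟨S', hS'0, hS'⟩ := exists_sum_not_coprime_vonMangoldt_le hA hfpow
  obtain ⟨C₁, hC₁, h₁⟩ := exists_abs_sum_vonMangoldt_mul_log_sub_le
  obtain ⟨C₂, hC₂, h₂⟩ := exists_abs_sum_vonMangoldt_pairs_sub_le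
  set Λ := ArithmeticFunction.vonMangoldt
  have hΛ : ∀ n, 0 ≤ Λ n := fun n => ArithmeticFunction.vonMangoldt_nonneg
  have hlog : ∀ n : ℕ, 0 ≤ Real.log n := fun n => Real.log_natCast_nonneg n
  set h : ℕ → ℝ := fun n => Λ n * |f n - c| with hh
  have hh0 : ∀ n, 0 ≤ h n := fun n => mul_nonneg (hΛ n) (abs_nonneg _)
  have hsum : ∀ N : ℕ, ∑ n ∈ Ioc 0 N, h n / n ≤ S := fun N => by
    refine le_trans (Finset.sum_le_sum fun n _ => ?_) (hS N)
    have : h n * 1 ≤ h n * (1 + Real.log n) :=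
      mul_le_mul_of_nonneg_left (by linarith [hlog n]) (hh0 n)
    gcongr
    linarith
  have hsumlog : ∀ N : ℕ, ∑ n ∈ Ioc 0 N, h n * Real.log n ≤ S * N := fun N => by
    calc _ ≤ ∑ n ∈ Ioc 0 N, h n * (1 + Real.log n) / n * N := by
          refine Finset.sum_le_sum fun n hn => ?_
          obtain ⟨hn0, hnN⟩ := Finset.mem_Ioc.mp hn
          have hn0' : (0 : ℝ) < n := by positivity
          have hnN' : (n : ℝ) ≤ N := by exact_mod_cast hnN
          rw [div_mul_eq_mul_div, le_div_iff₀ hn0']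
          have := mul_nonneg (hh0 n) (hlog n)
          have h3 := hh0 n
          calc _ ≤ h n * (1 + Real.log n) * n := by gcongr; linarith
            _ ≤ _ := by
              have := hlog n
              gcongr
      _ ≤ S * N := by
          rw [← Finset.sum_mul]
          exact mul_le_mul_of_nonneg_right (hS N) (Nat.cast_nonneg N)
  have hψ : ∀ M : ℕ, ∑ n ∈ Ioc 0 M, Λ n ≤ 7 * M := fun M => by
    rw [← psi_natCast]
    exact psi_le_seven_mul (Nat.cast_nonneg M)
  have hsumh : ∀ M : ℕ, ∑ n ∈ Ioc 0 M, h n ≤ S * M := fun M => by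
    calc _ ≤ ∑ n ∈ Ioc 0 M, h n / n * M := by
          refine Finset.sum_le_sum fun n hn => ?_
          obtain ⟨hn0, hnN⟩ := Finset.mem_Ioc.mp hn
          have hn0' : (0 : ℝ) < n := by positivity
          have hnN' : (n : ℝ) ≤ M := by exact_mod_cast hnN
          rw [div_mul_eq_mul_div, le_div_iff₀ hn0']
          exact mul_le_mul_of_nonneg_left hnN' (hh0 n)
      _ ≤ S * M := by
          rw [← Finset.sum_mul]
          exact mul_le_mul_of_nonneg_right (hsum M) (Nat.cast_nonneg M)
  have hsumf : ∀ M : ℕ, ∑ n ∈ Ioc 0 M, Λ n * |f n| ≤ (S + A * 7) * M := fun M => by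
    calc _ ≤ ∑ n ∈ Ioc 0 M, (h n + A * Λ n) := by
          refine Finset.sum_le_sum fun n _ => ?_
          have h3 : |f n| ≤ |f n - c| + A := by
            have := abs_sub_abs_le_abs_sub (f n) c
            linarith
          have := mul_le_mul_of_nonneg_left h3 (hΛ n)
          rw [hh]
          linarith
      _ ≤ _ := by
          rw [Finset.sum_add_distrib, ← Finset.mul_sum]
          have := mul_le_mul_of_nonneg_left (hψ M) hA
          linarith [hsumh M]
  refine ⟨S + A * C₁ + S' + (S + A * 7) * S + A * (S * 7) + A ^ 2 * C₂, fun N => ?_⟩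
  rw [sum_vonMangoldtTwo_mul_eq]
  set P := (Ioc 0 N ×ˢ Ioc 0 N).filter fun q : ℕ × ℕ => q.1 * q.2 ≤ N with hP
  have e1 : |∑ n ∈ Ioc 0 N, Λ n * Real.log n * f n - c * ∑ n ∈ Ioc 0 N, Λ n * Real.log n| ≤
      S * N := by
    rw [Finset.mul_sum, ← Finset.sum_sub_distrib]
    refine (Finset.abs_sum_le_sum_abs _ _).trans (le_trans (Finset.sum_le_sum fun n _ => ?_)
      (hsumlog N))
    rw [show Λ n * Real.log n * f n - c * (Λ n * Real.log n) =
      (Λ n * Real.log n) * (f n - c) by ring, abs_mul,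
      abs_of_nonneg (mul_nonneg (hΛ n) (hlog n))]
    exact le_of_eq (by rw [hh]; ring)
  have e2 : |∑ q ∈ P, Λ q.1 * Λ q.2 * f (q.1 * q.2) - ∑ q ∈ P, Λ q.1 * Λ q.2 * (f q.1 * f q.2)| ≤
      S' * N := by
    rw [← Finset.sum_sub_distrib]
    refine le_trans (Finset.abs_sum_le_sum_abs _ _) ?_
    have hS'P := hS' P
    rw [Finset.sum_filter] at hS'P
    refine le_trans ?_ (mul_le_mul_of_nonneg_right hS'P (Nat.cast_nonneg N))
    rw [Finset.sum_mul]
    refine Finset.sum_le_sum fun q hq => ?_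
    obtain ⟨hq1, hq2⟩ := Finset.mem_filter.mp hq
    obtain ⟨hqa, hqb⟩ := Finset.mem_product.mp hq1
    have ha0 := (Finset.mem_Ioc.mp hqa).1
    have hb0 := (Finset.mem_Ioc.mp hqb).1
    split_ifs with hco
    · rw [hmul _ _ ha0.ne' hb0.ne' hco]
      simp
    · have hq3 : (q.1 * q.2 : ℝ) ≤ N := by exact_mod_cast hq2
      rw [← mul_sub, abs_mul, abs_of_nonneg (mul_nonneg (hΛ _) (hΛ _)), div_mul_eq_mul_div,
        le_div_iff₀ (by positivity)]
      exact mul_le_mul_of_nonneg_left hq3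
        (mul_nonneg (mul_nonneg (hΛ _) (hΛ _)) (abs_nonneg _))
  have e3 : |∑ q ∈ P, Λ q.1 * Λ q.2 * (f q.1 * f q.2) - c * ∑ q ∈ P, Λ q.1 * Λ q.2 * f q.2| ≤
      (S + A * 7) * S * N := by
    rw [Finset.mul_sum, ← Finset.sum_sub_distrib]
    refine (Finset.abs_sum_le_sum_abs _ _).trans
      (le_trans (Finset.sum_le_sum fun q _ => ?_)
        (sum_pairs_mul_le hh0 (by positivity) hsumf (hsum N)))
    rw [show Λ q.1 * Λ q.2 * (f q.1 * f q.2) - c * (Λ q.1 * Λ q.2 * f q.2) =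
      Λ q.1 * Λ q.2 * ((f q.1 - c) * f q.2) by ring, abs_mul,
      abs_of_nonneg (mul_nonneg (hΛ _) (hΛ _)), abs_mul]
    exact le_of_eq (by rw [hh]; ring)
  have e4 : |∑ q ∈ P, Λ q.1 * Λ q.2 * f q.2 - c * ∑ q ∈ P, Λ q.1 * Λ q.2| ≤ S * 7 * N := by
    rw [Finset.mul_sum, ← Finset.sum_sub_distrib]
    have hswap : ∑ q ∈ P, h q.1 * Λ q.2 = ∑ q ∈ P, h q.2 * Λ q.1 := by
      refine Finset.sum_nbij' Prod.swap Prod.swap ?_ ?_ (by simp) (by simp) (by simp)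
      · intro q; simp [P, mul_comm q.1]; tauto
      · intro q; simp [P, mul_comm q.1]; tauto
    have hle := sum_pairs_mul_le hh0 (by norm_num : (0 : ℝ) ≤ 7) hψ (hsum N)
    rw [← hP, hswap, mul_comm 7] at hle
    refine (Finset.abs_sum_le_sum_abs _ _).trans
      (le_trans (Finset.sum_le_sum fun q _ => ?_) hle)
    rw [show Λ q.1 * Λ q.2 * f q.2 - c * (Λ q.1 * Λ q.2) =
      Λ q.1 * Λ q.2 * (f q.2 - c) by ring, abs_mul,
      abs_of_nonneg (mul_nonneg (hΛ _) (hΛ _))]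
    exact le_of_eq (by rw [hh]; ring)
  have hc2 : |c ^ 2| ≤ A ^ 2 := by
    rw [abs_pow]
    gcongr
  have hmulabs : ∀ {a x B X : ℝ}, |a| ≤ B → |x| ≤ X → |a * x| ≤ B * X := fun ha hx => by
    rw [abs_mul]
    exact mul_le_mul ha hx (abs_nonneg _) ((abs_nonneg _).trans ha)
  have e5 := hmulabs hc (h₁ N)
  have e6 := hmulabs hc e4
  have e7 := hmulabs hc2 (h₂ N)
  rw [← hP] at e7
  rw [abs_le] at *
  constructor <;> nlinarith

lemma tauR_succ_prime_pow (r : ℕ) {p : ℕ} (hp : p.Prime) (k : ℕ) :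
    tauR (r + 1) (p ^ k) = ∑ i ∈ range (k + 1), tauR r (p ^ i) := by
  rw [tauR, pow_succ, ArithmeticFunction.mul_zeta_apply, Nat.sum_divisors_prime_pow hp]
  rfl

lemma tauR_one (r : ℕ) : tauR r 1 = 1 := by
  induction r with
  | zero => simp [tauR]
  | succ r ih =>
    have := tauR_succ_prime_pow r Nat.prime_two 0
    simpa [ih] using this

lemma tauR_prime (r : ℕ) {p : ℕ} (hp : p.Prime) : tauR r p = r := by
  induction r with
  | zero => simp [tauR, hp.ne_one]
  | succ r ih =>
    have := tauR_succ_prime_pow r hp 1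
    simpa [Finset.sum_range_succ, tauR_one, ih, add_comm] using this

lemma exists_tauR_prime_pow_le (r : ℕ) : ∃ C : ℝ, 1 ≤ C ∧ ∀ p k : ℕ, p.Prime →
    (tauR r (p ^ k) : ℝ) ≤ C * (5 / 4) ^ k := by
  induction r with
  | zero =>
    refine ⟨1, le_rfl, fun p k hp => ?_⟩
    have h1 : (1 : ℝ) ≤ (5 / 4) ^ k := one_le_pow₀ (by norm_num)
    have h2 : tauR 0 (p ^ k) ≤ 1 := by
      rw [tauR, pow_zero, ArithmeticFunction.one_apply]
      split_ifs <;> simp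
    have h3 : (tauR 0 (p ^ k) : ℝ) ≤ 1 := by exact_mod_cast h2
    linarith
  | succ r ih =>
    obtain ⟨C, hC, h⟩ := ih
    refine ⟨C * 5, by linarith, fun p k hp => ?_⟩
    rw [tauR_succ_prime_pow r hp, Nat.cast_sum]
    calc _ ≤ ∑ i ∈ range (k + 1), C * (5 / 4 : ℝ) ^ i := Finset.sum_le_sum fun i _ => h p i hp
      _ = C * (5 * (5 / 4) ^ k - 4) := by
        rw [← Finset.mul_sum, geom_sum_eq (by norm_num), pow_succ]
        ring
      _ ≤ C * 5 * (5 / 4) ^ k := by linarith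

lemma summable_div_prime_pow {a : ℕ → ℝ} {B : ℝ} (hB : 0 ≤ B)
    (ha : ∀ j, |a j| ≤ B * (25 / 16) ^ j) {p : ℕ} (hp : 2 ≤ p) :
    (Summable fun j => a j / (p : ℝ) ^ j) ∧ |∑' j, a j / (p : ℝ) ^ j| ≤ 5 * B ∧
      |∑' j, a j / (p : ℝ) ^ j - a 0| ≤ 8 * B / p := by
  have hp' : (2 : ℝ) ≤ p := by exact_mod_cast hp
  have hbd : ∀ j, ‖a j / (p : ℝ) ^ j‖ ≤ B * (25 / 32) ^ j := fun j => by
    rw [Real.norm_eq_abs, abs_div, abs_of_nonneg (by positivity : (0 : ℝ) ≤ (p : ℝ) ^ j),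
      show (25 / 32 : ℝ) = 25 / 16 / 2 by norm_num, div_pow (25 / 16 : ℝ), ← mul_div_assoc]
    gcongr
    exact ha j
  have hg := hasSum_geometric_of_lt_one (r := (25 / 32 : ℝ)) (by norm_num) (by norm_num)
  have hs : Summable fun j => a j / (p : ℝ) ^ j :=
    Summable.of_norm_bounded (hg.summable.mul_left B) hbd
  refine ⟨hs, ?_, ?_⟩
  · have := tsum_of_norm_bounded (hg.mul_left B) hbd
    rw [Real.norm_eq_abs] at this
    refine this.trans ?_
    norm_num
    linarith
  · rw [hs.tsum_eq_zero_add, pow_zero, div_one, add_sub_cancel_left]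
    have hbd' : ∀ j, ‖a (j + 1) / (p : ℝ) ^ (j + 1)‖ ≤ B * (25 / 16) / p * (25 / 32) ^ j := by
      intro j
      rw [Real.norm_eq_abs, abs_div,
        abs_of_nonneg (by positivity : (0 : ℝ) ≤ (p : ℝ) ^ (j + 1)),
        show (25 / 32 : ℝ) = 25 / 16 / 2 by norm_num, div_pow (25 / 16 : ℝ),
        div_mul_div_comm, mul_assoc, ← pow_succ', pow_succ' (p : ℝ)]
      gcongr
      exact ha (j + 1)
    have := tsum_of_norm_bounded (hg.mul_left (B * (25 / 16) / p)) hbd'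
    rw [Real.norm_eq_abs] at this
    refine this.trans ?_
    rw [div_mul_eq_mul_div]
    refine div_le_div_of_nonneg_right ?_ (by positivity)
    norm_num
    linarith

lemma ratio_bounds {t v : ℕ → ℝ} {C : ℝ} (hC : 1 ≤ C) (ht0 : ∀ j, 0 ≤ t j) (hv0 : ∀ j, 0 ≤ v j)
    (ht : ∀ j, t j ≤ C * (5 / 4) ^ j) (hv : ∀ j, v j ≤ C * (5 / 4) ^ j) (ht1 : t 0 = 1)
    (hv1 : v 0 = 1) {p : ℕ} (hp : 2 ≤ p) :
    (∀ e, |(∑' j, t (e + j) * v j / (p : ℝ) ^ j) / ∑' j, t j * v j / (p : ℝ) ^ j| ≤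
      5 * C ^ 2 * (5 / 4) ^ e) ∧
    |(∑' j, t (1 + j) * v j / (p : ℝ) ^ j) / (∑' j, t j * v j / (p : ℝ) ^ j) - t 1| ≤
      20 * C ^ 3 / p := by
  have hp0 : (0 : ℝ) < p := by positivity
  have hbd : ∀ e j, |t (e + j) * v j| ≤ C ^ 2 * (5 / 4) ^ e * (25 / 16) ^ j := fun e j => by
    rw [abs_of_nonneg (mul_nonneg (ht0 _) (hv0 _))]
    calc _ ≤ (C * (5 / 4) ^ (e + j)) * (C * (5 / 4) ^ j) := by
          gcongr
          · exact hv0 j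
          · exact ht _
          · exact hv j
      _ = _ := by
        rw [show (25 / 16 : ℝ) = 5 / 4 * (5 / 4) by norm_num, mul_pow, pow_add]
        ring
  have hbd0 : ∀ j, |t j * v j| ≤ C ^ 2 * (25 / 16) ^ j := fun j => by simpa using hbd 0 j
  obtain ⟨hs, -, hD⟩ := summable_div_prime_pow (by positivity) hbd0 hp
  set D := ∑' j, t j * v j / (p : ℝ) ^ j
  have hD1 : 1 ≤ D := by
    have := hs.sum_le_tsum {0} fun j _ => div_nonneg (mul_nonneg (ht0 j) (hv0 j)) (by positivity)
    simpa [ht1, hv1] using this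
  have hD0 : 0 < D := by linarith
  constructor
  · intro e
    obtain ⟨-, h1, -⟩ := summable_div_prime_pow (by positivity) (hbd e) hp
    rw [abs_div, abs_of_pos hD0]
    exact (div_le_self (abs_nonneg _) hD1).trans (by linarith)
  · obtain ⟨-, -, h1⟩ := summable_div_prime_pow (by positivity) (hbd 1) hp
    set G := ∑' j, t (1 + j) * v j / (p : ℝ) ^ j
    rw [add_zero, hv1, mul_one] at h1
    rw [ht1, hv1, mul_one] at hD
    rw [div_sub' hD0.ne', abs_div, abs_of_pos hD0]
    refine (div_le_self (abs_nonneg _) hD1).trans ?_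
    have h2 : |t 1 * (D - 1)| ≤ (C * (5 / 4)) * (8 * C ^ 2 / p) := by
      rw [abs_mul, abs_of_nonneg (ht0 1)]
      gcongr
      simpa using ht 1
    have h3 : |G - D * t 1| ≤ |G - t 1| + |t 1 * (D - 1)| := by
      rw [show G - D * t 1 = (G - t 1) - t 1 * (D - 1) by ring]
      exact abs_sub _ _
    have h4 : C ^ 2 ≤ C ^ 3 := pow_le_pow_right₀ hC (by norm_num)
    calc _ ≤ 8 * (C ^ 2 * (5 / 4) ^ 1) / p + (C * (5 / 4)) * (8 * C ^ 2 / p) := by linarith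
      _ = (10 * C ^ 2 + 10 * C ^ 3) / p := by ring
      _ ≤ _ := by
        gcongr
        linarith

lemma prod_primeFactors_mul_of_coprime (g : ℕ → ℕ → ℝ) {a b : ℕ} (hab : a.Coprime b) :
    ∏ p ∈ (a * b).primeFactors, g p ((a * b).factorization p) =
      (∏ p ∈ a.primeFactors, g p (a.factorization p)) *
        ∏ p ∈ b.primeFactors, g p (b.factorization p) := by
  rw [hab.primeFactors_mul, Finset.prod_union hab.disjoint_primeFactors]
  congr 1
  · exact Finset.prod_congr rfl fun p hp => by
      rw [Nat.factorization_eq_of_coprime_left hab (by simpa using hp)]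
  · exact Finset.prod_congr rfl fun p hp => by
      rw [Nat.factorization_eq_of_coprime_right hab (by simpa using hp)]

lemma exists_abs_sum_sub_le_of_eq_prod (r : ℕ) {v : ℕ → ℕ → ℝ} {C : ℝ}
    (hv0 : ∀ p j, 0 ≤ v p j) (hv : ∀ p j, p.Prime → v p j ≤ C * (5 / 4) ^ j)
    (hv1 : ∀ p, v p 0 = 1) {f : ℕ → ℝ}
    (hf : ∀ n, f n = ∏ p ∈ n.primeFactors,
      (∑' j : ℕ, (tauR r (p ^ (n.factorization p + j)) : ℝ) * v p j / p ^ j) /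
        (∑' j : ℕ, (tauR r (p ^ j) : ℝ) * v p j / p ^ j)) :
    ∃ K : ℝ, ∀ N : ℕ,
      |∑ n ∈ Ioc 0 N, vonMangoldtTwo n * f n - ((r : ℝ) ^ 2 + r) * (N * Real.log N)| ≤ K * N := by
  obtain ⟨C', hC', ht⟩ := exists_tauR_prime_pow_le r
  set M := max C C'
  have hM : 1 ≤ M := hC'.trans (le_max_right _ _)
  have hratio : ∀ p : ℕ, p.Prime → _ := fun p hp =>
    ratio_bounds (t := fun j => (tauR r (p ^ j) : ℝ)) (v := v p) hM (fun j => Nat.cast_nonneg _)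
      (hv0 p)
      (fun j => (ht p j hp).trans (by gcongr; exact le_max_right _ _))
      (fun j => (hv p j hp).trans (by gcongr; exact le_max_left _ _))
      (by simp [tauR_one]) (hv1 p) hp.two_le
  have hfpp : ∀ p k : ℕ, p.Prime → k ≠ 0 → f (p ^ k) =
      (∑' j : ℕ, (tauR r (p ^ (k + j)) : ℝ) * v p j / p ^ j) /
        (∑' j : ℕ, (tauR r (p ^ j) : ℝ) * v p j / p ^ j) := fun p k hp hk => by
    rw [hf, Nat.primeFactors_prime_pow hk hp, Finset.prod_singleton, hp.factorization_pow,
      Finsupp.single_eq_same]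
  have hM2 : M ^ 2 ≤ M ^ 3 := pow_le_pow_right₀ hM (by norm_num)
  have hM3 : (1 : ℝ) ≤ M ^ 3 := one_le_pow₀ hM
  refine exists_abs_sum_vonMangoldtTwo_mul_sub_le (A := 20 * M ^ 3 + r) ?_ (fun p k hp => ?_)
    (fun p hp => ?_) fun a b _ _ hab => ?_
  · rw [abs_of_nonneg (Nat.cast_nonneg r)]
    linarith
  · have hr : (0 : ℝ) ≤ r := Nat.cast_nonneg r
    rcases Nat.eq_zero_or_pos k with rfl | hk
    · rw [hf]
      simp
      linarith
    · rw [hfpp p k hp hk.ne']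
      refine ((hratio p hp).1 k).trans ?_
      gcongr
      linarith
  · have h1 := (hratio p hp).2
    have h2 := hfpp p 1 hp one_ne_zero
    rw [pow_one] at h2
    rw [h2]
    simp only [pow_one, tauR_prime r hp] at h1
    refine h1.trans ?_
    gcongr
    have hr : (0 : ℝ) ≤ r := Nat.cast_nonneg r
    linarith
  · rw [hf, hf, hf]
    exact prod_primeFactors_mul_of_coprime (fun p e =>
      (∑' j : ℕ, (tauR r (p ^ (e + j)) : ℝ) * v p j / p ^ j) /
        (∑' j : ℕ, (tauR r (p ^ j) : ℝ) * v p j / p ^ j)) hab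

lemma exists_abs_sum_mul_fOne_or_fTwo_sub_le (r : ℕ) {f : ℕ → ℝ} (hf : f = fOne r ∨ f = fTwo r) :
    ∃ K : ℝ, ∀ N : ℕ,
      |∑ n ∈ Ioc 0 N, vonMangoldtTwo n * f n - ((r : ℝ) ^ 2 + r) * (N * Real.log N)| ≤ K * N := by
  rcases hf with rfl | rfl
  · refine exists_abs_sum_sub_le_of_eq_prod r (v := fun _ _ => 1) (C := 1) (fun _ _ => zero_le_one)
      (fun p j _ => ?_) (fun _ => rfl) fun n => ?_
    · rw [one_mul]
      exact one_le_pow₀ (by norm_num)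
    · simp only [mul_one]
      rfl
  · obtain ⟨C, -, ht⟩ := exists_tauR_prime_pow_le r
    refine exists_abs_sum_sub_le_of_eq_prod r (v := fun p j => (tauR r (p ^ j) : ℝ)) (C := C)
      (fun _ _ => Nat.cast_nonneg _) ht (fun p => by simp [tauR_one]) fun n => ?_
    simp only [fTwo, sq]

/-- Fix `r ∈ ℕ` and let `i ∈ {1, 2}`. Then
`Σ_{n ≤ x} Λ₂(n) f_i(n) = (r² + r) x (log x) (1 + O(1/log x))` as `x → ∞`. -/
theorem sum_vonMangoldtTwo_mul_fi (r : ℕ) (hr : 1 ≤ r) (f : ℕ → ℝ)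
    (hf : f = fOne r ∨ f = fTwo r) :
    (fun x : ℝ =>
        (∑ n ∈ Finset.Icc 1 ⌊x⌋₊, vonMangoldtTwo n * f n) -
          ((r ^ 2 + r : ℕ) : ℝ) * x * Real.log x)
      =O[atTop] fun x : ℝ => ((r ^ 2 + r : ℕ) : ℝ) * x * Real.log x / Real.log x := by
  obtain ⟨K, hK⟩ := exists_abs_sum_mul_fOne_or_fTwo_sub_le r hf
  set c : ℝ := ((r ^ 2 + r : ℕ) : ℝ) with hc
  have hc' : c = (r : ℝ) ^ 2 + r := by
    rw [hc]
    push_cast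
    rfl
  have hc1 : 1 ≤ c := by
    rw [hc]
    exact_mod_cast (by nlinarith : 1 ≤ r ^ 2 + r)
  refine Asymptotics.IsBigO.of_bound (|K| + 2 * c) ?_
  filter_upwards [eventually_ge_atTop (2 : ℝ)] with x hx
  have hx0 : 0 < x := by linarith
  have hlog : 0 < Real.log x := Real.log_pos (by linarith)
  rw [mul_div_cancel_right₀ _ hlog.ne', Real.norm_eq_abs, Real.norm_eq_abs,
    abs_of_pos (by positivity : 0 < c * x)]
  set N := ⌊x⌋₊ with hN
  have hNx : (N : ℝ) ≤ x := Nat.floor_le hx0.le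
  have hxN : x < N + 1 := Nat.lt_floor_add_one x
  have hN1 : (1 : ℝ) ≤ N := by exact_mod_cast Nat.le_floor (by norm_num; linarith)
  have h1 := hK N
  rw [← hc', show Ioc 0 N = Finset.Icc 1 N from rfl] at h1
  have h2 : |x * Real.log x - N * Real.log N| ≤ 2 * x := by
    have h3 : Real.log N ≤ Real.log x := Real.log_le_log (by linarith) hNx
    have h4 : Real.log x - Real.log N ≤ 1 / N := by
      rw [← Real.log_div hx0.ne' (by positivity)]
      refine (Real.log_le_sub_one_of_pos (by positivity)).trans ?_
      rw [div_sub_one (by positivity)]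
      gcongr
      linarith
    rw [le_div_iff₀ (by positivity)] at h4
    have h5 := Real.log_le_sub_one_of_pos hx0
    have h6 : 0 ≤ Real.log N := Real.log_nonneg hN1
    rw [abs_le]
    constructor <;> nlinarith
  calc _ ≤ |∑ n ∈ Finset.Icc 1 N, vonMangoldtTwo n * f n - c * (N * Real.log N)| +
        |c * (x * Real.log x - N * Real.log N)| := by
        refine le_trans (le_of_eq ?_) (abs_sub _ _)
        congr 1
        ring
    _ ≤ |K| * x + c * (2 * x) := by
        rw [abs_mul, abs_of_pos (by linarith : 0 < c)]
        gcongr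
        refine h1.trans ?_
        gcongr
        exact le_abs_self K
    _ ≤ (|K| + 2 * c) * (c * x) := by
        have : (|K| + 2 * c) * x * 1 ≤ (|K| + 2 * c) * x * c := by gcongr
        linarith
end

section
/- With the resonator coefficients f = f_M as defined, Σ_{nu ≤ M} f(u) f(nu)/√n = Q₁ (1 + o(1)) as M → ∞, where Q₁ = Π_p (1 + f(p)² + f(p)/√p). -/
open Filter Finset
open scoped Classical

/-- `L = √(log M · log log M)` for the resonator parameter `M`. -/
noncomputable def resL (M : ℕ) : ℝ := Real.sqrt (Real.log M * Real.log (Real.log M))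

/-- The value of the resonator coefficients at a prime `p`:
`f(p) = L/(√p log p)` if `L² ≤ p ≤ exp((log L)²)`, and `f(p) = 0` otherwise. -/
noncomputable def resFp (M p : ℕ) : ℝ :=
  if resL M ^ 2 ≤ (p : ℝ) ∧ (p : ℝ) ≤ Real.exp (Real.log (resL M) ^ 2) then
    resL M / (Real.sqrt p * Real.log p)
  else 0

/-- The resonator coefficients `f = f_M`: the multiplicative function supported on squarefree
integers determined by its values `resFp` at primes. -/
noncomputable def resF (M n : ℕ) : ℝ :=
  if Squarefree n then ∏ p ∈ n.primeFactors, resFp M p else 0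

/-- `Q₁ = Π_p (1 + f(p)² + f(p)/√p)`. -/
noncomputable def resQ1 (M : ℕ) : ℝ :=
  ∏ᶠ p ∈ {p : ℕ | p.Prime}, (1 + resFp M p ^ 2 + resFp M p / Real.sqrt p)

/-- `Q₂ = Π_p (1 + f(p)²)`. -/
noncomputable def resQ2 (M : ℕ) : ℝ :=
  ∏ᶠ p ∈ {p : ℕ | p.Prime}, (1 + resFp M p ^ 2)

/-- The multiplicative function `g` supported on squarefree integers with `g(p) = 1 + f(p)²`. -/
noncomputable def resG (M n : ℕ) : ℝ :=
  if Squarefree n then ∏ p ∈ n.primeFactors, (1 + resFp M p ^ 2) else 0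

namespace ArithmeticFunction

theorem sum_Ioc_vonMangoldt_mul_div (N : ℕ) :
    ∑ n ∈ Ioc 0 N, vonMangoldt n * ((N / n : ℕ) : ℝ) = Real.log (N.factorial) := by
  rw [← sum_Ioc_mul_zeta_eq_sum, vonMangoldt_mul_zeta]
  induction N with
  | zero => simp
  | succ k ih =>
    rw [Finset.sum_Ioc_succ_top (by omega), ih, Nat.factorial_succ, Nat.cast_mul,
      Real.log_mul (by positivity) (by positivity), log_apply, add_comm]

theorem sum_Ioc_vonMangoldt_div_ge {N : ℕ} (hN : N ≠ 0) :
    Real.log N - 1 ≤ ∑ n ∈ Ioc 0 N, vonMangoldt n / n := by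
  have hN' : (0 : ℝ) < N := by positivity
  have hN1 : (1 : ℝ) ≤ N := by exact_mod_cast Nat.one_le_iff_ne_zero.2 hN
  have h1 : Real.log N.factorial ≤ N * ∑ n ∈ Ioc 0 N, vonMangoldt n / n := by
    rw [← sum_Ioc_vonMangoldt_mul_div, mul_sum]
    refine sum_le_sum fun n _ ↦ ?_
    calc vonMangoldt n * ((N / n : ℕ) : ℝ) ≤ vonMangoldt n * ((N : ℝ) / n) :=
          mul_le_mul_of_nonneg_left Nat.cast_div_le vonMangoldt_nonneg
      _ = N * (vonMangoldt n / n) := by ring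
  have h2 := Stirling.le_log_factorial_stirling hN
  have h3 : 0 ≤ Real.log N := Real.log_nonneg hN1
  have h4 : 0 ≤ Real.log (2 * Real.pi) := Real.log_nonneg (by linarith [Real.pi_gt_three])
  nlinarith

theorem sum_Ioc_vonMangoldt_div_le {N : ℕ} (hN : N ≠ 0) :
    ∑ n ∈ Ioc 0 N, vonMangoldt n / n ≤ Real.log N + (Real.log 4 + 4) := by
  have hN' : (0 : ℝ) < N := by positivity
  have h1 : N * ∑ n ∈ Ioc 0 N, vonMangoldt n / n ≤
      Real.log N.factorial + Chebyshev.psi N := by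
    rw [← sum_Ioc_vonMangoldt_mul_div, mul_sum, Chebyshev.psi, Nat.floor_natCast,
      ← sum_add_distrib]
    refine sum_le_sum fun n hn ↦ ?_
    have h : (N : ℝ) / n ≤ ((N / n : ℕ) : ℝ) + 1 := by
      have := Nat.lt_floor_add_one ((N : ℝ) / n)
      rw [Nat.floor_div_natCast, Nat.floor_natCast] at this
      exact this.le
    calc (N : ℝ) * (vonMangoldt n / n) = vonMangoldt n * ((N : ℝ) / n) := by ring
      _ ≤ vonMangoldt n * (((N / n : ℕ) : ℝ) + 1) :=
          mul_le_mul_of_nonneg_left h vonMangoldt_nonneg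
      _ = _ := by ring
  have h2 : Real.log N.factorial ≤ N * Real.log N := by
    rw [← Real.log_pow]
    exact Real.log_le_log (by positivity) (by exact_mod_cast N.factorial_le_pow)
  have h3 := Chebyshev.psi_le_const_mul_self hN'.le
  refine le_of_mul_le_mul_left ?_ hN'
  linarith

theorem sum_Icc_vonMangoldt_div_le {a N : ℕ} (ha : a ≠ 0) (haN : a ≤ N) :
    ∑ n ∈ Icc a N, vonMangoldt n / n ≤ Real.log N - Real.log a + (Real.log 4 + 6) := by
  have h1 := sum_Ioc_vonMangoldt_div_le (N := N) (by omega)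
  have h2 := sum_Ioc_vonMangoldt_div_ge ha
  have h3 : vonMangoldt a / a ≤ 1 := by
    have : (0 : ℝ) < a := by positivity
    rw [div_le_one this]
    exact vonMangoldt_le_log.trans (Real.log_le_self this.le)
  rw [← add_sum_Ioc_eq_sum_Icc haN]
  have h4 := sum_Ioc_consecutive (fun n ↦ vonMangoldt n / n) (Nat.zero_le a) haN
  linarith

theorem sum_Icc_vonMangoldt_div_log_sq_le {a N : ℕ} (ha : 2 ≤ a) (haN : a ≤ N) :
    ∑ n ∈ Icc a N, vonMangoldt n / (n * Real.log n ^ 2) ≤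
      1 / Real.log a + (Real.log 4 + 6) / Real.log a ^ 2 := by
  suffices h : ∑ n ∈ Icc a N, vonMangoldt n / (n * Real.log n ^ 2) +
      (Real.log N - Real.log a + (Real.log 4 + 6) - ∑ n ∈ Icc a N, vonMangoldt n / n) /
        Real.log N ^ 2 ≤
      1 / Real.log a - 1 / Real.log N + (Real.log 4 + 6) / Real.log a ^ 2 by
    have h1 := sum_Icc_vonMangoldt_div_le (by omega) haN
    have h2 : 0 ≤ (Real.log N - Real.log a + (Real.log 4 + 6) -
      ∑ n ∈ Icc a N, vonMangoldt n / n) / Real.log N ^ 2 := by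
      apply div_nonneg _ (by positivity)
      linarith
    have h3 : 0 ≤ 1 / Real.log N := by positivity
    linarith
  induction N, haN using Nat.le_induction with
  | base =>
    simp only [Icc_self, sum_singleton]
    apply le_of_eq
    ring
  | succ k hk ih =>
    have h0 := sum_Icc_vonMangoldt_div_le (by omega) hk
    rw [← insert_Icc_right_eq_Icc_add_one (by omega), sum_insert (by simp), sum_insert (by simp)]
    set S := ∑ n ∈ Icc a k, vonMangoldt n / n
    set T := ∑ n ∈ Icc a k, vonMangoldt n / (n * Real.log n ^ 2)
    set D := Real.log 4 + 6
    set v := vonMangoldt (k + 1)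
    have hx : 0 < Real.log k := Real.log_pos (by exact_mod_cast (by omega : 1 < k))
    have hxy : Real.log k ≤ Real.log (k + 1 : ℕ) :=
      Real.log_le_log (by exact_mod_cast (by omega : 0 < k)) (by push_cast; linarith)
    set x := Real.log k
    set y := Real.log (k + 1 : ℕ)
    have hy : 0 < y := hx.trans_le hxy
    have h1 : (x - Real.log a + D - S) / y ^ 2 ≤ (x - Real.log a + D - S) / x ^ 2 := by
      apply div_le_div_of_nonneg_left (by linarith) (by positivity)
      gcongr
    have h2 : (y - x) / y ^ 2 ≤ 1 / x - 1 / y := by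
      rw [div_sub_div _ _ hx.ne' hy.ne', one_mul, mul_one, sq]
      apply div_le_div_of_nonneg_left (by linarith) (by positivity)
      gcongr
    have h3 : v / ((k + 1 : ℕ) * y ^ 2) + T + (y - Real.log a + D - (v / (k + 1 : ℕ) + S)) / y ^ 2
       = T + (x - Real.log a + D - S) / y ^ 2 + (y - x) / y ^ 2 := by
      field_simp
      ring
    linarith

end ArithmeticFunction

namespace Finset

theorem sum_Icc_sum_Icc_div_eq_sum_divisorsAntidiagonal {R : Type*} [AddCommMonoid R]
    (F : ℕ → ℕ → R) (N : ℕ) :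
    ∑ n ∈ Icc 1 N, ∑ m ∈ Icc 1 (N / n), F n m =
      ∑ k ∈ Icc 1 N, ∑ x ∈ k.divisorsAntidiagonal, F x.1 x.2 := by
  rw [sum_sigma', sum_sigma']
  refine sum_bij' (fun x _ ↦ ⟨x.1 * x.2, (x.1, x.2)⟩) (fun x _ ↦ ⟨x.2.1, x.2.2⟩) ?_ ?_ ?_ ?_ ?_
  · rintro ⟨n, m⟩ h
    simp only [mem_sigma, mem_Icc, Nat.mem_divisorsAntidiagonal] at h ⊢
    obtain ⟨⟨h1, h2⟩, h3, h4⟩ := h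
    have h5 : 1 ≤ n * m := Nat.mul_pos h1 h3
    have h6 : n * m ≤ N := (Nat.mul_le_mul_left n h4).trans (Nat.mul_div_le N n)
    exact ⟨⟨h5, h6⟩, trivial, by omega⟩
  · rintro ⟨k, n, m⟩ h
    simp only [mem_sigma, mem_Icc, Nat.mem_divisorsAntidiagonal] at h ⊢
    obtain ⟨⟨h1, h2⟩, rfl, h4⟩ := h
    have hn : 0 < n := Nat.pos_of_mul_pos_right h1
    have hm : 0 < m := Nat.pos_of_mul_pos_left h1
    refine ⟨⟨hn, (Nat.le_mul_of_pos_right n hm).trans h2⟩, hm, ?_⟩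
    rw [Nat.le_div_iff_mul_le hn, mul_comm]
    exact h2
  · rintro ⟨n, m⟩ h
    rfl
  · rintro ⟨k, n, m⟩ h
    simp only [mem_sigma, mem_Icc, Nat.mem_divisorsAntidiagonal] at h ⊢
    obtain ⟨⟨h1, h2⟩, rfl, h4⟩ := h
    rfl
  · rintro ⟨n, m⟩ h
    rfl

end Finset

theorem Nat.sqrt_eq_prod_primeFactors {n : ℕ} (hn : Squarefree n) :
    √(n : ℝ) = ∏ p ∈ n.primeFactors, √(p : ℝ) := by
  conv_lhs => rw [← Nat.prod_primeFactors_of_squarefree hn]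
  rw [Nat.cast_prod, Real.sqrt_prod]
  intro i _
  positivity

/-- The common weight `f(p)² + f(p)/√p` of a prime in the main sum and in `Q₁`. -/
noncomputable def resWeight (M p : ℕ) : ℝ := resFp M p ^ 2 + resFp M p / √(p : ℝ)

theorem sum_divisorsAntidiagonal_resF {M m : ℕ} (hm : Squarefree m) :
    ∑ x ∈ m.divisorsAntidiagonal, resF M x.2 * resF M (x.1 * x.2) / √(x.1 : ℝ) =
      ∏ p ∈ m.primeFactors, resWeight M p := by
  have h := ArithmeticFunction.IsMultiplicative.prodPrimeFactors_add_of_squarefree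
    (ArithmeticFunction.IsMultiplicative.prodPrimeFactors fun p ↦ (√(p : ℝ))⁻¹)
    (ArithmeticFunction.IsMultiplicative.prodPrimeFactors (resFp M)) hm
  rw [ArithmeticFunction.prodPrimeFactors_apply hm.ne_zero, ArithmeticFunction.mul_apply] at h
  calc _ = resF M m * ∑ x ∈ m.divisorsAntidiagonal,
        ArithmeticFunction.prodPrimeFactors (fun p ↦ (√(p : ℝ))⁻¹) x.1 *
          ArithmeticFunction.prodPrimeFactors (resFp M) x.2 := by
        rw [mul_sum]
        refine sum_congr rfl fun x hx ↦ ?_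
        obtain ⟨rfl, h0⟩ := Nat.mem_divisorsAntidiagonal.1 hx
        have h1 : Squarefree x.1 := hm.of_mul_left
        have h2 : Squarefree x.2 := hm.of_mul_right
        rw [ArithmeticFunction.prodPrimeFactors_apply h1.ne_zero,
          ArithmeticFunction.prodPrimeFactors_apply h2.ne_zero, prod_inv_distrib,
          ← Nat.sqrt_eq_prod_primeFactors h1]
        rw [resF, if_pos h2]
        ring
    _ = _ := by
        rw [← h, resF, if_pos hm, ← prod_mul_distrib]
        refine prod_congr rfl fun p hp ↦ ?_
        have hp := Nat.prime_of_mem_primeFactors hp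
        rw [ArithmeticFunction.add_apply, ArithmeticFunction.prodPrimeFactors_apply hp.ne_zero,
          ArithmeticFunction.prodPrimeFactors_apply hp.ne_zero, hp.primeFactors, prod_singleton,
          prod_singleton, resWeight]
        ring

theorem sum_resF_eq_sum_squarefree (M : ℕ) :
    ∑ n ∈ Icc 1 M, ∑ u ∈ Icc 1 (M / n), resF M u * resF M (n * u) / √(n : ℝ) =
      ∑ m ∈ Icc 1 M with Squarefree m, ∏ p ∈ m.primeFactors, resWeight M p := by
  rw [sum_Icc_sum_Icc_div_eq_sum_divisorsAntidiagonal
    (fun n u ↦ resF M u * resF M (n * u) / √(n : ℝ)), sum_filter]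
  refine sum_congr rfl fun m _ ↦ ?_
  split_ifs with hm
  · exact sum_divisorsAntidiagonal_resF hm
  · refine sum_eq_zero fun x hx ↦ ?_
    rw [(Nat.mem_divisorsAntidiagonal.1 hx).1, resF.eq_1 M m, if_neg hm]
    simp

/-- The primes on which the resonator coefficients are supported. -/
noncomputable def resPrimes (M : ℕ) : Finset ℕ :=
  {p ∈ Icc ⌈resL M ^ 2⌉₊ ⌊Real.exp (Real.log (resL M) ^ 2)⌋₊ | p.Prime}

theorem mem_resPrimes {M p : ℕ} : p ∈ resPrimes M ↔
    (resL M ^ 2 ≤ (p : ℝ) ∧ (p : ℝ) ≤ Real.exp (Real.log (resL M) ^ 2)) ∧ p.Prime := by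
  rw [resPrimes, mem_filter, mem_Icc, Nat.ceil_le, Nat.le_floor_iff (Real.exp_pos _).le]

theorem resWeight_eq_zero {M p : ℕ} (hp : p.Prime) (h : p ∉ resPrimes M) : resWeight M p = 0 := by
  have h' : ¬ (resL M ^ 2 ≤ (p : ℝ) ∧ (p : ℝ) ≤ Real.exp (Real.log (resL M) ^ 2)) :=
    fun h' ↦ h (mem_resPrimes.2 ⟨h', hp⟩)
  simp [resWeight, resFp, if_neg h']

theorem resWeight_nonneg (M p : ℕ) : 0 ≤ resWeight M p := by
  have : 0 ≤ resFp M p := by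
    unfold resFp
    split_ifs
    · exact div_nonneg (Real.sqrt_nonneg _)
        (mul_nonneg (Real.sqrt_nonneg _) (Real.log_natCast_nonneg p))
    · rfl
  unfold resWeight
  positivity

theorem resQ1_eq_prod (M : ℕ) : resQ1 M = ∏ p ∈ resPrimes M, (1 + resWeight M p) := by
  unfold resQ1
  rw [finprod_mem_eq_prod_of_inter_mulSupport_eq (t := resPrimes M)]
  · exact prod_congr rfl fun p _ ↦ by rw [resWeight, add_assoc]
  · ext p
    simp only [Set.mem_inter_iff, Set.mem_ofPred_eq, Function.mem_mulSupport, mem_coe]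
    refine and_congr_left fun h ↦ ⟨fun hp ↦ ?_, fun hp ↦ (mem_resPrimes.1 hp).2⟩
    by_contra hp'
    apply h
    rw [add_assoc]
    exact add_eq_left.2 (resWeight_eq_zero hp hp')

theorem resQ1_pos (M : ℕ) : 0 < resQ1 M := by
  rw [resQ1_eq_prod]
  exact prod_pos fun p _ ↦ by linarith [resWeight_nonneg M p]

theorem sum_squarefree_eq_sum_powerset (M : ℕ) :
    ∑ m ∈ Icc 1 M with Squarefree m, ∏ p ∈ m.primeFactors, resWeight M p =
      ∑ s ∈ (resPrimes M).powerset with ∏ p ∈ s, p ≤ M, ∏ p ∈ s, resWeight M p := by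
  have hpr : ∀ s ∈ {s ∈ (resPrimes M).powerset | ∏ p ∈ s, p ≤ M}, ∀ p ∈ s, p.Prime :=
    fun s hs p hp ↦ (mem_resPrimes.1 (mem_powerset.1 (mem_filter.1 hs).1 hp)).2
  symm
  refine sum_of_injOn (fun s ↦ ∏ p ∈ s, p) ?_ ?_ ?_ ?_
  · intro s hs t ht hst
    rw [← Nat.primeFactors_prod (hpr s hs), ← Nat.primeFactors_prod (hpr t ht)]
    exact congrArg Nat.primeFactors hst
  · intro s hs
    have h := hpr s hs
    rw [mem_coe, mem_filter, mem_Icc]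
    refine ⟨⟨Nat.one_le_iff_ne_zero.2 (prod_ne_zero_iff.2 fun p hp ↦ (h p hp).ne_zero),
      (mem_filter.1 hs).2⟩, ?_⟩
    exact Finset.squarefree_prod_of_pairwise_isCoprime
      (fun p hp q hq hpq ↦
        Nat.coprime_iff_isRelPrime.1 ((Nat.coprime_primes (h p hp) (h q hq)).2 hpq))
      (fun p hp ↦ (h p hp).prime.squarefree)
  · intro m hm hm'
    rw [mem_filter, mem_Icc] at hm
    have : ¬ m.primeFactors ⊆ resPrimes M := by
      intro h
      refine hm' ⟨m.primeFactors, ?_, Nat.prod_primeFactors_of_squarefree hm.2⟩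
      rw [mem_coe, mem_filter, mem_powerset, Nat.prod_primeFactors_of_squarefree hm.2]
      exact ⟨h, hm.1.2⟩
    obtain ⟨p, hp, hp'⟩ := not_subset.1 this
    exact prod_eq_zero hp (resWeight_eq_zero (Nat.prime_of_mem_primeFactors hp) hp')
  · intro s hs
    rw [Nat.primeFactors_prod (hpr s hs)]

/-- Rankin's bound for the part of a product of `1 + g p` coming from large products. -/
theorem Finset.prod_one_add_sub_sum_le_rpow_mul_prod {P : Finset ℕ} {g : ℕ → ℝ}
    (hg : ∀ p, 0 ≤ g p) {M : ℕ} (hM : 0 < M) {a : ℝ} (ha : 0 ≤ a) :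
    ∏ p ∈ P, (1 + g p) - ∑ s ∈ P.powerset with ∏ p ∈ s, p ≤ M, ∏ p ∈ s, g p ≤
      (M : ℝ) ^ (-a) * ∏ p ∈ P, (1 + (p : ℝ) ^ a * g p) := by
  have hM' : (0 : ℝ) < M := by positivity
  rw [prod_one_add, prod_one_add, ← sum_filter_add_sum_filter_not P.powerset (∏ p ∈ ·, p ≤ M),
    add_sub_cancel_left, mul_sum]
  refine (sum_le_sum fun s hs ↦ ?_).trans (sum_le_sum_of_subset_of_nonneg (filter_subset _ _) ?_)
  · have hsM : (M : ℝ) ≤ ∏ p ∈ s, (p : ℝ) := by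
      rw [← Nat.cast_prod]
      exact_mod_cast (not_le.1 (mem_filter.1 hs).2).le
    have h1 : 1 ≤ (M : ℝ) ^ (-a) * ∏ p ∈ s, (p : ℝ) ^ a := by
      rw [Real.finsetProd_rpow _ _ fun _ _ ↦ by positivity, Real.rpow_neg hM'.le,
        inv_mul_eq_div, one_le_div (by positivity)]
      exact Real.rpow_le_rpow hM'.le hsM ha
    rw [prod_mul_distrib, ← mul_assoc]
    exact le_mul_of_one_le_left (prod_nonneg fun p _ ↦ hg p) h1
  · intro s _ _
    exact mul_nonneg (by positivity) (prod_nonneg fun p _ ↦ mul_nonneg (by positivity) (hg p))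

theorem Finset.prod_one_add_mul_le_exp_sum_mul {ι : Type*} (P : Finset ι) {g c : ι → ℝ}
    (hg : ∀ p, 0 ≤ g p) (hc : ∀ p ∈ P, 1 ≤ c p) :
    ∏ p ∈ P, (1 + c p * g p) ≤ Real.exp (∑ p ∈ P, (c p - 1) * g p) * ∏ p ∈ P, (1 + g p) := by
  rw [Real.exp_sum, ← prod_mul_distrib]
  refine prod_le_prod (fun p hp ↦ ?_) fun p hp ↦ ?_
  · have := mul_nonneg (zero_le_one.trans (hc p hp)) (hg p)
    linarith
  · have h1 := Real.add_one_le_exp ((c p - 1) * g p)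
    have h2 := mul_nonneg (sub_nonneg.2 (hc p hp)) (hg p)
    nlinarith [hg p, mul_le_mul_of_nonneg_right h1 (add_nonneg zero_le_one (hg p)),
      mul_nonneg h2 (hg p)]

/-- The relative error in the main sum, for any Rankin exponent `a ≥ 0`. -/
theorem norm_sum_resF_sub_resQ1_le {M : ℕ} (hM : 0 < M) {a : ℝ} (ha : 0 ≤ a) :
    ‖∑ n ∈ Icc 1 M, ∑ u ∈ Icc 1 (M / n), resF M u * resF M (n * u) / √(n : ℝ) - resQ1 M‖ ≤
      Real.exp (-a * Real.log M + ∑ p ∈ resPrimes M, ((p : ℝ) ^ a - 1) * resWeight M p) *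
        resQ1 M := by
  have hP : ∀ p ∈ resPrimes M, 0 < p := fun p hp ↦ (mem_resPrimes.1 hp).2.pos
  rw [sum_resF_eq_sum_squarefree, sum_squarefree_eq_sum_powerset, resQ1_eq_prod, norm_sub_rev,
    Real.norm_of_nonneg]
  · refine (prod_one_add_sub_sum_le_rpow_mul_prod (resWeight_nonneg M) hM ha).trans ?_
    rw [Real.exp_add, mul_assoc, Real.rpow_def_of_pos (by positivity), mul_comm (Real.log M)]
    gcongr
    exact prod_one_add_mul_le_exp_sum_mul _ (resWeight_nonneg M) fun p hp ↦
      Real.one_le_rpow (by exact_mod_cast hP p hp) ha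
  · rw [prod_one_add, sub_nonneg]
    exact sum_le_sum_of_subset_of_nonneg (filter_subset _ _)
      fun s _ _ ↦ prod_nonneg fun p _ ↦ resWeight_nonneg M p

theorem resL_pos {M : ℕ} (hL : 1 ≤ Real.log (resL M)) : 0 < resL M := by
  have h0 : 0 ≤ resL M := Real.sqrt_nonneg _
  refine h0.lt_of_ne' fun h ↦ ?_
  rw [h, Real.log_zero] at hL
  linarith

theorem rpow_sub_one_mul_resWeight_le {M p : ℕ} (hp : p ∈ resPrimes M)
    (hL : 1 ≤ Real.log (resL M)) :
    ((p : ℝ) ^ (1 / Real.log (resL M) ^ 3) - 1) * resWeight M p ≤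
      1 / Real.log (resL M) ^ 3 * (1 + 1 / Real.log (resL M)) *
        (resL M ^ 2 * (1 + 6 / Real.log (resL M))) *
          (ArithmeticFunction.vonMangoldt p / (p * Real.log p ^ 2)) := by
  obtain ⟨hp1, hp2⟩ := mem_resPrimes.1 hp
  have hp0 : (0 : ℝ) < p := by exact_mod_cast hp2.pos
  have hlp : 0 < Real.log p := Real.log_pos (by exact_mod_cast hp2.one_lt)
  have hlpl : Real.log p ≤ Real.log (resL M) ^ 2 := by
    rw [← Real.log_exp (Real.log (resL M) ^ 2)]
    exact Real.log_le_log hp0 hp1.2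
  have hLpos := resL_pos hL
  have hw : resWeight M p = resL M ^ 2 / (p * Real.log p ^ 2) + resL M / (p * Real.log p) := by
    rw [resWeight, resFp, if_pos hp1, div_pow, mul_pow, Real.sq_sqrt hp0.le, div_div]
    congr 2
    rw [mul_right_comm, Real.mul_self_sqrt hp0.le]
  have hLl : Real.log (resL M) ^ 2 ≤ resL M * (6 / Real.log (resL M)) := by
    have h := Real.pow_div_factorial_le_exp (Real.log (resL M)) (by linarith) 3
    rw [Real.exp_log hLpos] at h
    rw [← mul_div_assoc, le_div_iff₀ (by linarith)]
    norm_num [Nat.factorial] at h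
    nlinarith
  rw [hw, Real.rpow_def_of_pos hp0, ArithmeticFunction.vonMangoldt_apply_prime hp2]
  set l := Real.log (resL M)
  set L := resL M
  set q := Real.log p
  have hl : 0 < l := by linarith
  set t := q * (1 / l ^ 3) with ht
  have ht0 : 0 ≤ t := by positivity
  have htl : t ≤ 1 / l := by
    calc t ≤ l ^ 2 * (1 / l ^ 3) := by rw [ht]; gcongr
      _ = 1 / l := by field_simp
  have ht1 : t ≤ 1 := htl.trans (by rw [div_le_one hl]; exact hL)
  have hexp : Real.exp t - 1 ≤ t * (1 + 1 / l) := by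
    have h := (abs_le.1 (Real.abs_exp_sub_one_sub_id_le (abs_le.2 ⟨by linarith, ht1⟩))).2
    nlinarith
  calc (Real.exp t - 1) * (L ^ 2 / (p * q ^ 2) + L / (p * q))
      ≤ t * (1 + 1 / l) * (L ^ 2 / (p * q ^ 2) + L / (p * q)) := by gcongr
    _ = 1 / l ^ 3 * (1 + 1 / l) * (L ^ 2 + L * q) * (q / (p * q ^ 2)) := by
      rw [ht]
      field_simp
    _ ≤ 1 / l ^ 3 * (1 + 1 / l) * (L ^ 2 * (1 + 6 / l)) * (q / (p * q ^ 2)) := by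
      gcongr
      nlinarith

theorem sum_rpow_sub_one_mul_resWeight_le {M : ℕ} (hL : 1 ≤ Real.log (resL M)) :
    ∑ p ∈ resPrimes M, ((p : ℝ) ^ (1 / Real.log (resL M) ^ 3) - 1) * resWeight M p ≤
      1 / Real.log (resL M) ^ 3 *
        (resL M ^ 2 / (2 * Real.log (resL M)) * (1 + 83 / Real.log (resL M))) := by
  have hLpos := resL_pos hL
  have hl : 0 < Real.log (resL M) := by linarith
  have hL2 : 2 ≤ resL M ^ 2 := by
    have h := Real.log_le_sub_one_of_pos hLpos
    nlinarith
  have hsum : ∑ p ∈ resPrimes M, ArithmeticFunction.vonMangoldt p / (p * Real.log p ^ 2) ≤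
      1 / (2 * Real.log (resL M)) * (1 + 5 / Real.log (resL M)) := by
    rcases (resPrimes M).eq_empty_or_nonempty with h | ⟨q, hq⟩
    · rw [h, sum_empty]
      positivity
    have hq := mem_Icc.1 (mem_filter.1 hq).1
    have hc : 2 ≤ ⌈resL M ^ 2⌉₊ := by
      exact_mod_cast hL2.trans (Nat.le_ceil _)
    have hlog : 2 * Real.log (resL M) ≤ Real.log ⌈resL M ^ 2⌉₊ := by
      have := Real.log_le_log (by positivity) (Nat.le_ceil (resL M ^ 2))
      rwa [Real.log_pow, Nat.cast_ofNat] at this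
    have h4 := Real.log_le_sub_one_of_pos (x := 4) (by norm_num)
    have h40 : 0 ≤ Real.log 4 := Real.log_nonneg (by norm_num)
    calc _ ≤ ∑ n ∈ Icc ⌈resL M ^ 2⌉₊ ⌊Real.exp (Real.log (resL M) ^ 2)⌋₊,
          ArithmeticFunction.vonMangoldt n / (n * Real.log n ^ 2) :=
          sum_le_sum_of_subset_of_nonneg (filter_subset _ _) fun n _ _ ↦
            div_nonneg ArithmeticFunction.vonMangoldt_nonneg (by positivity)
      _ ≤ _ := ArithmeticFunction.sum_Icc_vonMangoldt_div_log_sq_le hc (hq.1.trans hq.2)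
      _ ≤ 1 / (2 * Real.log (resL M)) + 10 / (2 * Real.log (resL M)) ^ 2 := by
          gcongr
          linarith
      _ = _ := by
          field_simp
          ring
  refine (sum_le_sum fun p hp ↦ rpow_sub_one_mul_resWeight_le hp hL).trans ?_
  rw [← mul_sum]
  refine (mul_le_mul_of_nonneg_left hsum (by positivity)).trans ?_
  set l := Real.log (resL M)
  have hu1 : 1 / l ≤ 1 := by rwa [div_le_one hl]
  have hu0 : 0 ≤ 1 / l := by positivity
  have hpoly : (1 + 1 / l) * (1 + 6 / l) * (1 + 5 / l) ≤ 1 + 83 / l := by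
    rw [div_eq_mul_one_div 6, div_eq_mul_one_div 5, div_eq_mul_one_div 83]
    set u := 1 / l
    have h1 : u ^ 2 ≤ u := by nlinarith
    have h2 : u ^ 3 ≤ u := by nlinarith
    nlinarith
  calc _ = 1 / l ^ 3 * (resL M ^ 2 / (2 * l) * ((1 + 1 / l) * (1 + 6 / l) * (1 + 5 / l))) := by
        ring
    _ ≤ _ := by gcongr

/-- With Rankin's exponent `1 / (log L)³`, the exponent of the relative error tends to `-∞`. -/
theorem resonator_exponent_le {M : ℕ} (hx : 0 < Real.log (Real.log M))
    (hM : 167 ≤ Real.log (Real.log (Real.log M))) :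
    -(1 / Real.log (resL M) ^ 3) * Real.log M +
        ∑ p ∈ resPrimes M, ((p : ℝ) ^ (1 / Real.log (resL M) ^ 3) - 1) * resWeight M p ≤
      -(Real.exp (Real.log (Real.log M)) / Real.log (Real.log M) ^ 4 / 2) := by
  have hlogM : 0 < Real.log M := by
    refine (Real.log_natCast_nonneg M).lt_of_ne' fun h ↦ ?_
    rw [h, Real.log_zero] at hx
    exact hx.false
  have hsq : resL M ^ 2 = Real.log M * Real.log (Real.log M) := Real.sq_sqrt (by positivity)
  have hlog : Real.log (resL M) =
      (Real.log (Real.log M) + Real.log (Real.log (Real.log M))) / 2 := by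
    rw [resL, Real.log_sqrt (by positivity), Real.log_mul hlogM.ne' hx.ne']
  have hyx := Real.log_le_sub_one_of_pos hx
  refine (add_le_add_right (sum_rpow_sub_one_mul_resWeight_le (by rw [hlog]; linarith)) _).trans ?_
  rw [hsq, Real.exp_log hlogM]
  set l := Real.log (resL M)
  set x := Real.log (Real.log M)
  set y := Real.log x
  set m := Real.log M
  have hl : 0 < l := by linarith
  have hlx : l ≤ x := by linarith
  have hxl : x / l ≤ 2 := by
    rw [div_le_iff₀ hl]
    linarith
  calc -(1 / l ^ 3) * m + 1 / l ^ 3 * (m * x / (2 * l) * (1 + 83 / l))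
      = m / (2 * l ^ 4) * (x - 2 * l + 83 * (x / l)) := by
        field_simp
        ring
    _ ≤ m / (2 * l ^ 4) * (-1) := by
        gcongr
        linarith
    _ = -(m / l ^ 4 / 2) := by
        field_simp
    _ ≤ -(m / x ^ 4 / 2) := by
        gcongr

/-- With the resonator coefficients `f = f_M` as defined,
`Σ_{nu ≤ M} f(u) f(nu)/√n = Q₁ (1 + o(1))` as `M → ∞`. -/
theorem resonator_main_sum :
    (fun M : ℕ =>
        (∑ n ∈ Finset.Icc 1 M, ∑ u ∈ Finset.Icc 1 (M / n),
          resF M u * resF M (n * u) / Real.sqrt n) - resQ1 M)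
      =o[atTop] fun M : ℕ => resQ1 M := by
  have h1 : Tendsto (fun M : ℕ ↦ Real.log (Real.log M)) atTop atTop :=
    Real.tendsto_log_atTop.comp (Real.tendsto_log_atTop.comp tendsto_natCast_atTop_atTop)
  have h2 : Tendsto (fun M : ℕ ↦ Real.log (Real.log (Real.log M))) atTop atTop :=
    Real.tendsto_log_atTop.comp h1
  have h3 : Tendsto (fun M : ℕ ↦
      Real.exp (-(Real.exp (Real.log (Real.log M)) / Real.log (Real.log M) ^ 4 / 2)))
      atTop (nhds 0) :=
    Real.tendsto_exp_neg_atTop_nhds_zero.comp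
      (((Real.tendsto_exp_div_pow_atTop 4).comp h1).atTop_div_const two_pos)
  refine Asymptotics.isLittleO_iff.2 fun c hc ↦ ?_
  filter_upwards [eventually_gt_atTop 0, h1.eventually_gt_atTop 0, h2.eventually_ge_atTop 167,
    h3.eventually_le_const hc] with M hM hx hy hexp
  have hl : 0 ≤ Real.log (resL M) := by
    have hlogM : Real.log M ≠ 0 := fun h ↦ by
      rw [h, Real.log_zero] at hx
      exact hx.false
    rw [resL, Real.log_sqrt (mul_nonneg (Real.log_natCast_nonneg M) hx.le),
      Real.log_mul hlogM hx.ne']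
    linarith
  refine (norm_sum_resF_sub_resQ1_le hM (a := 1 / Real.log (resL M) ^ 3) (by positivity)).trans ?_
  rw [Real.norm_of_nonneg (resQ1_pos M).le]
  exact mul_le_mul_of_nonneg_right
    ((Real.exp_le_exp.2 (resonator_exponent_le hx hy)).trans hexp) (resQ1_pos M).le
end
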